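/- Let T > 0 and let ξ₁(t) < ξ₂(t) be continuous functions on [0,T]. Let u be a classical solution of the linear parabolic equation u_t = a(x,t) u_xx + b(x,t) u_x + c(x,t) u on Ω = {(x,t) : ξ₁(t) < x < ξ₂(t), t ∈ (0,T]} with coefficients satisfying the regularity assumption (1.2), and suppose u(·,t) ≢ 0 on I(t) for every t ∈ [0,T]. Assume (H1) holds for both i = 1,2, (H2) holds at every NZ*-moment of wᵢ(t) := u(ξᵢ(t),t), and (H3) holds at every Z-moment of wᵢ (i = 1,2). Then the number Z(t) of zeros of u(·,t) in I(t) = [ξ₁(t), ξ₂(t)] is non-increasing in t on (0,T). -/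

import Mathlib

open Set

/-- spatial partial derivative `u_x` -/
noncomputable def pdx (u : ℝ → ℝ → ℝ) (x t : ℝ) : ℝ := deriv (fun y => u y t) x

/-- second spatial partial derivative `u_xx` -/
noncomputable def pdxx (u : ℝ → ℝ → ℝ) (x t : ℝ) : ℝ := deriv (fun y => pdx u y t) x

/-- time partial derivative `u_t` -/
noncomputable def pdt (u : ℝ → ℝ → ℝ) (x t : ℝ) : ℝ := deriv (fun s => u x s) t

/-- the closure of the space-time domain `Ω` -/
def domCl (xi1 xi2 : ℝ → ℝ) (T : ℝ) : Set (ℝ × ℝ) :=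
  {p : ℝ × ℝ | p.2 ∈ Icc (0:ℝ) T ∧ p.1 ∈ Icc (xi1 p.2) (xi2 p.2)}

/-- the domain together with its lateral boundaries -/
def domLat (xi1 xi2 : ℝ → ℝ) (T : ℝ) : Set (ℝ × ℝ) :=
  {p : ℝ × ℝ | p.2 ∈ Ioc (0:ℝ) T ∧ p.1 ∈ Icc (xi1 p.2) (xi2 p.2)}

/-- `u` is a classical solution of `u_t = a u_xx + b u_x + c u` on
`Ω = {(x,t) : ξ₁(t) < x < ξ₂(t), 0 < t ≤ T}`: it is continuous on the closure, its
partial derivatives `u_t, u_x, u_xx` exist and are continuous up to the lateral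
boundaries, and the equation holds. -/
structure IsClassicalSolution (a b c : ℝ → ℝ → ℝ) (xi1 xi2 : ℝ → ℝ) (T : ℝ)
    (u : ℝ → ℝ → ℝ) : Prop where
  cont : ContinuousOn (fun p : ℝ × ℝ => u p.1 p.2) (domCl xi1 xi2 T)
  diff_x : ∀ p ∈ domLat xi1 xi2 T, DifferentiableAt ℝ (fun y => u y p.2) p.1
  diff_xx : ∀ p ∈ domLat xi1 xi2 T, DifferentiableAt ℝ (fun y => pdx u y p.2) p.1
  diff_t : ∀ p ∈ domLat xi1 xi2 T, DifferentiableAt ℝ (fun s => u p.1 s) p.2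
  cont_x : ContinuousOn (fun p : ℝ × ℝ => pdx u p.1 p.2) (domLat xi1 xi2 T)
  cont_xx : ContinuousOn (fun p : ℝ × ℝ => pdxx u p.1 p.2) (domLat xi1 xi2 T)
  cont_t : ContinuousOn (fun p : ℝ × ℝ => pdt u p.1 p.2) (domLat xi1 xi2 T)
  eqn : ∀ p ∈ domLat xi1 xi2 T,
    pdt u p.1 p.2 =
      a p.1 p.2 * pdxx u p.1 p.2 + b p.1 p.2 * pdx u p.1 p.2 + c p.1 p.2 * u p.1 p.2

/-- the regularity assumption (1.2): `a, a⁻¹, a_t, a_x, a_xx, b, b_t, b_x, c ∈ L^∞`,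
with `a > 0` -/
def Reg12 (a b c : ℝ → ℝ → ℝ) (xi1 xi2 : ℝ → ℝ) (T : ℝ) : Prop :=
  ∃ M : ℝ, ∀ p ∈ domLat xi1 xi2 T,
    0 < a p.1 p.2 ∧
    DifferentiableAt ℝ (fun y => a y p.2) p.1 ∧
    DifferentiableAt ℝ (fun y => pdx a y p.2) p.1 ∧
    DifferentiableAt ℝ (fun s => a p.1 s) p.2 ∧
    DifferentiableAt ℝ (fun y => b y p.2) p.1 ∧
    DifferentiableAt ℝ (fun s => b p.1 s) p.2 ∧
    |a p.1 p.2| ≤ M ∧ |(a p.1 p.2)⁻¹| ≤ M ∧ |pdt a p.1 p.2| ≤ M ∧ |pdx a p.1 p.2| ≤ M ∧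
    |pdxx a p.1 p.2| ≤ M ∧ |b p.1 p.2| ≤ M ∧ |pdt b p.1 p.2| ≤ M ∧ |pdx b p.1 p.2| ≤ M ∧
    |c p.1 p.2| ≤ M

/-- the set of zeroes of `u(·,t)` in `I(t) = [ξ₁(t), ξ₂(t)]` -/
def zeroSet (u : ℝ → ℝ → ℝ) (xi1 xi2 : ℝ → ℝ) (t : ℝ) : Set ℝ :=
  {x ∈ Icc (xi1 t) (xi2 t) | u x t = 0}

/-- `Z(t)`: the (extended-natural) number of zeroes of `u(·,t)` in `I(t)` -/
noncomputable def Znum (u : ℝ → ℝ → ℝ) (xi1 xi2 : ℝ → ℝ) (t : ℝ) : ℕ∞ :=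
  (zeroSet u xi1 xi2 t).encard

/-- `u(·,s)` has a multiple (degenerate) zero in `I(s)` -/
def HasMultipleZero (u : ℝ → ℝ → ℝ) (xi1 xi2 : ℝ → ℝ) (s : ℝ) : Prop :=
  ∃ x₀ ∈ Icc (xi1 s) (xi2 s), u x₀ s = 0 ∧ pdx u x₀ s = 0

/-- the boundary trace `wᵢ(t) := u(ξᵢ(t), t)` -/
def bdryTrace (u : ℝ → ℝ → ℝ) (xi : ℝ → ℝ) : ℝ → ℝ := fun t => u (xi t) t

/-- some left neighborhood of `s` consists entirely of N-moments -/
def leftN (w : ℝ → ℝ) (s : ℝ) : Prop := ∃ ε > 0, ∀ t ∈ Ioo (s - ε) s, w t ≠ 0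

/-- some left neighborhood of `s` consists entirely of Z-moments -/
def leftZ (w : ℝ → ℝ) (s : ℝ) : Prop := ∃ ε > 0, ∀ t ∈ Ioo (s - ε) s, w t = 0

/-- some right neighborhood of `s` consists entirely of N-moments -/
def rightN (w : ℝ → ℝ) (s : ℝ) : Prop := ∃ ε > 0, ∀ t ∈ Ioo s (s + ε), w t ≠ 0

/-- some right neighborhood of `s` consists entirely of Z-moments -/
def rightZ (w : ℝ → ℝ) (s : ℝ) : Prop := ∃ ε > 0, ∀ t ∈ Ioo s (s + ε), w t = 0

/-- `s` is an NZN-moment of `w` -/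
def IsNZN (w : ℝ → ℝ) (s : ℝ) : Prop := w s = 0 ∧ leftN w s ∧ rightN w s

/-- `s` is a ZZZ-moment of `w` -/
def IsZZZ (w : ℝ → ℝ) (s : ℝ) : Prop := w s = 0 ∧ leftZ w s ∧ rightZ w s

/-- `s` is an NZZ-moment of `w` -/
def IsNZZ (w : ℝ → ℝ) (s : ℝ) : Prop := w s = 0 ∧ leftN w s ∧ rightZ w s

/-- `s` is a ZZN-moment of `w` -/
def IsZZN (w : ℝ → ℝ) (s : ℝ) : Prop := w s = 0 ∧ leftZ w s ∧ rightN w s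

/-- `s` is an NZ*-moment of `w` -/
def IsNZstar (w : ℝ → ℝ) (s : ℝ) : Prop := w s = 0 ∧ leftN w s

/-- (H1): on every nondegenerate closed interval of Z-moments of the boundary trace `w`,
the boundary curve `ξ` is `C¹` -/
def H1cond (w xi : ℝ → ℝ) (T : ℝ) : Prop :=
  ∀ p q : ℝ, 0 ≤ p → p < q → q ≤ T → (∀ t ∈ Icc p q, w t = 0) → ContDiffOn ℝ 1 xi (Icc p q)

/-- (H2) at an NZ*-moment `s` of `u(ξ(·),·)`, with sign `σ = (-1)^i`:
`ξ'(s-0)` exists, and `σ · u_x(ξ(s),s) ≥ 0` (resp. `≤ 0`) if `u(ξ(t),t) > 0`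
(resp. `< 0`) shortly before `s`. -/
def H2at (u : ℝ → ℝ → ℝ) (xi : ℝ → ℝ) (σ s : ℝ) : Prop :=
  (∃ L : ℝ, HasDerivWithinAt xi L (Iio s) s) ∧
  ((∃ ε > 0, ∀ t ∈ Ioo (s - ε) s, 0 < u (xi t) t) → 0 ≤ σ * pdx u (xi s) s) ∧
  ((∃ ε > 0, ∀ t ∈ Ioo (s - ε) s, u (xi t) t < 0) → σ * pdx u (xi s) s ≤ 0)

/-- (H3) at a Z-moment `s` of `u(ξ(·),·)`, with sign `σ = (-1)^i`:
`σ · u(ξ(t),t) · u(x,s) ≤ 0` for `t` slightly after `s` and `x ∈ I(s)` near (but not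
equal to) `ξ(s)`. -/
def H3at (u : ℝ → ℝ → ℝ) (xi1 xi2 xi : ℝ → ℝ) (σ s : ℝ) : Prop :=
  ∃ ε > 0, ∃ δ > 0, ∀ t ∈ Ioo s (s + ε), ∀ x ∈ Icc (xi1 s) (xi2 s),
    x ≠ xi s → |x - xi s| < δ → σ * (u (xi t) t * u x s) ≤ 0

/-- (H3) at a Z-moment `s` for the left boundary (`i = 1`, one-boundary setting):
`-u(ξ₁(t),t) · u(x,s) ≤ 0` for `t` slightly after `s` and `x` slightly to the right
of `ξ₁(s)`. -/
def H3one (u : ℝ → ℝ → ℝ) (xi : ℝ → ℝ) (s : ℝ) : Prop :=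
  ∃ ε > 0, ∃ δ > 0, ∀ t ∈ Ioo s (s + ε), ∀ x : ℝ,
    xi s < x → x - xi s < δ → -(u (xi t) t) * u x s ≤ 0

section Helpers
open Topology Filter

lemma cross_theta {θ : ℝ → ℝ} (h : ContinuousOn θ (Icc 0 1)) (hs : ∀ t ∈ Icc (0:ℝ) 1, 0 ≤ Real.sin (θ t))
    (k m : ℤ) (h0 : θ 0 = 2 * Real.pi * k + Real.pi) (h1 : θ 1 = 2 * Real.pi * m) : m = k := by
  have hpi := Real.pi_pos
  rcases lt_trichotomy m k with hlt | heq | hgt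
  · exfalso
    have hmk : (m:ℝ) ≤ k - 1 := by exact_mod_cast Int.le_sub_one_of_lt hlt
    have hmem : 2 * Real.pi * k - Real.pi / 2 ∈ Icc (θ 1) (θ 0) := by
      rw [h0, h1]; constructor <;> nlinarith
    obtain ⟨t, ht, hte⟩ := intermediate_value_Icc' zero_le_one h hmem
    have := hs t ht
    rw [hte] at this
    have e : 2 * Real.pi * k - Real.pi / 2 = -(Real.pi/2) + k * (2 * Real.pi) := by ring
    rw [e, Real.sin_add_int_mul_two_pi, Real.sin_neg, Real.sin_pi_div_two] at this
    linarith
  · exact heq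
  · exfalso
    have hmk : (k:ℝ) + 1 ≤ m := by exact_mod_cast hgt
    have hmem : 2 * Real.pi * k + (Real.pi + Real.pi / 2) ∈ Icc (θ 0) (θ 1) := by
      rw [h0, h1]; constructor <;> nlinarith
    obtain ⟨t, ht, hte⟩ := intermediate_value_Icc zero_le_one h hmem
    have := hs t ht
    rw [hte] at this
    have e : 2 * Real.pi * k + (Real.pi + Real.pi / 2) = (Real.pi/2 + Real.pi) + k * (2 * Real.pi) := by ring
    rw [e, Real.sin_add_int_mul_two_pi, Real.sin_add_pi, Real.sin_pi_div_two] at this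
    linarith

lemma exp_lift_square (f : C(ℝ × ℝ, ℂ)) (hf : ∀ p, f p ≠ 0) :
    ∃ g : C(ℝ × ℝ, ℂ), ∀ p, Complex.exp (g p) = f p := by
  obtain ⟨e, he⟩ : ∃ e : ℂ, Complex.exp e = f 0 := ⟨Complex.log (f 0), Complex.exp_log (hf 0)⟩
  let F : C(ℝ × ℝ, {z : ℂ // z ≠ 0}) :=
    ⟨fun p => ⟨f p, hf p⟩, by fun_prop⟩
  obtain ⟨g, hg, -⟩ := Complex.isCoveringMap_exp.existsUnique_continuousMap_lifts F (a₀ := 0) (e₀ := e)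
    (by simp [F, he])
  refine ⟨g, fun p => ?_⟩
  have := congrFun hg.2 p
  simpa [F] using congrArg Subtype.val this

lemma crossing {P Q : Set (ℝ × ℝ)} {t0 s : ℝ} (hPQ : Disjoint P Q)
    (hP : ∀ p ∈ P, p.2 ∈ Icc t0 s) (hQ : ∀ p ∈ Q, p.2 ∈ Icc t0 s)
    {x1 x2 y1 y2 : ℝ} (h1 : JoinedIn P (x1, s) (y1, t0)) (h2 : JoinedIn Q (x2, s) (y2, t0))
    (hx : x1 < x2) : y1 < y2 := by
  by_contra hcon
  have hne : y1 ≠ y2 := by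
    rintro rfl
    exact hPQ.ne_of_mem h1.target_mem h2.target_mem rfl
  have hy : y2 < y1 := lt_of_le_of_ne (not_lt.mp hcon) (Ne.symm hne)
  obtain ⟨p, hp⟩ := h1
  obtain ⟨q, hq⟩ := h2
  have hpe : ∀ a, p.extend a ∈ P := fun a => by
    have : p.extend a ∈ range p := by rw [← p.extend_range]; exact mem_range_self a
    obtain ⟨b, hb⟩ := this
    rw [← hb]; exact hp b
  have hqe : ∀ a, q.extend a ∈ Q := fun a => by
    have : q.extend a ∈ range q := by rw [← q.extend_range]; exact mem_range_self a
    obtain ⟨b, hb⟩ := this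
    rw [← hb]; exact hq b
  have pc := p.continuous_extend
  have qc := q.continuous_extend
  let f : C(ℝ × ℝ, ℂ) := ⟨fun z => (((p.extend z.1).1 - (q.extend z.2).1 : ℝ) : ℂ) +
    (((p.extend z.1).2 - (q.extend z.2).2 : ℝ) : ℂ) * Complex.I, by fun_prop⟩
  have fre : ∀ z, (f z).re = (p.extend z.1).1 - (q.extend z.2).1 := fun z => by
    simp [f]
  have fim : ∀ z, (f z).im = (p.extend z.1).2 - (q.extend z.2).2 := fun z => by
    simp [f]
  have hf : ∀ z, f z ≠ 0 := by
    intro z hz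
    have e1 : (p.extend z.1).1 - (q.extend z.2).1 = 0 := by rw [← fre, hz]; rfl
    have e2 : (p.extend z.1).2 - (q.extend z.2).2 = 0 := by rw [← fim, hz]; rfl
    exact hPQ.ne_of_mem (hpe z.1) (hqe z.2) (Prod.ext (by linarith) (by linarith))
  obtain ⟨g, hg⟩ := exp_lift_square f hf
  have gim : ∀ z, (f z).im = Real.exp (g z).re * Real.sin (g z).im := fun z => by
    rw [← hg, Complex.exp_im]
  have gre : ∀ z, (f z).re = Real.exp (g z).re * Real.cos (g z).im := fun z => by
    rw [← hg, Complex.exp_re]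
  have spos : ∀ z, 0 ≤ (f z).im → 0 ≤ Real.sin (g z).im := fun z hz => by
    rw [gim] at hz; exact nonneg_of_mul_nonneg_right hz (Real.exp_pos _)
  have sneg : ∀ z, (f z).im ≤ 0 → Real.sin (g z).im ≤ 0 := fun z hz => by
    rw [gim] at hz
    by_contra hh
    push Not at hh
    nlinarith [mul_pos (Real.exp_pos (g z).re) hh]
  -- endpoints
  have f00 : (f (0,0)).re < 0 ∧ (f (0,0)).im = 0 := by
    rw [fre, fim]; simp [hx]
  have f11 : 0 < (f (1,1)).re ∧ (f (1,1)).im = 0 := by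
    rw [fre, fim]; simp [hy]
  have hs0 : Real.sin (g (0,0)).im = 0 := by
    have := f00.2; rw [gim] at this
    exact (mul_eq_zero.mp this).resolve_left (Real.exp_pos _).ne'
  have hs1 : Real.sin (g (1,1)).im = 0 := by
    have := f11.2; rw [gim] at this
    exact (mul_eq_zero.mp this).resolve_left (Real.exp_pos _).ne'
  have hc0 : Real.cos (g (0,0)).im < 0 := by
    have := f00.1; rw [gre] at this
    by_contra hh; push Not at hh
    nlinarith [mul_nonneg (Real.exp_pos (g (0,0)).re).le hh]
  have hc1 : 0 < Real.cos (g (1,1)).im := by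
    have := f11.1; rw [gre] at this
    exact pos_of_mul_pos_right this (Real.exp_pos _).le
  obtain ⟨m, hm⟩ : ∃ m : ℤ, (g (1,1)).im = 2 * Real.pi * m := by
    have : Real.cos (g (1,1)).im = 1 := by
      nlinarith [Real.sin_sq_add_cos_sq (g (1,1)).im]
    obtain ⟨m, hm⟩ := (Real.cos_eq_one_iff _).mp this
    exact ⟨m, by rw [← hm]; ring⟩
  obtain ⟨k, hk⟩ : ∃ k : ℤ, (g (0,0)).im = 2 * Real.pi * k + Real.pi := by
    have : Real.cos ((g (0,0)).im - Real.pi) = 1 := by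
      rw [Real.cos_sub_pi]
      nlinarith [Real.sin_sq_add_cos_sq (g (0,0)).im]
    obtain ⟨m, hm⟩ := (Real.cos_eq_one_iff _).mp this
    exact ⟨m, by linarith⟩
  have gc : Continuous fun z => (g z).im := Complex.continuous_im.comp g.continuous
  -- corners
  have hpI := fun a => hP _ (hpe a)
  have hqI := fun a => hQ _ (hqe a)
  -- upper : (0,0) → (0,1) → (1,1)
  have key1 : m = k := by
    refine cross_theta (θ := fun r => (g (max 0 (2*r-1), min 1 (2*r))).im) ?_ ?_ k m ?_ ?_
    · apply Continuous.continuousOn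
      exact gc.comp (by fun_prop)
    · intro r hr
      apply spos
      rw [fim]
      rcases le_total (2*r) 1 with h | h
      · rw [max_eq_left (by linarith)]
        simp only [Path.extend_zero]
        have := (hqI (min 1 (2*r))).2
        linarith
      · rw [min_eq_left h]
        simp only [Path.extend_one]
        have := (hpI (max 0 (2*r-1))).1
        linarith
    · simp [hk]
    · norm_num [hm]
  have key2 : -m = -k-1 := by
    refine cross_theta (θ := fun r => -(g (min 1 (2*r), max 0 (2*r-1))).im) ?_ ?_ (-k-1) (-m) ?_ ?_
    · apply Continuous.continuousOn
      exact (gc.comp (by fun_prop)).neg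
    · intro r hr
      rw [Real.sin_neg]
      have : Real.sin (g (min 1 (2*r), max 0 (2*r-1))).im ≤ 0 := by
        apply sneg
        rw [fim]
        rcases le_total (2*r) 1 with h | h
        · rw [max_eq_left (by linarith)]
          simp only [Path.extend_zero]
          have := (hpI (min 1 (2*r))).2
          linarith
        · rw [min_eq_left h]
          simp only [Path.extend_one]
          have := (hqI (max 0 (2*r-1))).1
          linarith
      linarith
    · simp [hk]; ring
    · norm_num [hm]
  omega

def Adm (M a b c : ℝ) : Prop := 1 / M ≤ a ∧ a ≤ M ∧ |b| ≤ M ∧ |c| ≤ M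

def Good (M : ℝ) (u : ℝ → ℝ → ℝ) (x t : ℝ) : Prop :=
  (∀ᶠ y in 𝓝 x, DifferentiableAt ℝ (fun z => u z t) y) ∧
  DifferentiableAt ℝ (fun y => pdx u y t) x ∧
  DifferentiableAt ℝ (fun s => u x s) t ∧
  ∃ a b c, Adm M a b c ∧ pdt u x t = a * pdxx u x t + b * pdx u x t + c * u x t

def SubAt (M : ℝ) (g : ℝ → ℝ → ℝ) (x t : ℝ) : Prop :=
  ∃ (gx : ℝ → ℝ) (gxx gt : ℝ), (∀ y, HasDerivAt (fun z => g z t) (gx y) y) ∧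
    HasDerivAt gx gxx x ∧ HasDerivAt (fun s => g x s) gt t ∧
    ∀ a b c, Adm M a b c → gt ≤ a * gxx + b * gx x + c * g x t

def Reg (l r : ℝ → ℝ) (t0 t1 : ℝ) : Set (ℝ × ℝ) :=
  {p | p.2 ∈ Icc t0 t1 ∧ p.1 ∈ Icc (l p.2) (r p.2)}

structure LocSol (M : ℝ) (l r : ℝ → ℝ) (t0 t1 : ℝ) (u : ℝ → ℝ → ℝ) : Prop where
  hM : 1 ≤ M
  lc : ContinuousOn l (Icc t0 t1)
  rc : ContinuousOn r (Icc t0 t1)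
  lr : ∀ t ∈ Icc t0 t1, l t ≤ r t
  uc : ContinuousOn (fun p : ℝ × ℝ => u p.1 p.2) (Reg l r t0 t1)
  good : ∀ t ∈ Ioc t0 t1, ∀ x ∈ Ioo (l t) (r t), Good M u x t

lemma pdx_neg (u : ℝ → ℝ → ℝ) (x t : ℝ) : pdx (fun x t => -u x t) x t = - pdx u x t := by
  unfold pdx; exact deriv.fun_neg
lemma pdxx_neg (u : ℝ → ℝ → ℝ) (x t : ℝ) : pdxx (fun x t => -u x t) x t = - pdxx u x t := by
  unfold pdxx; simp only [pdx_neg]; exact deriv.fun_neg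
lemma pdx_refl (u : ℝ → ℝ → ℝ) (x t : ℝ) : pdx (fun x t => u (-x) t) x t = - pdx u (-x) t := by
  unfold pdx; exact deriv_comp_neg (fun y => u y t) x
lemma pdxx_refl (u : ℝ → ℝ → ℝ) (x t : ℝ) : pdxx (fun x t => u (-x) t) x t = pdxx u (-x) t := by
  unfold pdxx; simp only [pdx_refl]
  rw [deriv.fun_neg, deriv_comp_neg (fun y => pdx u y t) x, neg_neg]

lemma Good.neg {M u x t} (h : Good M u x t) : Good M (fun x t => -u x t) x t := by
  obtain ⟨h1, h2, h3, a, b, c, hA, he⟩ := h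
  refine ⟨h1.mono fun y hy => hy.neg, ?_, h3.neg, a, b, c, hA, ?_⟩
  · simp only [pdx_neg]; exact h2.neg
  · rw [pdx_neg, pdxx_neg]
    have : pdt (fun x t => -u x t) x t = - pdt u x t := by unfold pdt; exact deriv.fun_neg
    rw [this, he]; ring

lemma Good.refl {M u x t} (h : Good M u (-x) t) : Good M (fun x t => u (-x) t) x t := by
  obtain ⟨h1, h2, h3, a, b, c, ⟨hA1, hA2, hA3, hA4⟩, he⟩ := h
  refine ⟨?_, ?_, h3, a, -b, c, ⟨hA1, hA2, by rwa [abs_neg], hA4⟩, ?_⟩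
  · have hn : Tendsto (fun y : ℝ => -y) (𝓝 x) (𝓝 (-x)) := continuous_neg.tendsto x
    filter_upwards [hn.eventually h1] with y hy
    exact DifferentiableAt.comp (f := fun y : ℝ => -y) (g := fun z => u z t) y hy differentiableAt_id.neg
  · simp only [pdx_refl]
    exact (DifferentiableAt.comp (f := fun y : ℝ => -y) (g := fun z => pdx u z t) x h2 differentiableAt_id.neg).neg
  · rw [pdx_refl, pdxx_refl]
    have : pdt (fun x t => u (-x) t) x t = pdt u (-x) t := rfl
    rw [this, he]; ring

lemma LocSol.neg {M l r t0 t1 u} (h : LocSol M l r t0 t1 u) : LocSol M l r t0 t1 (fun x t => -u x t) :=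
  ⟨h.hM, h.lc, h.rc, h.lr, h.uc.neg, fun t ht x hx => (h.good t ht x hx).neg⟩

lemma LocSol.refl {M l r t0 t1 u} (h : LocSol M l r t0 t1 u) :
    LocSol M (fun t => -r t) (fun t => -l t) t0 t1 (fun x t => u (-x) t) := by
  refine ⟨h.hM, h.rc.neg, h.lc.neg, fun t ht => neg_le_neg (h.lr t ht), ?_, fun t ht x hx => ?_⟩
  · refine h.uc.comp (f := fun p : ℝ × ℝ => (-p.1, p.2)) (by fun_prop) ?_
    rintro ⟨x, t⟩ ⟨ht, hx⟩
    exact ⟨ht, by simp only [mem_Icc] at hx ⊢; constructor <;> linarith⟩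
  · exact (h.good t ht (-x) ⟨by linarith [hx.2], by linarith [hx.1]⟩).refl

lemma LocSol.mono {M l r t0 t1 u} (h : LocSol M l r t0 t1 u) {l' r' : ℝ → ℝ} {a b : ℝ}
    (ha : t0 ≤ a) (hb : b ≤ t1) (hl : ContinuousOn l' (Icc a b)) (hr : ContinuousOn r' (Icc a b))
    (h1 : ∀ t ∈ Icc a b, l t ≤ l' t) (h2 : ∀ t ∈ Icc a b, l' t ≤ r' t) (h3 : ∀ t ∈ Icc a b, r' t ≤ r t) :
    LocSol M l' r' a b u := by
  refine ⟨h.hM, hl, hr, h2, h.uc.mono ?_, fun t ht x hx => ?_⟩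
  · rintro ⟨x, t⟩ ⟨ht, hx⟩
    exact ⟨⟨ha.trans ht.1, ht.2.trans hb⟩, ⟨(h1 t ht).trans hx.1, hx.2.trans (h3 t ht)⟩⟩
  · have ht' : t ∈ Icc a b := ⟨ht.1.le, ht.2⟩
    exact h.good t ⟨ha.trans_lt ht.1, ht.2.trans hb⟩ x ⟨(h1 t ht').trans_lt hx.1, hx.2.trans_le (h3 t ht')⟩

lemma subAt_zero (M x t : ℝ) : SubAt M (fun _ _ => 0) x t :=
  ⟨fun _ => 0, 0, 0, fun y => hasDerivAt_const _ _, hasDerivAt_const _ _, hasDerivAt_const _ _, fun a b c _ => by simp⟩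

lemma no_pos_max {M : ℝ} {u g : ℝ → ℝ → ℝ} {x t : ℝ} (hM : 1 ≤ M) (hu : Good M u x t) (hg : SubAt M g x t)
    (hw : 0 < u x t + g x t) {r : ℝ} (hr : 0 < r)
    (hmax : ∀ y τ, |y - x| < r → t - r < τ → τ ≤ t →
      Real.exp (-((M+1) * τ)) * (u y τ + g y τ) ≤ Real.exp (-((M+1) * t)) * (u x t + g x t)) : False := by
  obtain ⟨h1, h2, h3, a, b, c, hA, he⟩ := hu
  obtain ⟨gx, gxx, gt, g1, g2, g3, g4⟩ := hg
  have hin := g4 a b c hA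
  set W : ℝ → ℝ := fun y => u y t + g y t with hW
  have hlm : IsLocalMax W x := by
    have : ∀ᶠ y in 𝓝 x, |y - x| < r := by
      have := Metric.ball_mem_nhds x hr
      filter_upwards [this] with y hy
      rwa [Metric.mem_ball, Real.dist_eq] at hy
    filter_upwards [this] with y hy
    have := hmax y t hy (by linarith) le_rfl
    exact le_of_mul_le_mul_left this (Real.exp_pos _)
  have hd : deriv W =ᶠ[𝓝 x] fun y => pdx u y t + gx y := by
    filter_upwards [h1] with y hy
    exact (hy.hasDerivAt.add (g1 y)).deriv
  have hdd : deriv (deriv W) x = pdxx u x t + gxx := by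
    rw [hd.deriv_eq]
    exact (h2.hasDerivAt.add g2).deriv
  have hd0 : deriv W x = 0 := hlm.deriv_eq_zero
  have hx0 : pdx u x t + gx x = 0 := by
    have h := hd.self_of_nhds
    simp only [hd0] at h; exact h.symm
  have hcont : ContinuousAt W x := (h1.self_of_nhds.hasDerivAt.add (g1 x)).continuousAt
  have hxx : pdxx u x t + gxx ≤ 0 := by
    by_contra hh
    push Not at hh
    rw [← hdd] at hh
    have hmin := isLocalMin_of_deriv_deriv_pos hh hd0 hcont
    have hc : W =ᶠ[𝓝 x] fun _ => W x := by
      filter_upwards [hlm, hmin] with y h1 h2 using le_antisymm h1 h2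
    have : deriv W =ᶠ[𝓝 x] fun _ => 0 := by
      have := hc.deriv
      simpa using this
    rw [this.deriv_eq] at hh
    simp at hh
  -- time
  have ht : HasDerivAt (fun τ => u x τ + g x τ) (pdt u x t + gt) t := h3.hasDerivAt.add g3
  have hexp : HasDerivAt (fun τ => Real.exp (-((M+1) * τ))) (Real.exp (-((M+1)*t)) * (-(M+1))) t := by
    have : HasDerivAt (fun τ : ℝ => -((M+1) * τ)) (-(M+1)) t := by
      have h := ((hasDerivAt_id t).const_mul (M+1)).fun_neg
      simpa only [id, mul_one] using h
    exact this.exp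
  have hh := hexp.mul ht
  have hge : 0 ≤ Real.exp (-((M+1)*t)) * (-(M+1)) * (u x t + g x t) + Real.exp (-((M+1) * t)) * (pdt u x t + gt) := by
    by_contra hneg
    push Not at hneg
    have hlt := hh.hasDerivWithinAt (s := Iio t)
    rw [hasDerivWithinAt_iff_tendsto_slope' (by simp)] at hlt
    have ev := hlt.eventually (gt_mem_nhds hneg)
    have ev2 : ∀ᶠ τ in 𝓝[<] t, t - r < τ := mem_nhdsWithin_of_mem_nhds (lt_mem_nhds (by linarith))
    have ev3 : ∀ᶠ τ in 𝓝[<] t, τ < t := self_mem_nhdsWithin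
    obtain ⟨τ, e1, e2, e3⟩ := (ev.and (ev2.and ev3)).exists
    have hm := hmax x τ (by simpa using hr) e2 e3.le
    rw [slope_def_field] at e1
    simp only [Pi.mul_apply] at e1
    rw [div_neg_iff] at e1
    rcases e1 with e | e <;> linarith [e.1, e.2]
  have hge2 : (M+1) * (u x t + g x t) ≤ pdt u x t + gt := by
    have := Real.exp_pos (-((M+1)*t))
    by_contra hneg
    push Not at hneg
    nlinarith
  obtain ⟨hA1, hA2, hA3, hA4⟩ := hA
  have ha : 0 ≤ a := le_trans (by positivity) hA1
  have hcM : c ≤ M := (le_abs_self c).trans hA4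
  have e1 : a * (pdxx u x t + gxx) ≤ 0 := mul_nonpos_of_nonneg_of_nonpos ha hxx
  have e2 : b * (pdx u x t + gx x) = 0 := by rw [hx0, mul_zero]
  have e3 : c * (u x t + g x t) ≤ M * (u x t + g x t) := by gcongr
  nlinarith

lemma MP_compact {M : ℝ} {u g : ℝ → ℝ → ℝ} {K : Set (ℝ × ℝ)} (hM : 1 ≤ M) (hK : IsCompact K)
    (hc : ContinuousOn (fun p : ℝ × ℝ => u p.1 p.2 + g p.1 p.2) K)
    (h : ∀ x t, (x, t) ∈ K → 0 < u x t + g x t → Good M u x t ∧ SubAt M g x t ∧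
      ∃ r > 0, ∀ y τ, |y - x| < r → t - r < τ → τ ≤ t → (y, τ) ∈ K) :
    ∀ x t, (x, t) ∈ K → u x t + g x t ≤ 0 := by
  intro x t hxt
  by_contra hpos
  push Not at hpos
  have hc' : ContinuousOn (fun p : ℝ × ℝ => Real.exp (-((M+1) * p.2)) * (u p.1 p.2 + g p.1 p.2)) K :=
    (Continuous.continuousOn (by fun_prop)).mul hc
  obtain ⟨⟨y, s⟩, hy, hmax⟩ := hK.exists_isMaxOn ⟨_, hxt⟩ hc'
  have hpos' : 0 < u y s + g y s := by
    have h1 := hmax hxt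
    simp only [mem_ofPred_eq] at h1
    have h2 : 0 < Real.exp (-((M+1) * s)) * (u y s + g y s) :=
      lt_of_lt_of_le (mul_pos (Real.exp_pos _) hpos) h1
    exact pos_of_mul_pos_right h2 (Real.exp_pos _).le
  obtain ⟨h1, h2, r, hr, h3⟩ := h y s hy hpos'
  exact no_pos_max hM h1 h2 hpos' hr fun z τ hz hτ hτ' => hmax (h3 z τ hz hτ hτ')

def Phi (l r : ℝ → ℝ) (p : ℝ × ℝ) : ℝ × ℝ := (l p.2 + p.1 * (r p.2 - l p.2), p.2)

lemma Phi_image {l r : ℝ → ℝ} {t0 t1 : ℝ} (h : ∀ t ∈ Icc t0 t1, l t ≤ r t) :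
    Phi l r '' (Icc 0 1 ×ˢ Icc t0 t1) = Reg l r t0 t1 := by
  ext ⟨x, t⟩
  constructor
  · rintro ⟨⟨y, s⟩, ⟨hy, hs⟩, he⟩
    simp only [Phi, Prod.mk.injEq] at he
    obtain ⟨rfl, rfl⟩ := he
    have := h s hs
    refine ⟨hs, ?_, ?_⟩
    · simp only; nlinarith [hy.1]
    · simp only; nlinarith [hy.2]
  · rintro ⟨ht, hx⟩
    rcases (h t ht).eq_or_lt with he | hlt
    · refine ⟨(0, t), ⟨⟨le_rfl, zero_le_one⟩, ht⟩, ?_⟩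
      simp only [Phi, Prod.mk.injEq, and_true]
      simp only at hx
      linarith [hx.1, hx.2]
    · simp only at hx ht hlt
      refine ⟨((x - l t) / (r t - l t), t), ⟨⟨div_nonneg (by linarith [hx.1]) (by linarith), ?_⟩, ht⟩, ?_⟩
      · rw [div_le_one (by linarith)]; linarith [hx.2]
      · simp only [Phi, Prod.mk.injEq, and_true]
        rw [div_mul_cancel₀ _ (by linarith)]; ring

lemma Phi_cont {l r : ℝ → ℝ} {t0 t1 : ℝ} (hl : ContinuousOn l (Icc t0 t1)) (hr : ContinuousOn r (Icc t0 t1)) :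
    ContinuousOn (Phi l r) (Icc 0 1 ×ˢ Icc t0 t1) := by
  have h2 : ContinuousOn (fun p : ℝ × ℝ => l p.2) (Icc 0 1 ×ˢ Icc t0 t1) :=
    hl.comp continuousOn_snd fun p hp => hp.2
  have h3 : ContinuousOn (fun p : ℝ × ℝ => r p.2) (Icc 0 1 ×ˢ Icc t0 t1) :=
    hr.comp continuousOn_snd fun p hp => hp.2
  exact (h2.add (continuousOn_fst.mul (h3.sub h2))).prodMk continuousOn_snd

lemma LocSol.compact {M l r t0 t1 u} (h : LocSol M l r t0 t1 u) : IsCompact (Reg l r t0 t1) := by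
  rw [← Phi_image h.lr]
  exact (isCompact_Icc.prod isCompact_Icc).image_of_continuousOn (Phi_cont h.lc h.rc)

/-- backward box around a point of `Ioo l r × Ioc t0 t1` -/
lemma LocSol.box {M l r t0 t1 u} (h : LocSol M l r t0 t1 u) {x t : ℝ} (ht : t ∈ Ioc t0 t1)
    (hx : x ∈ Ioo (l t) (r t)) : ∃ ε > 0, ∀ y τ, |y - x| < ε → t - ε < τ → τ ≤ t →
      (τ ∈ Ioc t0 t1 ∧ y ∈ Ioo (l τ) (r τ)) := by
  have ht' : t ∈ Icc t0 t1 := ⟨ht.1.le, ht.2⟩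
  have hl : ∀ᶠ τ in 𝓝[Icc t0 t1] t, l τ < (l t + x) / 2 :=
    (h.lc t ht').eventually (gt_mem_nhds (by linarith [hx.1]))
  have hr : ∀ᶠ τ in 𝓝[Icc t0 t1] t, (r t + x) / 2 < r τ :=
    (h.rc t ht').eventually (lt_mem_nhds (by linarith [hx.2]))
  obtain ⟨ε, hε, hb⟩ := Metric.mem_nhdsWithin_iff.mp (hl.and hr)
  refine ⟨min (min ε (t - t0)) (min ((x - l t)/2) ((r t - x)/2)), ?_, ?_⟩
  · have := hx.1; have := hx.2; have := ht.1
    refine lt_min (lt_min hε (by linarith)) (lt_min (by linarith) (by linarith))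
  · intro y τ hy h1 h2
    simp only [lt_min_iff] at hy
    have h3 := min_le_left (min ε (t - t0)) (min ((x - l t)/2) ((r t - x)/2))
    have h4 := min_le_left ε (t-t0)
    have h5 := min_le_right ε (t-t0)
    have hτ : τ ∈ Ioc t0 t1 := ⟨by linarith, h2.trans ht.2⟩
    have hm : τ ∈ Metric.ball t ε ∩ Icc t0 t1 := by
      refine ⟨?_, hτ.1.le, hτ.2⟩
      rw [Metric.mem_ball, Real.dist_eq, abs_lt]; constructor <;> linarith
    have := hb hm
    obtain ⟨e1, e2⟩ := abs_lt.mp hy.2.1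
    obtain ⟨e3, e4⟩ := abs_lt.mp hy.2.2
    exact ⟨hτ, by linarith [this.1], by linarith [this.2]⟩

lemma MP_reg {M l r t0 t1 u} (h : LocSol M l r t0 t1 u) {g : ℝ → ℝ → ℝ}
    (hgc : ContinuousOn (fun p : ℝ × ℝ => g p.1 p.2) (Reg l r t0 t1))
    (hg : ∀ t ∈ Ioc t0 t1, ∀ x ∈ Ioo (l t) (r t), SubAt M g x t)
    (hb : ∀ x ∈ Icc (l t0) (r t0), u x t0 + g x t0 ≤ 0)
    (hl : ∀ t ∈ Icc t0 t1, u (l t) t + g (l t) t ≤ 0)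
    (hr : ∀ t ∈ Icc t0 t1, u (r t) t + g (r t) t ≤ 0) :
    ∀ t ∈ Icc t0 t1, ∀ x ∈ Icc (l t) (r t), u x t + g x t ≤ 0 := by
  intro t ht x hx
  refine MP_compact h.hM h.compact (h.uc.add hgc) ?_ x t ⟨ht, hx⟩
  rintro x t ⟨ht, hx⟩ hpos
  simp only at hx ht
  have ht' : t ∈ Ioc t0 t1 := by
    refine ⟨lt_of_le_of_ne ht.1 ?_, ht.2⟩
    rintro rfl
    linarith [hb x hx]
  have hx' : x ∈ Ioo (l t) (r t) := by
    refine ⟨lt_of_le_of_ne hx.1 ?_, lt_of_le_of_ne hx.2 ?_⟩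
    · rintro rfl; linarith [hl t ht]
    · rintro rfl; linarith [hr t ht]
  refine ⟨h.good t ht' x hx', hg t ht' x hx', ?_⟩
  obtain ⟨ε, hε, hb⟩ := h.box ht' hx'
  refine ⟨ε, hε, fun y τ h1 h2 h3 => ?_⟩
  obtain ⟨h4, h5⟩ := hb y τ h1 h2 h3
  exact ⟨⟨h4.1.le, h4.2⟩, ⟨h5.1.le, h5.2.le⟩⟩

lemma MP_nonneg {M l r t0 t1 u} (h : LocSol M l r t0 t1 u)
    (hb : ∀ x ∈ Icc (l t0) (r t0), 0 ≤ u x t0)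
    (hl : ∀ t ∈ Icc t0 t1, 0 ≤ u (l t) t) (hr : ∀ t ∈ Icc t0 t1, 0 ≤ u (r t) t) :
    ∀ t ∈ Icc t0 t1, ∀ x ∈ Icc (l t) (r t), 0 ≤ u x t := by
  intro t ht x hx
  have := MP_reg h.neg (g := fun _ _ => 0) continuousOn_const (fun t _ x _ => subAt_zero M x t)
    (fun x hx => by simpa using hb x hx) (fun t ht => by simpa using hl t ht)
    (fun t ht => by simpa using hr t ht) t ht x hx
  simpa using this

lemma barrier {M : ℝ} {u : ℝ → ℝ → ℝ} {q x1 k τ0 τ1 : ℝ} (hτ : τ0 ≤ τ1) (hk : 0 ≤ k)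
    (hq : x1 + k * (τ1 - τ0) = q) (h : LocSol M (fun τ => x1 + k * (τ1 - τ)) (fun _ => q) τ0 τ1 u)
    (hu : ∀ t ∈ Icc τ0 τ1, ∀ x ∈ Icc (x1 + k * (τ1 - t)) q, 0 ≤ u x t)
    (huq : ∀ t ∈ Icc τ0 τ1, 0 < u q t) :
    ∃ η > 0, ∃ κ > 0, ∀ x ∈ Icc x1 q, η * (Real.exp (κ * (x - x1)) - 1) ≤ u x τ1 := by
  have hM := h.hM
  have hqc : ContinuousOn (fun t => u q t) (Icc τ0 τ1) := by
    refine h.uc.comp (f := fun t : ℝ => (q, t)) (by fun_prop) ?_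
    intro t ht
    exact ⟨ht, h.lr t ht, le_rfl⟩
  obtain ⟨tm, htm, hmin⟩ := isCompact_Icc.exists_isMinOn (nonempty_Icc.mpr hτ) hqc
  set m := u q tm with hm
  have hmpos : 0 < m := huq tm htm
  have hmle : ∀ t ∈ Icc τ0 τ1, m ≤ u q t := fun t ht => hmin ht
  set κ := M * (k + 2 * M) with hκ
  have hκ1 : 1 ≤ κ := by nlinarith
  have hκpos : 0 < κ := by linarith
  set η := m * Real.exp (-(κ * (q - x1))) with hη
  have hηpos : 0 < η := mul_pos hmpos (Real.exp_pos _)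
  refine ⟨η, hηpos, κ, hκpos, fun x hx => ?_⟩
  have key := MP_reg h.neg (g := fun x t => η * (Real.exp (κ * (x - (x1 + k * (τ1 - t)))) - 1))
    (Continuous.continuousOn (by fun_prop)) ?_ ?_ ?_ ?_ τ1 ⟨hτ, le_rfl⟩ x (by simpa using hx)
  · simp only [sub_self, mul_zero, add_zero] at key
    linarith
  · intro t ht x hx
    set e := Real.exp (κ * (x - (x1 + k * (τ1 - t)))) with he
    have he1 : 1 ≤ e := Real.one_le_exp (mul_nonneg hκpos.le (by linarith [hx.1]))
    have hd : ∀ y : ℝ, HasDerivAt (fun y : ℝ => Real.exp (κ * (y - (x1 + k * (τ1 - t)))))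
        (Real.exp (κ * (y - (x1 + k * (τ1 - t)))) * κ) y := fun y => by
      have : HasDerivAt (fun y : ℝ => κ * (y - (x1 + k * (τ1 - t)))) κ y := by
        simpa only [id, mul_one] using ((hasDerivAt_id y).sub_const (x1 + k * (τ1 - t))).const_mul κ
      exact this.exp
    refine ⟨fun y => η * (Real.exp (κ * (y - (x1 + k * (τ1 - t)))) * κ), η * (e * κ * κ), η * (e * (κ * k)), ?_, ?_, ?_, ?_⟩
    · intro y
      exact ((hd y).sub_const 1).const_mul η
    · exact ((hd x).mul_const κ).const_mul η
    · have : HasDerivAt (fun s : ℝ => κ * (x - (x1 + k * (τ1 - s)))) (κ * k) t := by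
        have h1 : HasDerivAt (fun s : ℝ => κ * (x - (x1 + k * (τ1 - s)))) (κ * (-(k * (-1)))) t :=
          (((((hasDerivAt_id t).const_sub τ1).const_mul k).const_add x1).const_sub x).const_mul κ
        convert h1 using 1; ring
      exact (this.exp.sub_const 1).const_mul η
    · rintro a b c ⟨h1, h2, h3, h4⟩
      have hb := (abs_le.mp h3).1
      have hc := (abs_le.mp h4).1
      have hin : κ * k ≤ a * (κ * κ) + b * κ - M := by
        have h5 : 1 / M * (κ * κ) = κ * (k + 2 * M) := by rw [hκ]; field_simp
        have h6 : 1 / M * (κ * κ) ≤ a * (κ * κ) := by gcongr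
        nlinarith
      have h7 : -(M * e) ≤ c * (e - 1) := by nlinarith
      have h8 : e * (κ * k) ≤ e * (a * (κ * κ) + b * κ - M) := by gcongr
      have h9 : e * (κ * k) ≤ a * (e * κ * κ) + b * (e * κ) + c * (e - 1) := by nlinarith
      have := mul_le_mul_of_nonneg_left h9 hηpos.le
      calc η * (e * (κ * k)) ≤ _ := this
        _ = _ := by ring
  · intro y hy
    rw [hq] at hy ⊢
    have : y = q := le_antisymm hy.2 hy.1
    subst this
    have := huq τ0 ⟨le_rfl, hτ⟩
    simp; linarith
  · intro t ht
    have := hu t ht _ ⟨le_rfl, h.lr t ht⟩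
    simpa using this
  · intro t ht
    have h1 := hmle t ht
    have h2 : Real.exp (κ * (q - (x1 + k * (τ1 - t)))) ≤ Real.exp (κ * (q - x1)) := by
      apply Real.exp_le_exp.mpr
      apply mul_le_mul_of_nonneg_left _ hκpos.le
      have := mul_nonneg hk (sub_nonneg.mpr ht.2)
      linarith
    have h3 : η * Real.exp (κ * (q - x1)) = m := by
      rw [hη, mul_assoc, ← Real.exp_add]; simp
    have h4 := mul_le_mul_of_nonneg_left h2 hηpos.le
    linarith

lemma SM_right {M : ℝ} {u : ℝ → ℝ → ℝ} {p q τ0 τ1 : ℝ} (hτ : τ0 < τ1)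
    (h : LocSol M (fun _ => p) (fun _ => q) τ0 τ1 u)
    (hu : ∀ t ∈ Icc τ0 τ1, ∀ x ∈ Icc p q, 0 ≤ u x t)
    (huq : ∀ t ∈ Icc τ0 τ1, 0 < u q t) : ∀ x ∈ Ioc p q, 0 < u x τ1 := by
  intro x hx
  rcases hx.2.eq_or_lt with rfl | hlt
  · exact huq τ1 ⟨hτ.le, le_rfl⟩
  set x1 := (p + x) / 2 with hx1
  have h1 : p < x1 := by rw [hx1]; linarith [hx.1]
  have h2 : x1 < x := by rw [hx1]; linarith [hx.1]
  set k := (q - x1) / (τ1 - τ0) with hk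
  have hk0 : 0 ≤ k := div_nonneg (by linarith) (by linarith)
  have hkq : k * (τ1 - τ0) = q - x1 := div_mul_cancel₀ _ (by linarith)
  have hle : ∀ t ∈ Icc τ0 τ1, p ≤ x1 + k * (τ1 - t) ∧ x1 + k * (τ1 - t) ≤ q := fun t ht => by
    have e1 := mul_nonneg hk0 (sub_nonneg.mpr ht.2)
    have e2 := mul_nonneg hk0 (sub_nonneg.mpr ht.1)
    constructor <;> nlinarith
  obtain ⟨η, hη, κ, hκ, hb⟩ := barrier (M := M) (u := u) (q := q) (x1 := x1) (k := k) hτ.le hk0 (by linarith)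
    (h.mono le_rfl le_rfl (by fun_prop) (by fun_prop) (fun t ht => (hle t ht).1)
      (fun t ht => (hle t ht).2) (fun t ht => le_rfl))
    (fun t ht x hx => hu t ht x ⟨(hle t ht).1.trans hx.1, hx.2⟩) huq
  refine lt_of_lt_of_le ?_ (hb x ⟨h2.le, hx.2⟩)
  apply mul_pos hη
  have : 0 < κ * (x - x1) := mul_pos hκ (by linarith)
  linarith [Real.add_one_lt_exp this.ne']

lemma SM_left {M : ℝ} {u : ℝ → ℝ → ℝ} {p q τ0 τ1 : ℝ} (hτ : τ0 < τ1)
    (h : LocSol M (fun _ => p) (fun _ => q) τ0 τ1 u)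
    (hu : ∀ t ∈ Icc τ0 τ1, ∀ x ∈ Icc p q, 0 ≤ u x t)
    (huq : ∀ t ∈ Icc τ0 τ1, 0 < u p t) : ∀ x ∈ Ico p q, 0 < u x τ1 := by
  intro x hx
  have := SM_right hτ h.refl (fun t ht x hx => hu t ht (-x) ⟨by linarith [hx.2], by linarith [hx.1]⟩)
    (fun t ht => by simpa using huq t ht) (-x) ⟨by linarith [hx.2], by linarith [hx.1]⟩
  simpa using this

lemma Hopf_left {M : ℝ} {u : ℝ → ℝ → ℝ} {l : ℝ → ℝ} {q τ0 τ1 L : ℝ} (hτ : τ0 < τ1)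
    (h : LocSol M l (fun _ => q) τ0 τ1 u) (hlq : l τ1 < q)
    (hu : ∀ t ∈ Icc τ0 τ1, ∀ x ∈ Icc (l t) q, 0 ≤ u x t)
    (huq : ∀ t ∈ Icc τ0 τ1, 0 < u q t) (h0 : u (l τ1) τ1 = 0)
    (hL : HasDerivWithinAt l L (Iio τ1) τ1) (hd : DifferentiableAt ℝ (fun y => u y τ1) (l τ1)) :
    0 < pdx u (l τ1) τ1 := by
  set x1 := l τ1 with hx1
  have hlo : ∀ᶠ τ in 𝓝[<] τ1, l τ ≤ x1 + (|L| + 1) * (τ1 - τ) := by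
    rw [hasDerivWithinAt_iff_tendsto_slope' (by simp)] at hL
    have := hL.eventually (lt_mem_nhds (show -(|L| + 1) < L by linarith [neg_abs_le L]))
    filter_upwards [this, self_mem_nhdsWithin] with τ h1 h2
    have h2 : τ < τ1 := h2
    rw [slope_def_field, lt_div_iff_of_neg (by linarith)] at h1
    nlinarith
  obtain ⟨ε, hε, hb⟩ := mem_nhdsLT_iff_exists_Ioo_subset.mp hlo
  have hε : ε < τ1 := hε
  set k0 := |L| + 1 with hk0
  have hk0p : 0 < k0 := by positivity
  set σ := max (max ((ε + τ1)/2) τ0) (τ1 - (q - x1) / k0) with hσ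
  have hdp : 0 < (q - x1) / k0 := div_pos (by linarith) hk0p
  have hσ1 : σ < τ1 := by
    rw [hσ]; refine max_lt (max_lt (by linarith) hτ) (by linarith)
  have hσ0 : τ0 ≤ σ := (le_max_right _ _).trans (le_max_left _ _)
  have hσε : ε < σ := lt_of_lt_of_le (by linarith) ((le_max_left ((ε + τ1)/2) τ0).trans (le_max_left _ _))
  have hσq : τ1 - σ ≤ (q - x1) / k0 := by
    have := le_max_right (max ((ε + τ1)/2) τ0) (τ1 - (q - x1) / k0)
    rw [← hσ] at this
    linarith
  set k := (q - x1) / (τ1 - σ) with hk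
  have hkk : k0 ≤ k := by
    rw [hk, le_div_iff₀ (by linarith)]
    rw [le_div_iff₀ hk0p] at hσq
    linarith
  have hkq : k * (τ1 - σ) = q - x1 := div_mul_cancel₀ _ (by linarith)
  have hle : ∀ t ∈ Icc σ τ1, l t ≤ x1 + k * (τ1 - t) ∧ x1 + k * (τ1 - t) ≤ q := fun t ht => by
    constructor
    · rcases ht.2.eq_or_lt with rfl | hlt
      · simp [hx1]
      · have h1 : l t ≤ x1 + k0 * (τ1 - t) := hb ⟨lt_of_lt_of_le hσε ht.1, hlt⟩
        have := mul_le_mul_of_nonneg_right hkk (sub_nonneg.mpr ht.2)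
        linarith
    · have := mul_nonneg (hk0p.le.trans hkk) (sub_nonneg.mpr ht.1)
      nlinarith
  obtain ⟨η, hη, κ, hκ, hbar⟩ := barrier (M := M) (u := u) (q := q) (x1 := x1) (k := k) hσ1.le (hk0p.le.trans hkk)
    (by linarith)
    (h.mono hσ0 le_rfl (by fun_prop) (by fun_prop) (fun t ht => (hle t ht).1)
      (fun t ht => (hle t ht).2) (fun t ht => le_rfl))
    (fun t ht x hx => hu t ⟨hσ0.trans ht.1, ht.2⟩ x ⟨(hle t ht).1.trans hx.1, hx.2⟩)
    (fun t ht => huq t ⟨hσ0.trans ht.1, ht.2⟩)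
  have hd1 := hd.hasDerivAt.hasDerivWithinAt (s := Ioi x1)
  rw [hasDerivWithinAt_iff_tendsto_slope' (by simp)] at hd1
  have : η * κ ≤ pdx u x1 τ1 := by
    refine ge_of_tendsto hd1 ?_
    filter_upwards [Ioo_mem_nhdsGT hlq] with y hy
    rw [slope_def_field, le_div_iff₀ (by linarith [hy.1]), h0, sub_zero]
    refine le_trans ?_ (hbar y ⟨hy.1.le, hy.2.le⟩)
    rw [mul_assoc]
    apply mul_le_mul_of_nonneg_left _ hη.le
    linarith [Real.add_one_le_exp (κ * (y - x1))]
  exact lt_of_lt_of_le (mul_pos hη hκ) this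

lemma Hopf_right {M : ℝ} {u : ℝ → ℝ → ℝ} {r : ℝ → ℝ} {q τ0 τ1 L : ℝ} (hτ : τ0 < τ1)
    (h : LocSol M (fun _ => q) r τ0 τ1 u) (hlq : q < r τ1)
    (hu : ∀ t ∈ Icc τ0 τ1, ∀ x ∈ Icc q (r t), 0 ≤ u x t)
    (huq : ∀ t ∈ Icc τ0 τ1, 0 < u q t) (h0 : u (r τ1) τ1 = 0)
    (hL : HasDerivWithinAt r L (Iio τ1) τ1) (hd : DifferentiableAt ℝ (fun y => u y τ1) (r τ1)) :
    pdx u (r τ1) τ1 < 0 := by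
  have hd' : DifferentiableAt ℝ (fun y => u y τ1) (- -r τ1) := by rwa [neg_neg]
  have := Hopf_left (L := -L) hτ h.refl (by simpa using hlq)
    (fun t ht x hx => hu t ht (-x) ⟨by linarith [hx.2], by linarith [hx.1]⟩)
    (fun t ht => by simpa using huq t ht) (by simpa using h0) hL.fun_neg
    (DifferentiableAt.comp (f := fun y : ℝ => -y) (g := fun z => u z τ1) (-r τ1) hd' differentiableAt_id.neg)
  rw [pdx_refl] at this
  simp only [neg_neg] at this
  linarith

lemma loc_path {M l r t0 s u} (h : LocSol M l r t0 s u) (hlr : ∀ t ∈ Icc t0 s, l t < r t)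
    {w : ℝ × ℝ → ℝ} (hw : ContinuousOn w (Reg l r t0 s)) {p : ℝ × ℝ} (hp : p ∈ Reg l r t0 s) (hpw : 0 < w p) :
    ∃ ε > 0, ∀ p' ∈ Reg l r t0 s, dist p' p < ε → JoinedIn {p ∈ Reg l r t0 s | 0 < w p} p p' := by
  set S : Set (ℝ × ℝ) := Icc 0 1 ×ˢ Icc t0 s with hS
  have hPhi := Phi_image h.lr
  have hPc := Phi_cont h.lc h.rc
  let Ψ : ℝ × ℝ → ℝ × ℝ := fun q => ((q.1 - l q.2) / (r q.2 - l q.2), q.2)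
  have hlc : ContinuousOn (fun p : ℝ × ℝ => l p.2) (Reg l r t0 s) :=
    h.lc.comp continuousOn_snd fun p hp => hp.1
  have hrc : ContinuousOn (fun p : ℝ × ℝ => r p.2) (Reg l r t0 s) :=
    h.rc.comp continuousOn_snd fun p hp => hp.1
  have hΨc : ContinuousOn Ψ (Reg l r t0 s) := by
    refine ContinuousOn.prodMk ((continuousOn_fst.sub hlc).div (hrc.sub hlc) ?_) continuousOn_snd
    intro q hq
    have := hlr q.2 hq.1
    linarith
  have hΨ : ∀ q ∈ Reg l r t0 s, Ψ q ∈ S ∧ Phi l r (Ψ q) = q := by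
    rintro ⟨x, t⟩ ⟨ht, hx⟩
    have h1 := hlr t ht
    simp only at ht hx
    refine ⟨⟨⟨div_nonneg (by linarith [hx.1]) (by linarith), ?_⟩, ht⟩, ?_⟩
    · simp only [Ψ]
      rw [div_le_one (by linarith)]; linarith [hx.2]
    · simp only [Phi, Ψ, Prod.mk.injEq, and_true]
      rw [div_mul_cancel₀ _ (by linarith)]; ring
  have hPS : MapsTo (Phi l r) S (Reg l r t0 s) := by
    rw [← hPhi]; exact mapsTo_image _ _
  have hwS : ContinuousOn (fun z => w (Phi l r z)) S := hw.comp hPc hPS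
  have hz := hΨ p hp
  have hev : ∀ᶠ z in 𝓝[S] (Ψ p), 0 < w (Phi l r z) := by
    refine (hwS _ hz.1).eventually (lt_mem_nhds ?_)
    simpa [hz.2] using hpw
  obtain ⟨δ, hδ, hb⟩ := Metric.mem_nhdsWithin_iff.mp hev
  have hΨp := Metric.continuousWithinAt_iff.mp (hΨc p hp) δ hδ
  obtain ⟨ε, hε, he⟩ := hΨp
  refine ⟨ε, hε, fun p' hp' hd => ?_⟩
  have hconv : Convex ℝ (Metric.ball (Ψ p) δ ∩ S) :=
    (convex_ball _ _).inter ((convex_Icc 0 1).prod (convex_Icc t0 s))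
  have hseg : JoinedIn (Metric.ball (Ψ p) δ ∩ S) (Ψ p) (Ψ p') :=
    JoinedIn.of_segment_subset (hconv.segment_subset ⟨Metric.mem_ball_self hδ, hz.1⟩ ⟨he hp' hd, (hΨ p' hp').1⟩)
  have hm := hseg.map_continuousOn (hPc.mono inter_subset_right)
  rw [hz.2, (hΨ p' hp').2] at hm
  refine hm.mono ?_
  rintro _ ⟨z, hz, rfl⟩
  exact ⟨hPS hz.2, hb hz⟩

lemma slide {l : ℝ → ℝ} {t0 s t : ℝ} (hl : ContinuousOn l (Icc t0 s)) (ht : t ∈ Icc t0 s) {F : Set (ℝ × ℝ)}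
    (hF : ∀ t ∈ Icc t0 s, (l t, t) ∈ F) : JoinedIn F (l t, t) (l t0, t0) := by
  have h0 : JoinedIn (Icc t0 s) t t0 :=
    JoinedIn.of_segment_subset ((convex_Icc t0 s).segment_subset ht ⟨le_rfl, ht.1.trans ht.2⟩)
  have := h0.map_continuousOn (f := fun t => (l t, t)) (hl.prodMk continuousOn_id)
  refine this.mono ?_
  rintro _ ⟨z, hz, rfl⟩
  exact hF z hz

lemma TL {M l r t0 s u} (h : LocSol M l r t0 s u) (hlr : ∀ t ∈ Icc t0 s, l t < r t) (hts : t0 ≤ s)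
    {g : ℝ → ℝ → ℝ} (hgc : ContinuousOn (fun p : ℝ × ℝ => g p.1 p.2) (Reg l r t0 s))
    (hg : ∀ t ∈ Ioc t0 s, ∀ x ∈ Ioo (l t) (r t), SubAt M g x t) {F : Set (ℝ × ℝ)}
    (hF : ∀ p ∈ Reg l r t0 s, 0 < u p.1 p.2 + g p.1 p.2 → p ∈ F)
    (hL : (∀ t ∈ Icc t0 s, (l t, t) ∈ F) ∨ (∀ t ∈ Icc t0 s, u (l t) t + g (l t) t ≤ 0))
    (hR : (∀ t ∈ Icc t0 s, (r t, t) ∈ F) ∨ (∀ t ∈ Icc t0 s, u (r t) t + g (r t) t ≤ 0))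
    {x : ℝ} (hx : x ∈ Icc (l s) (r s)) (hpos : 0 < u x s + g x s) :
    ∃ y ∈ Icc (l t0) (r t0), JoinedIn F (x, s) (y, t0) := by
  set U : Set (ℝ × ℝ) := {p ∈ Reg l r t0 s | 0 < (fun p : ℝ × ℝ => u p.1 p.2 + g p.1 p.2) p} with hU
  have hUF : U ⊆ F := fun p hp => hF p hp.1 hp.2
  have ht0 : t0 ∈ Icc t0 s := ⟨le_rfl, hts⟩
  have hwc := h.uc.add hgc
  set P := pathComponentIn U (x, s) with hP
  have hPU : P ⊆ U := pathComponentIn_subset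
  have hxU : (x, s) ∈ U := ⟨⟨⟨hts, le_rfl⟩, hx⟩, hpos⟩
  have hjoin : ∀ p ∈ P, JoinedIn U (x, s) p := fun p hp => hp
  by_cases hA : ∃ y, (y, t0) ∈ P
  · obtain ⟨y, hy⟩ := hA
    exact ⟨y, (hPU hy).1.2, (hjoin _ hy).mono hUF⟩
  by_cases hB : ∃ t, (l t, t) ∈ P
  · obtain ⟨t, ht⟩ := hB
    have htI : t ∈ Icc t0 s := (hPU ht).1.1
    have hL' := hL.resolve_right fun hh => by
      have h1 : 0 < u (l t) t + g (l t) t := (hPU ht).2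
      linarith [hh t htI]
    exact ⟨l t0, ⟨le_rfl, (hlr t0 ht0).le⟩, ((hjoin _ ht).mono hUF).trans (slide h.lc htI hL')⟩
  by_cases hC : ∃ t, (r t, t) ∈ P
  · obtain ⟨t, ht⟩ := hC
    have htI : t ∈ Icc t0 s := (hPU ht).1.1
    have hR' := hR.resolve_right fun hh => by
      have h1 : 0 < u (r t) t + g (r t) t := (hPU ht).2
      linarith [hh t htI]
    exact ⟨r t0, ⟨(hlr t0 ht0).le, le_rfl⟩, ((hjoin _ ht).mono hUF).trans (slide h.rc htI hR')⟩
  exfalso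
  push Not at hA hB hC
  have hcl : closure P ⊆ Reg l r t0 s :=
    closure_minimal (hPU.trans fun p hp => hp.1) h.compact.isClosed
  have hKc : IsCompact (closure P) := h.compact.of_isClosed_subset isClosed_closure hcl
  have hxP : (x, s) ∈ P := mem_pathComponentIn_self hxU
  have := MP_compact h.hM hKc (hwc.mono hcl) ?_ x s (subset_closure hxP)
  · linarith
  intro y τ hyK hyp
  obtain ⟨ε, hε, hj⟩ := loc_path h hlr hwc (hcl hyK) hyp
  have hyP : (y, τ) ∈ P := by
    obtain ⟨p', hp', hd⟩ := Metric.mem_closure_iff.mp hyK ε hε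
    rw [dist_comm] at hd
    exact (hjoin p' hp').trans (hj p' (hPU hp').1 hd).symm
  have hyR := (hPU hyP).1
  have hτ : τ ∈ Ioc t0 s := by
    refine ⟨lt_of_le_of_ne hyR.1.1 ?_, hyR.1.2⟩
    rintro rfl; exact hA _ hyP
  have hyI : y ∈ Ioo (l τ) (r τ) := by
    refine ⟨lt_of_le_of_ne hyR.2.1 ?_, lt_of_le_of_ne hyR.2.2 ?_⟩
    · intro he; rw [← he] at hyP; exact hB _ hyP
    · intro he; rw [he] at hyP; exact hC _ hyP
  refine ⟨h.good τ hτ y hyI, hg τ hτ y hyI, ?_⟩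
  obtain ⟨δ, hδ, hbox⟩ := h.box hτ hyI
  refine ⟨min δ ε, lt_min hδ hε, fun z σ h1 h2 h3 => subset_closure ?_⟩
  have e1 := min_le_left δ ε
  have e2 := min_le_right δ ε
  obtain ⟨h4, h5⟩ := hbox z σ (by linarith) (by linarith) h3
  refine JoinedIn.trans hyP (hj (z, σ) ⟨⟨h4.1.le, h4.2⟩, ⟨h5.1.le, h5.2.le⟩⟩ ?_)
  rw [Prod.dist_eq, max_lt_iff, Real.dist_eq, Real.dist_eq]
  refine ⟨by simp only; linarith, ?_⟩
  rw [abs_lt]; simp only; constructor <;> linarith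

def FP (l r : ℝ → ℝ) (t0 s : ℝ) (u : ℝ → ℝ → ℝ) (A : ℝ → ℝ) (K lam : ℝ) (pL pR : Prop) : Set (ℝ × ℝ) :=
  {p | p ∈ Reg l r t0 s ∧ (0 < u p.1 p.2 + lam * (A p.1 - K * (p.2 - t0)) ∨ (pL ∧ p.1 = l p.2) ∨ (pR ∧ p.1 = r p.2))}

lemma AT1 {M l r t0 s u} (h : LocSol M l r t0 s u) (hlr : ∀ t ∈ Icc t0 s, l t < r t) (hts : t0 ≤ s)
    {A A1 A2 : ℝ → ℝ} (hA1 : ∀ y, HasDerivAt A (A1 y) y) (hA2 : ∀ y, HasDerivAt A1 (A2 y) y) {B K lam : ℝ}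
    (hB0 : ∀ y, |A y| ≤ B) (hB1 : ∀ y, |A1 y| ≤ B) (hB2 : ∀ y, |A2 y| ≤ B) (hlam : 0 ≤ lam) (hK0 : 0 ≤ K)
    (hK : 3 * M * B + M * K * (s - t0) ≤ K)
    (hAl : ∀ t ∈ Icc t0 s, A (l t) = 0) (hAr : ∀ t ∈ Icc t0 s, A (r t) = 0) {pL pR : Prop}
    (hL : ¬ pL → ∀ t ∈ Icc t0 s, u (l t) t ≤ 0) (hR : ¬ pR → ∀ t ∈ Icc t0 s, u (r t) t ≤ 0)
    {x : ℝ} (hx : x ∈ Icc (l s) (r s)) (hpos : 0 < u x s + lam * (A x - K * (s - t0))) :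
    ∃ y, JoinedIn (FP l r t0 s u A K lam pL pR) (x, s) (y, t0) := by
  have hAc : Continuous A := continuous_iff_continuousAt.mpr fun y => (hA1 y).continuousAt
  have hM := h.hM
  have := TL h hlr hts (g := fun x t => lam * (A x - K * (t - t0))) (F := FP l r t0 s u A K lam pL pR)
    (Continuous.continuousOn (by fun_prop)) ?_ ?_ ?_ ?_ hx hpos
  · obtain ⟨y, -, hy⟩ := this
    exact ⟨y, hy⟩
  · intro t ht y hy
    refine ⟨fun y => lam * A1 y, lam * A2 y, lam * (-(K * 1)), fun y => ?_, (hA2 y).const_mul lam, ?_, ?_⟩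
    · exact ((hA1 y).sub_const _).const_mul lam
    · exact ((((hasDerivAt_id t).sub_const t0).const_mul K).const_sub (A y)).const_mul lam
    · rintro a b c ⟨h1, h2, h3, h4⟩
      have ha : |a| ≤ M := by
        rw [abs_le]; constructor
        · have : 0 ≤ 1 / M := by positivity
          linarith
        · exact h2
      have hM0 : 0 ≤ M := by linarith
      have e1 : |a * A2 y| ≤ M * B := by rw [abs_mul]; exact mul_le_mul ha (hB2 y) (abs_nonneg _) hM0
      have e2 : |b * A1 y| ≤ M * B := by rw [abs_mul]; exact mul_le_mul h3 (hB1 y) (abs_nonneg _) hM0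
      have e3 : |c * A y| ≤ M * B := by rw [abs_mul]; exact mul_le_mul h4 (hB0 y) (abs_nonneg _) hM0
      have e4 : |c * (K * (t - t0))| ≤ M * (K * (s - t0)) := by
        rw [abs_mul]
        refine mul_le_mul h4 ?_ (abs_nonneg _) hM0
        rw [abs_of_nonneg (mul_nonneg hK0 (by linarith [ht.1]))]
        exact mul_le_mul_of_nonneg_left (by linarith [ht.2]) hK0
      have := (abs_le.mp e1).1
      have := (abs_le.mp e2).1
      have := (abs_le.mp e3).1
      have := (abs_le.mp e4).2
      have key : -(K * 1) ≤ a * A2 y + b * A1 y + c * (A y - K * (t - t0)) := by nlinarith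
      calc lam * (-(K * 1)) ≤ lam * (a * A2 y + b * A1 y + c * (A y - K * (t - t0))) :=
            mul_le_mul_of_nonneg_left key hlam
        _ = _ := by ring
  · intro p hp hpp
    exact ⟨hp, Or.inl hpp⟩
  · by_cases hp : pL
    · left; intro t ht
      exact ⟨⟨ht, le_rfl, (hlr t ht).le⟩, Or.inr (Or.inl ⟨hp, rfl⟩)⟩
    · right; intro t ht
      have := hL hp t ht
      rw [hAl t ht]
      have := mul_nonneg hlam (mul_nonneg hK0 (sub_nonneg.mpr ht.1))
      linarith
  · by_cases hp : pR
    · left; intro t ht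
      exact ⟨⟨ht, (hlr t ht).le, le_rfl⟩, Or.inr (Or.inr ⟨hp, rfl⟩)⟩
    · right; intro t ht
      have := hR hp t ht
      rw [hAr t ht]
      have := mul_nonneg hlam (mul_nonneg hK0 (sub_nonneg.mpr ht.1))
      linarith

lemma AT {M l r t0 s u} (h : LocSol M l r t0 s u) (hlr : ∀ t ∈ Icc t0 s, l t < r t) (hts : t0 ≤ s)
    {A A1 A2 : ℝ → ℝ} (hA1 : ∀ y, HasDerivAt A (A1 y) y) (hA2 : ∀ y, HasDerivAt A1 (A2 y) y) {B K lam : ℝ}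
    (hB0 : ∀ y, |A y| ≤ B) (hB1 : ∀ y, |A1 y| ≤ B) (hB2 : ∀ y, |A2 y| ≤ B) (hlam : 0 ≤ lam) (hK0 : 0 ≤ K)
    (hK : 3 * M * B + M * K * (s - t0) ≤ K)
    (hAl : ∀ t ∈ Icc t0 s, A (l t) = 0) (hAr : ∀ t ∈ Icc t0 s, A (r t) = 0) {pL pR : Prop}
    (hL : ¬ pL → ∀ t ∈ Icc t0 s, u (l t) t ≤ 0) (hR : ¬ pR → ∀ t ∈ Icc t0 s, u (r t) t ≤ 0)
    (hL' : pL → ∀ t ∈ Icc t0 s, 0 ≤ u (l t) t) (hR' : pR → ∀ t ∈ Icc t0 s, 0 ≤ u (r t) t) :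
    ∃ Y : ℝ → ℝ,
      (∀ x ∈ Icc (l s) (r s), 0 < u x s + lam * (A x - K * (s - t0)) → Y x ∈ Icc (l t0) (r t0) ∧
        (0 < u (Y x) t0 + lam * A (Y x) ∨ (pL ∧ Y x = l t0) ∨ (pR ∧ Y x = r t0))) ∧
      (∀ x ∈ Icc (l s) (r s), u x s + lam * (A x + K * (s - t0)) < 0 → Y x ∈ Icc (l t0) (r t0) ∧
        (u (Y x) t0 + lam * A (Y x) < 0 ∨ (¬ pL ∧ Y x = l t0) ∨ (¬ pR ∧ Y x = r t0))) ∧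
      (∀ x ∈ Icc (l s) (r s), ∀ x' ∈ Icc (l s) (r s), 0 < u x s + lam * (A x - K * (s - t0)) →
        u x' s + lam * (A x' + K * (s - t0)) < 0 → (x < x' → Y x < Y x') ∧ (x' < x → Y x' < Y x)) := by
  set F1 := FP l r t0 s u A K lam pL pR with hF1
  set F2 := FP l r t0 s (fun x t => -u x t) (fun x => -A x) K lam (¬ pL) (¬ pR) with hF2
  have hdisj : Disjoint F1 F2 := by
    rw [Set.disjoint_left]
    rintro ⟨x, t⟩ ⟨⟨ht, hx⟩, h1⟩ ⟨-, h2⟩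
    simp only at ht hx h1 h2
    have hKt := mul_nonneg hlam (mul_nonneg hK0 (sub_nonneg.mpr ht.1))
    have hlt := hlr t ht
    rcases h1 with h1 | ⟨h1, rfl⟩ | ⟨h1, rfl⟩ <;> rcases h2 with h2 | ⟨h2, he⟩ | ⟨h2, he⟩
    · linarith
    · rw [he, hAl t ht] at h1; linarith [hL h2 t ht]
    · rw [he, hAr t ht] at h1; linarith [hR h2 t ht]
    · rw [hAl t ht] at h2; linarith [hL' h1 t ht]
    · exact h2 h1
    · linarith
    · rw [hAr t ht] at h2; linarith [hR' h1 t ht]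
    · linarith
    · exact h2 h1
  have hex : ∀ x, ∃ y, (x ∈ Icc (l s) (r s) → 0 < u x s + lam * (A x - K * (s - t0)) → JoinedIn F1 (x, s) (y, t0)) ∧
      (x ∈ Icc (l s) (r s) → u x s + lam * (A x + K * (s - t0)) < 0 → JoinedIn F2 (x, s) (y, t0)) := by
    intro x
    by_cases hx : x ∈ Icc (l s) (r s)
    · have hKt := mul_nonneg hlam (mul_nonneg hK0 (sub_nonneg.mpr hts))
      by_cases hp : 0 < u x s + lam * (A x - K * (s - t0))
      · obtain ⟨y, hy⟩ := AT1 h hlr hts hA1 hA2 hB0 hB1 hB2 hlam hK0 hK hAl hAr hL hR hx hp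
        exact ⟨y, fun _ _ => hy, fun _ hh => by linarith⟩
      by_cases hq : u x s + lam * (A x + K * (s - t0)) < 0
      · obtain ⟨y, hy⟩ := AT1 (pL := ¬ pL) (pR := ¬ pR) h.neg hlr hts (A := fun x => -A x) (A1 := fun x => -A1 x) (A2 := fun x => -A2 x)
          (fun y => (hA1 y).fun_neg) (fun y => (hA2 y).fun_neg) (B := B) (by simpa using hB0) (by simpa using hB1) (by simpa using hB2)
          hlam hK0 hK (by simpa using hAl) (by simpa using hAr)
          (fun hp t ht => by simpa using hL' (not_not.mp hp) t ht) (fun hp t ht => by simpa using hR' (not_not.mp hp) t ht)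
          hx (by linarith)
        exact ⟨y, fun _ hh => absurd hh hp, fun _ _ => hy⟩
      · exact ⟨0, fun _ hh => absurd hh hp, fun _ hh => absurd hh hq⟩
    · exact ⟨0, fun hh => absurd hh hx, fun hh => absurd hh hx⟩
  choose Y hY1 hY2 using hex
  refine ⟨Y, fun x hx hp => ?_, fun x hx hp => ?_, fun x hx x' hx' hp hq => ⟨fun hlt => ?_, fun hlt => ?_⟩⟩
  · obtain ⟨⟨-, h1⟩, h2⟩ := (hY1 x hx hp).target_mem
    refine ⟨h1, ?_⟩
    simpa using h2
  · obtain ⟨⟨-, h1⟩, h2⟩ := (hY2 x hx hp).target_mem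
    refine ⟨h1, ?_⟩
    refine h2.imp_left fun hh => ?_
    simp only [sub_self, mul_zero, sub_zero] at hh
    linarith
  · exact crossing hdisj (fun p hp => hp.1.1) (fun p hp => hp.1.1) (hY1 x hx hp) (hY2 x' hx' hq) hlt
  · exact crossing hdisj.symm (fun p hp => hp.1.1) (fun p hp => hp.1.1) (hY2 x' hx' hq) (hY1 x hx hp) hlt

lemma bump_one {δ : ℝ} (hδ : 0 < δ) : ∃ (ψ ψ1 ψ2 : ℝ → ℝ) (B : ℝ), 0 ≤ B ∧ (∀ y, HasDerivAt ψ (ψ1 y) y) ∧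
    (∀ y, HasDerivAt ψ1 (ψ2 y) y) ∧ (∀ y, |ψ y| ≤ B) ∧ (∀ y, |ψ1 y| ≤ B) ∧ (∀ y, |ψ2 y| ≤ B) ∧ ψ 0 = 1 ∧
    (∀ y, 0 ≤ ψ y) ∧ (∀ y, ψ y ≤ 1) ∧ (∀ y, δ ≤ |y| → ψ y = 0) := by
  let f : ContDiffBump (0:ℝ) := ⟨δ/2, δ, by linarith, by linarith⟩
  have hf : ContDiff ℝ 2 f := f.contDiff
  have hf1 : ContDiff ℝ 1 (deriv f) := by
    have : ContDiff ℝ (1+1) f := by simpa [one_add_one_eq_two] using hf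
    exact (contDiff_succ_iff_deriv.mp this).2.2
  have hf2 : Continuous (deriv (deriv f)) := hf1.continuous_deriv le_rfl
  obtain ⟨B0, h0⟩ := f.hasCompactSupport.exists_bound_of_continuous hf.continuous
  obtain ⟨B1, h1⟩ := f.hasCompactSupport.deriv.exists_bound_of_continuous hf1.continuous
  obtain ⟨B2, h2⟩ := f.hasCompactSupport.deriv.deriv.exists_bound_of_continuous hf2
  have hB0 := (norm_nonneg _).trans (h0 0)
  have hB1 := (norm_nonneg _).trans (h1 0)
  have hB2 := (norm_nonneg _).trans (h2 0)
  refine ⟨f, deriv f, deriv (deriv f), B0 + B1 + B2, by positivity, ?_, ?_, ?_, ?_, ?_, ?_, ?_, ?_, ?_⟩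
  · exact fun y => (hf.differentiable (by norm_num) y).hasDerivAt
  · exact fun y => (hf1.differentiable (by norm_num) y).hasDerivAt
  · intro y; have := h0 y; rw [Real.norm_eq_abs] at this; linarith
  · intro y; have := h1 y; rw [Real.norm_eq_abs] at this; linarith
  · intro y; have := h2 y; rw [Real.norm_eq_abs] at this; linarith
  · exact f.one_of_mem_closedBall (Metric.mem_closedBall_self (by simp [f]; linarith))
  · exact fun y => f.nonneg
  · exact fun y => f.le_one
  · intro y hy
    apply f.zero_of_le_dist
    simpa [f, Real.dist_eq] using hy

lemma bump_comb {δ : ℝ} (hδ : 0 < δ) (n : ℕ) : ∃ B : ℝ, 0 ≤ B ∧ ∀ (c σ : Fin n → ℝ), (∀ j, |σ j| ≤ 1) →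
    (∀ i j, i ≠ j → 2 * δ ≤ |c i - c j|) → ∃ A A1 A2 : ℝ → ℝ, (∀ y, HasDerivAt A (A1 y) y) ∧
      (∀ y, HasDerivAt A1 (A2 y) y) ∧ (∀ y, |A y| ≤ B) ∧ (∀ y, |A1 y| ≤ B) ∧ (∀ y, |A2 y| ≤ B) ∧
      (∀ i, A (c i) = σ i) ∧ (∀ x, A x = 0 ∨ ∃ j, |x - c j| < δ ∧ ∃ θ, 0 < θ ∧ θ ≤ 1 ∧ A x = θ * σ j) := by
  obtain ⟨ψ, ψ1, ψ2, B, hB, d1, d2, b0, b1, b2, p0, pn, pl, ps⟩ := bump_one hδ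
  refine ⟨n * B, by positivity, fun c σ hσ hc => ?_⟩
  have hbound : ∀ φ : ℝ → ℝ, (∀ y, |φ y| ≤ B) → ∀ y, |∑ j, σ j * φ (y - c j)| ≤ n * B := by
    intro φ hφ y
    refine (Finset.abs_sum_le_sum_abs _ _).trans ?_
    have : ∀ j ∈ Finset.univ, |σ j * φ (y - c j)| ≤ B := fun j _ => by
      rw [abs_mul]
      calc _ ≤ 1 * B := mul_le_mul (hσ j) (hφ _) (abs_nonneg _) zero_le_one
        _ = B := one_mul B
    refine (Finset.sum_le_card_nsmul _ _ _ this).trans ?_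
    simp
  have hder : ∀ φ φ1 : ℝ → ℝ, (∀ y, HasDerivAt φ (φ1 y) y) → ∀ y,
      HasDerivAt (fun y => ∑ j, σ j * φ (y - c j)) (∑ j, σ j * φ1 (y - c j)) y := by
    intro φ φ1 h y
    refine HasDerivAt.fun_sum fun j _ => ?_
    exact ((h (y - c j)).comp_sub_const y (c j)).const_mul (σ j)
  have hloc : ∀ i x, |x - c i| < δ → ∑ j, σ j * ψ (x - c j) = σ i * ψ (x - c i) := by
    intro i x hx
    refine Finset.sum_eq_single i (fun j _ hj => ?_) (by simp)
    rw [ps, mul_zero]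
    have := hc i j (Ne.symm hj)
    have h3 : |c i - c j| ≤ |x - c i| + |x - c j| := by
      have := abs_sub_le (c i) x (c j)
      rw [abs_sub_comm (c i) x] at this
      exact this
    linarith
  refine ⟨_, _, _, hder ψ ψ1 d1, hder ψ1 ψ2 d2, hbound ψ b0, hbound ψ1 b1, hbound ψ2 b2, fun i => ?_, fun x => ?_⟩
  · rw [hloc i (c i) (by simpa using hδ)]; simp [p0]
  · by_cases h : ∃ j, |x - c j| < δ
    · obtain ⟨j, hj⟩ := h
      rw [hloc j x hj]
      rcases (pn (x - c j)).eq_or_lt with he | hlt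
      · left; rw [← he, mul_zero]
      · right; exact ⟨j, hj, ψ (x - c j), hlt, pl _, mul_comm _ _⟩
    · left
      push Not at h
      exact Finset.sum_eq_zero fun j _ => by rw [ps _ (h j), mul_zero]

lemma encard_ge_of_inj {S : Set ℝ} {m : ℕ} {z : ℕ → ℝ} (hz : ∀ j < m, z j ∈ S) (hi : InjOn z (Iio m)) :
    (m : ℕ∞) ≤ S.encard := by
  have h1 : (Finset.range m : Set ℕ).encard ≤ S.encard :=
    Set.encard_le_encard_of_injOn (f := z) (fun j hj => hz j (by simpa using hj)) (by simpa using hi)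
  rwa [Set.encard_coe_eq_coe_finsetCard, Finset.card_range] at h1

lemma ivt_sign {f : ℝ → ℝ} {a b : ℝ} (hab : a < b) (hf : ContinuousOn f (Icc a b)) (h : f a * f b < 0) :
    ∃ z ∈ Ioo a b, f z = 0 := by
  have h0 : (0:ℝ) ∈ f '' Icc a b := by
    rcases mul_neg_iff.mp h with ⟨h1, h2⟩ | ⟨h1, h2⟩
    · exact intermediate_value_Icc' hab.le hf ⟨h2.le, h1.le⟩
    · exact intermediate_value_Icc hab.le hf ⟨h1.le, h2.le⟩
  obtain ⟨z, hz, hz0⟩ := h0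
  refine ⟨z, ⟨lt_of_le_of_ne hz.1 ?_, lt_of_le_of_ne hz.2 ?_⟩, hz0⟩
  · rintro rfl; simp [hz0] at h
  · rintro rfl; simp [hz0] at h

lemma zeros_of_alt {f : ℝ → ℝ} {p q : ℝ} (hf : ContinuousOn f (Icc p q)) {m : ℕ} {y : ℕ → ℝ}
    (hy : ∀ j ≤ m, y j ∈ Icc p q) (hlt : ∀ j < m, y j < y (j+1)) (hs : ∀ j < m, f (y j) * f (y (j+1)) < 0) :
    (m : ℕ∞) ≤ {x ∈ Icc p q | f x = 0}.encard := by
  have hex : ∀ j, ∃ z, j < m → z ∈ Ioo (y j) (y (j+1)) ∧ f z = 0 := by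
    intro j
    by_cases hj : j < m
    · obtain ⟨z, hz, hz0⟩ := ivt_sign (hlt j hj)
        (hf.mono (Icc_subset_Icc (hy j hj.le).1 (hy (j+1) hj).2)) (hs j hj)
      exact ⟨z, fun _ => ⟨hz, hz0⟩⟩
    · exact ⟨0, fun h => absurd h hj⟩
  choose z hz using hex
  have hmono : ∀ i j, i ≤ j → j ≤ m → y i ≤ y j := by
    intro i j hij
    induction j, hij using Nat.le_induction with
    | base => intro _; exact le_rfl
    | succ j hj ih => intro hm; exact (ih (by omega)).trans (hlt j (by omega)).le
  have hzlt : ∀ i j, i < j → j < m → z i < z j := by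
    intro i j hij hj
    have h1 := (hz i (by omega)).1.2
    have h2 := (hz j hj).1.1
    have h3 := hmono (i+1) j hij hj.le
    linarith
  refine encard_ge_of_inj (z := z) (fun j hj => ?_) ?_
  · obtain ⟨h1, h2⟩ := hz j hj
    exact ⟨⟨(hy j hj.le).1.trans h1.1.le, h1.2.le.trans (hy (j+1) hj).2⟩, h2⟩
  · intro i hi j hj he
    rcases lt_trichotomy i j with h | h | h
    · have := hzlt i j h hj; linarith
    · exact h
    · have := hzlt j i h hi; linarith

lemma LocSol.slice {M l r t0 t1 u} (h : LocSol M l r t0 t1 u) {t : ℝ} (ht : t ∈ Icc t0 t1) :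
    ContinuousOn (fun x => u x t) (Icc (l t) (r t)) :=
  h.uc.comp (f := fun x : ℝ => (x, t)) (by fun_prop) fun _ hx => ⟨ht, hx⟩

lemma LocSol.time {M l r t0 t1 u} (h : LocSol M l r t0 t1 u) {ρ : ℝ → ℝ} (hρ : ContinuousOn ρ (Icc t0 t1))
    (h2 : ∀ t ∈ Icc t0 t1, ρ t ∈ Icc (l t) (r t)) :
    ContinuousOn (fun t => u (ρ t) t) (Icc t0 t1) :=
  h.uc.comp (f := fun t : ℝ => (ρ t, t)) (hρ.prodMk continuousOn_id) fun t ht => ⟨ht, h2 t ht⟩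

lemma ev_left {f : ℝ → ℝ} {a0 s q : ℝ} (ha : a0 < s) (hf : ContinuousOn f (Icc a0 s)) (h : f s < q) :
    ∃ e, a0 ≤ e ∧ e < s ∧ ∀ t ∈ Icc e s, f t < q := by
  have h1 : ∀ᶠ t in 𝓝[Icc a0 s] s, f t < q := (hf s ⟨ha.le, le_rfl⟩).eventually (gt_mem_nhds h)
  obtain ⟨ε, hε, hb⟩ := Metric.mem_nhdsWithin_iff.mp h1
  refine ⟨max a0 (s - ε/2), le_max_left _ _, max_lt ha (by linarith), fun t ht => ?_⟩
  have e1 := (le_max_left a0 (s - ε/2)).trans ht.1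
  have e2 := (le_max_right a0 (s - ε/2)).trans ht.1
  refine hb ⟨?_, e1, ht.2⟩
  rw [Metric.mem_ball, Real.dist_eq, abs_lt]; constructor <;> linarith [ht.2]

lemma ev_left' {f : ℝ → ℝ} {a0 s q : ℝ} (ha : a0 < s) (hf : ContinuousOn f (Icc a0 s)) (h : q < f s) :
    ∃ e, a0 ≤ e ∧ e < s ∧ ∀ t ∈ Icc e s, q < f t := by
  obtain ⟨e, h1, h2, h3⟩ := ev_left (f := fun t => -f t) (q := -q) ha hf.neg (by linarith)
  exact ⟨e, h1, h2, fun t ht => by linarith [h3 t ht]⟩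

lemma L1 {M l r a0 s u} {N : ℕ} (h : LocSol M l r a0 s u) (hlr : ∀ t ∈ Icc a0 s, l t < r t) (ha : a0 < s)
    {pL pR : Prop}
    (hL : ¬ pL → ∀ t ∈ Icc a0 s, u (l t) t ≤ 0) (hR : ¬ pR → ∀ t ∈ Icc a0 s, u (r t) t ≤ 0)
    (hL' : pL → ∀ t ∈ Icc a0 s, 0 ≤ u (l t) t) (hR' : pR → ∀ t ∈ Icc a0 s, 0 ≤ u (r t) t)
    (hZ : ∀ t ∈ Ico a0 s, (zeroSet u l r t).encard ≤ N)
    {α β : ℝ} (hαβ : α < β) (hα : l s < α) (hβ : β < r s) (h0 : ∀ x ∈ Icc α β, u x s = 0) : False := by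
  set n := 2 * N + 4 with hn
  set δ := (β - α) / (3 * (n + 1)) with hδ
  have hδp : 0 < δ := div_pos (by linarith) (by positivity)
  have hδe : 3 * δ * (n + 1) = β - α := by rw [hδ]; field_simp
  set c : ℕ → ℝ := fun i => α + 3 * δ * (i + 1) with hc
  have hcI : ∀ i < n, ∀ x, |x - c i| ≤ δ → x ∈ Ioo α β := by
    intro i hi x hx
    have hi' : (i:ℝ) + 1 ≤ n := by exact_mod_cast hi
    obtain ⟨h1, h2⟩ := abs_le.mp hx
    have h3 : c i = α + 3 * δ * (i + 1) := rfl
    have h4 : 0 ≤ δ * (i:ℝ) := by positivity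
    have h5 : δ * ((i:ℝ) + 1) ≤ δ * n := by gcongr
    constructor <;> nlinarith
  have hcsep : ∀ i j, i < j → c i + 3 * δ ≤ c j := by
    intro i j hij
    have : (i:ℝ) + 1 ≤ j := by exact_mod_cast hij
    simp only [hc]; nlinarith
  have hcsep' : ∀ i j, i ≠ j → 3 * δ ≤ |c i - c j| := by
    intro i j hij
    rcases lt_or_gt_of_ne hij with h | h
    · rw [abs_sub_comm]; exact le_trans (by linarith [hcsep i j h]) (le_abs_self _)
    · exact le_trans (by linarith [hcsep j i h]) (le_abs_self _)
  obtain ⟨B, hB, hcomb⟩ := bump_comb hδp (N + 4)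
  have hM := h.hM
  set K := 6 * M * B + 1 with hK
  have hKp : 0 < K := by positivity
  -- choice of t0
  obtain ⟨e1, e1a, e1s, e1h⟩ := ev_left ha h.lc hα
  obtain ⟨e2, e2a, e2s, e2h⟩ := ev_left' ha h.rc hβ
  set t0 := max (max e1 e2) (max (s - 1/(2*M)) (s - 1/(2*K))) with ht0
  have hMp : 0 < 1/(2*M) := by positivity
  have hKp' : 0 < 1/(2*K) := by positivity
  have ht0s : t0 < s := max_lt (max_lt e1s e2s) (max_lt (by linarith) (by linarith))
  have q1 : e1 ≤ t0 := (le_max_left _ _).trans (le_max_left _ _)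
  have q2 : e2 ≤ t0 := (le_max_right _ _).trans (le_max_left _ _)
  have q3 : s - 1/(2*M) ≤ t0 := (le_max_left _ _).trans (le_max_right _ _)
  have q4 : s - 1/(2*K) ≤ t0 := (le_max_right _ _).trans (le_max_right _ _)
  have ha0 : a0 ≤ t0 := e1a.trans q1
  have hMs : M * (s - t0) ≤ 1/2 := by
    have : M * (s - t0) ≤ M * (1/(2*M)) := by gcongr; linarith
    have e : M * (1/(2*M)) = 1/2 := by field_simp
    linarith
  have hKs : K * (s - t0) ≤ 1/2 := by
    have : K * (s - t0) ≤ K * (1/(2*K)) := by gcongr; linarith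
    have e : K * (1/(2*K)) = 1/2 := by field_simp
    linarith
  have hsub : ∀ t ∈ Icc t0 s, t ∈ Icc a0 s := fun t ht => ⟨ha0.trans ht.1, ht.2⟩
  have ht0I : t0 ∈ Icc t0 s := ⟨le_rfl, ht0s.le⟩
  have hin : ∀ t ∈ Icc t0 s, l t < α ∧ β < r t := fun t ht =>
    ⟨e1h t ⟨q1.trans ht.1, ht.2⟩, e2h t ⟨q2.trans ht.1, ht.2⟩⟩
  -- good indices
  classical
  set Bd := (Finset.range n).filter (fun i => ∃ z, |z - c i| ≤ δ ∧ u z t0 = 0) with hBd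
  have hBdN : Bd.card ≤ N := by
    have hex : ∀ i, ∃ z, i ∈ Bd → |z - c i| ≤ δ ∧ u z t0 = 0 := by
      intro i
      by_cases hi : i ∈ Bd
      · obtain ⟨z, hz⟩ := (Finset.mem_filter.mp hi).2
        exact ⟨z, fun _ => hz⟩
      · exact ⟨0, fun hh => absurd hh hi⟩
    choose z hz using hex
    have h1 : (Bd : Set ℕ).encard ≤ (zeroSet u l r t0).encard := by
      refine Set.encard_le_encard_of_injOn (f := z) ?_ ?_
      · intro i hi
        have hi' : i ∈ Bd := hi
        obtain ⟨z1, z2⟩ := hz i hi'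
        have := hcI i (Finset.mem_range.mp (Finset.mem_filter.mp hi').1) _ z1
        have := hin t0 ht0I
        refine ⟨⟨?_, ?_⟩, z2⟩ <;> simp only [mem_Ioo] at * <;> linarith
      · intro i hi j hj he
        by_contra hne
        have z1 := (hz i hi).1
        have z2 := (hz j hj).1
        have h3 := hcsep' i j hne
        rw [he] at z1
        have h4 : |c i - c j| ≤ |z j - c i| + |z j - c j| := by
          have := abs_sub_le (c i) (z j) (c j)
          rw [abs_sub_comm (c i) (z j)] at this
          exact this
        linarith
    rw [Set.encard_coe_eq_coe_finsetCard] at h1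
    exact_mod_cast h1.trans (hZ t0 ⟨ha0, ht0s⟩)
  set Gd := (Finset.range n) \ Bd with hGd
  have hGdc : N + 4 ≤ Gd.card := by
    have : n - Bd.card ≤ Gd.card := by
      have := Finset.le_card_sdiff Bd (Finset.range n)
      rwa [Finset.card_range] at this
    omega
  set g := Gd.orderEmbOfCardLe hGdc with hg
  have hgm : ∀ j, g j ∈ Gd := fun j => Finset.orderEmbOfCardLe_mem Gd hGdc j
  have hgn : ∀ j, g j < n := fun j => Finset.mem_range.mp (Finset.mem_sdiff.mp (hgm j)).1
  have hgz : ∀ j z, |z - c (g j)| ≤ δ → u z t0 ≠ 0 := by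
    intro j z hz he
    refine (Finset.mem_sdiff.mp (hgm j)).2 (Finset.mem_filter.mpr ⟨Finset.mem_range.mpr (hgn j), z, hz, he⟩)
  obtain ⟨A, A1, A2, d1, d2, b0, b1, b2, hAc, hAx⟩ := hcomb (fun j => c (g j)) (fun j => (-1)^(j:ℕ))
    (fun j => by simp) (fun i j hij => by
      have := hcsep' (g i) (g j) (fun he => hij (g.injective he))
      linarith)
  have hA0 : ∀ x, x ∉ Ioo α β → A x = 0 := by
    intro x hx
    rcases hAx x with h | ⟨j, hj, -⟩
    · exact h
    · exact absurd (hcI _ (hgn j) x hj.le) hx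
  -- lambda
  obtain ⟨lam, hlam, hlamu⟩ : ∃ lam > 0, ∀ j x, |x - c (g j)| ≤ δ → lam < |u x t0| := by
    set Kc : Set ℝ := ⋃ j, Metric.closedBall (c (g j)) δ with hKc
    have hcomp : IsCompact Kc := isCompact_iUnion fun j => isCompact_closedBall _ _
    have hKsub : Kc ⊆ Icc (l t0) (r t0) := by
      intro x hx
      obtain ⟨j, hj⟩ := mem_iUnion.mp hx
      rw [Metric.mem_closedBall, Real.dist_eq] at hj
      have h1 := hcI _ (hgn j) x hj
      have h2 := hin t0 ht0I
      exact ⟨by linarith [h1.1], by linarith [h1.2]⟩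
    have hne : Kc.Nonempty := ⟨c (g 0), mem_iUnion.mpr ⟨0, Metric.mem_closedBall_self hδp.le⟩⟩
    obtain ⟨xm, hxm, hmin⟩ := hcomp.exists_isMinOn hne ((h.slice (hsub t0 ht0I)).mono hKsub).abs
    have hpos : 0 < |u xm t0| := by
      obtain ⟨j, hj⟩ := mem_iUnion.mp hxm
      rw [Metric.mem_closedBall, Real.dist_eq] at hj
      exact abs_pos.mpr (hgz j xm hj)
    refine ⟨|u xm t0| / 2, by linarith, fun j x hx => ?_⟩
    have : |u xm t0| ≤ |u x t0| := hmin (mem_iUnion.mpr ⟨j, by rwa [Metric.mem_closedBall, Real.dist_eq]⟩)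
    linarith
  have hloc : LocSol M l r t0 s u := h.mono ha0 le_rfl (h.lc.mono hsub) (h.rc.mono hsub)
    (fun t _ => le_rfl) (fun t ht => h.lr t (hsub t ht)) (fun t _ => le_rfl)
  obtain ⟨Y, Y1, Y2, Y3⟩ := AT (pL := pL) (pR := pR) hloc (fun t ht => hlr t (hsub t ht)) ht0s.le d1 d2 b0 b1 b2
    hlam.le hKp.le (by nlinarith)
    (fun t ht => hA0 _ fun hh => by linarith [hh.1, (hin t ht).1])
    (fun t ht => hA0 _ fun hh => by linarith [hh.2, (hin t ht).2])
    (fun hp t ht => hL hp t (hsub t ht)) (fun hp t ht => hR hp t (hsub t ht))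
    (fun hp t ht => hL' hp t (hsub t ht)) (fun hp t ht => hR' hp t (hsub t ht))
  set X : ℕ → ℝ := fun j => if hj : j < N + 4 then c (g ⟨j, hj⟩) else 0 with hX
  have hXe : ∀ j (hj : j < N + 4), X j = c (g ⟨j, hj⟩) := fun j hj => by simp [hX, hj]
  have hXA : ∀ j, j < N + 4 → A (X j) = (-1)^j := fun j hj => by rw [hXe j hj]; exact hAc ⟨j, hj⟩
  have hXI : ∀ j, j < N + 4 → X j ∈ Ioo α β := fun j hj => by
    rw [hXe j hj]; exact hcI _ (hgn ⟨j, hj⟩) _ (by simpa using hδp.le)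
  have hXI' : ∀ j, j < N + 4 → X j ∈ Icc (l s) (r s) := fun j hj => by
    have := hXI j hj; exact ⟨by linarith [this.1], by linarith [this.2]⟩
  have hXlt : ∀ j, j + 1 < N + 4 → X j < X (j+1) := fun j hj => by
    rw [hXe j (by omega), hXe (j+1) hj]
    have : g ⟨j, by omega⟩ < g ⟨j+1, hj⟩ := g.strictMono (by simp [Fin.lt_def])
    linarith [hcsep _ _ this]
  have hXu : ∀ j, j < N + 4 → u (X j) s = 0 := fun j hj => h0 _ ⟨(hXI j hj).1.le, (hXI j hj).2.le⟩
  have hXp : ∀ j, j < N + 4 → Even j → 0 < u (X j) s + lam * (A (X j) - K * (s - t0)) := fun j hj he => by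
    rw [hXu j hj, hXA j hj, he.neg_one_pow, zero_add]; apply mul_pos hlam; linarith
  have hXn : ∀ j, j < N + 4 → ¬ Even j → u (X j) s + lam * (A (X j) + K * (s - t0)) < 0 := fun j hj he => by
    rw [hXu j hj, hXA j hj, (Nat.not_even_iff_odd.mp he).neg_one_pow, zero_add]
    apply mul_neg_of_pos_of_neg hlam; linarith
  have hYlt : ∀ j, j + 1 < N + 4 → Y (X j) < Y (X (j+1)) := fun j hj => by
    by_cases he : Even j
    · have he' : ¬ Even (j+1) := by rw [Nat.even_add_one]; exact not_not.mpr he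
      exact (Y3 _ (hXI' j (by omega)) _ (hXI' (j+1) hj) (hXp j (by omega) he) (hXn (j+1) hj he')).1 (hXlt j hj)
    · have he' : Even (j+1) := by rw [Nat.even_add_one]; exact he
      exact (Y3 _ (hXI' (j+1) hj) _ (hXI' j (by omega)) (hXp (j+1) hj he') (hXn j (by omega) he)).2 (hXlt j hj)
  have hYI : ∀ j, j < N + 4 → Y (X j) ∈ Icc (l t0) (r t0) := fun j hj => by
    by_cases he : Even j
    · exact (Y1 _ (hXI' j hj) (hXp j hj he)).1
    · exact (Y2 _ (hXI' j hj) (hXn j hj he)).1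
  have hYint : ∀ j, j + 2 < N + 4 → Y (X (j+1)) ≠ l t0 ∧ Y (X (j+1)) ≠ r t0 := fun j hj => by
    have h1 := hYlt j (by omega)
    have h2 := hYlt (j+1) hj
    have h3 := (hYI j (by omega)).1
    have h4 := (hYI (j+2) hj).2
    constructor
    · intro he; linarith
    · intro he
      have h5 : Y (X (j+1+1)) ≤ r t0 := h4
      linarith
  have hsgn : ∀ y, |lam * A y| < |u y t0| ∨ A y = 0 := by
    intro y
    rcases hAx y with h | ⟨j, hj, θ, hθ, hθ1, he⟩
    · exact Or.inr h
    · left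
      refine lt_of_le_of_lt ?_ (hlamu j y hj.le)
      rw [abs_mul, he, abs_mul, abs_of_pos hlam, abs_of_pos hθ]
      simp
      nlinarith
  have hpos : ∀ y, 0 < u y t0 + lam * A y → 0 < u y t0 := by
    intro y hy
    rcases hsgn y with h | h
    · by_contra hh; push Not at hh
      rw [abs_of_nonpos hh] at h
      linarith [le_abs_self (lam * A y)]
    · rw [h] at hy; linarith
  have hneg : ∀ y, u y t0 + lam * A y < 0 → u y t0 < 0 := by
    intro y hy
    rcases hsgn y with h | h
    · by_contra hh; push Not at hh
      rw [abs_of_nonneg hh] at h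
      linarith [neg_abs_le (lam * A y)]
    · rw [h] at hy; linarith
  have hse : ∀ j, j + 2 < N + 4 → Even (j+1) → 0 < u (Y (X (j+1))) t0 := fun j hj he => by
    obtain ⟨-, h | h | h⟩ := Y1 _ (hXI' (j+1) (by omega)) (hXp (j+1) (by omega) he)
    · exact hpos _ h
    · exact absurd h.2 (hYint j hj).1
    · exact absurd h.2 (hYint j hj).2
  have hso : ∀ j, j + 2 < N + 4 → ¬ Even (j+1) → u (Y (X (j+1))) t0 < 0 := fun j hj he => by
    obtain ⟨-, h | h | h⟩ := Y2 _ (hXI' (j+1) (by omega)) (hXn (j+1) (by omega) he)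
    · exact hneg _ h
    · exact absurd h.2 (hYint j hj).1
    · exact absurd h.2 (hYint j hj).2
  have hfin := zeros_of_alt (h.slice (hsub t0 ht0I)) (m := N + 1) (y := fun j => Y (X (j+1)))
    (fun j hj => hYI (j+1) (by omega)) (fun j hj => hYlt (j+1) (by omega)) (fun j hj => by
      by_cases he : Even (j+1)
      · have he' : ¬ Even (j+1+1) := by rw [Nat.even_add_one]; exact not_not.mpr he
        exact mul_neg_of_pos_of_neg (hse j (by omega) he) (hso (j+1) (by omega) he')
      · have he' : Even (j+1+1) := by rw [Nat.even_add_one]; exact he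
        exact mul_neg_of_neg_of_pos (hso j (by omega) he) (hse (j+1) (by omega) he'))
  have := hfin.trans (hZ t0 ⟨ha0, ht0s⟩)
  have : N + 1 ≤ N := by exact_mod_cast this
  omega

lemma ev_lt {P : ℝ → Prop} {a s : ℝ} (ha : a < s) (h : ∀ᶠ τ in 𝓝[Icc a s] s, P τ) :
    ∀ᶠ t in 𝓝[<] s, t ∈ Ioo a s ∧ ∀ τ ∈ Icc t s, P τ := by
  obtain ⟨ε, hε, hb⟩ := Metric.mem_nhdsWithin_iff.mp h
  filter_upwards [Ioo_mem_nhdsLT (max_lt ha (show s - ε < s by linarith))] with t ht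
  have h1 := lt_of_le_of_lt (le_max_left a (s - ε)) ht.1
  have h2 := lt_of_le_of_lt (le_max_right a (s - ε)) ht.1
  refine ⟨⟨h1, ht.2⟩, fun τ hτ => hb ⟨?_, h1.le.trans hτ.1, hτ.2⟩⟩
  rw [Metric.mem_ball, Real.dist_eq, abs_lt]; constructor <;> linarith [hτ.1, hτ.2]

lemma ev_gt {P : ℝ → Prop} {b s : ℝ} (hb : s < b) (h : ∀ᶠ τ in 𝓝[Icc s b] s, P τ) :
    ∀ᶠ t in 𝓝[>] s, t ∈ Ioo s b ∧ ∀ τ ∈ Icc s t, P τ := by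
  obtain ⟨ε, hε, hh⟩ := Metric.mem_nhdsWithin_iff.mp h
  filter_upwards [Ioo_mem_nhdsGT (lt_min hb (show s < s + ε by linarith))] with t ht
  have h1 := lt_of_lt_of_le ht.2 (min_le_left b (s + ε))
  have h2 := lt_of_lt_of_le ht.2 (min_le_right b (s + ε))
  refine ⟨⟨ht.1, h1⟩, fun τ hτ => hh ⟨?_, hτ.1, hτ.2.trans h1.le⟩⟩
  rw [Metric.mem_ball, Real.dist_eq, abs_lt]; constructor <;> linarith [hτ.1, hτ.2]

def H2L (T : ℝ) (l : ℝ → ℝ) (u : ℝ → ℝ → ℝ) : Prop :=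
  ∀ s ∈ Ioo 0 T, u (l s) s = 0 → (∃ ε > 0, ∀ t ∈ Ioo (s - ε) s, 0 < u (l t) t) →
    (∃ L, HasDerivWithinAt l L (Iio s) s) ∧ pdx u (l s) s ≤ 0

structure Pre (M T : ℝ) (l r : ℝ → ℝ) (u : ℝ → ℝ → ℝ) : Prop where
  loc : LocSol M l r 0 T u
  lr : ∀ t ∈ Icc 0 T, l t < r t
  dl : ∀ t ∈ Ioo 0 T, DifferentiableAt ℝ (fun y => u y t) (l t)
  dr : ∀ t ∈ Ioo 0 T, DifferentiableAt ℝ (fun y => u y t) (r t)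
  h1 : H2L T l u
  h2 : H2L T l (fun x t => -u x t)
  h3 : H2L T (fun t => -r t) (fun x t => u (-x) t)
  h4 : H2L T (fun t => -r t) (fun x t => -u (-x) t)

lemma Pre.neg {M T l r u} (h : Pre M T l r u) : Pre M T l r (fun x t => -u x t) :=
  ⟨h.loc.neg, h.lr, fun t ht => (h.dl t ht).neg, fun t ht => (h.dr t ht).neg, h.h2,
    by simpa only [neg_neg] using h.h1, h.h4, by simpa only [neg_neg] using h.h3⟩

lemma Pre.refl {M T l r u} (h : Pre M T l r u) :
    Pre M T (fun t => -r t) (fun t => -l t) (fun x t => u (-x) t) := by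
  refine ⟨h.loc.refl, fun t ht => neg_lt_neg (h.lr t ht), fun t ht => ?_, fun t ht => ?_, h.h3, h.h4,
    by simpa only [neg_neg] using h.h1, by simpa only [neg_neg] using h.h2⟩
  · have hd' : DifferentiableAt ℝ (fun y => u y t) (- -r t) := by rw [neg_neg]; exact h.dr t ht
    exact DifferentiableAt.comp (f := fun y : ℝ => -y) (g := fun z => u z t) (-r t) hd' differentiableAt_id.neg
  · have hd' : DifferentiableAt ℝ (fun y => u y t) (- -l t) := by rw [neg_neg]; exact h.dl t ht
    exact DifferentiableAt.comp (f := fun y : ℝ => -y) (g := fun z => u z t) (-l t) hd' differentiableAt_id.neg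

lemma Pre.restr {M T l r u} (h : Pre M T l r u) {a b : ℝ} (ha : 0 ≤ a) (hb : b ≤ T) {l' r' : ℝ → ℝ}
    (hl : ContinuousOn l' (Icc a b)) (hr : ContinuousOn r' (Icc a b))
    (h1 : ∀ t ∈ Icc a b, l t ≤ l' t) (h2 : ∀ t ∈ Icc a b, l' t ≤ r' t) (h3 : ∀ t ∈ Icc a b, r' t ≤ r t) :
    LocSol M l' r' a b u := h.loc.mono ha hb hl hr h1 h2 h3

lemma Pre.lc {M T l r u} (h : Pre M T l r u) {a b : ℝ} (ha : 0 ≤ a) (hb : b ≤ T) : ContinuousOn l (Icc a b) :=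
  h.loc.lc.mono (Icc_subset_Icc ha hb)
lemma Pre.rc {M T l r u} (h : Pre M T l r u) {a b : ℝ} (ha : 0 ≤ a) (hb : b ≤ T) : ContinuousOn r (Icc a b) :=
  h.loc.rc.mono (Icc_subset_Icc ha hb)

lemma first_zero {w : ℝ → ℝ} {t s : ℝ} (hts : t ≤ s) (hw : ContinuousOn w (Icc t s)) (h0 : 0 < w t) (h1 : w s ≤ 0) :
    ∃ e ∈ Ioc t s, w e = 0 ∧ ∀ τ ∈ Ico t e, 0 < w τ := by
  set S := {τ ∈ Icc t s | w τ = 0} with hS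
  have hSc : IsCompact S := by
    have : IsClosed S := by
      have := hw.preimage_isClosed_of_isClosed isClosed_Icc (isClosed_singleton (x := (0:ℝ)))
      exact this
    exact isCompact_Icc.of_isClosed_subset this fun x hx => hx.1
  have hSn : S.Nonempty := by
    obtain ⟨z, hz, hz0⟩ := intermediate_value_Icc' hts hw ⟨h1, h0.le⟩
    exact ⟨z, hz, hz0⟩
  obtain ⟨e, he, hmin⟩ := hSc.exists_isLeast hSn
  have hte : t < e := lt_of_le_of_ne he.1.1 (by rintro rfl; linarith [he.2])
  refine ⟨e, ⟨hte, he.1.2⟩, he.2, fun τ hτ => ?_⟩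
  by_contra hneg
  push Not at hneg
  obtain ⟨z, hz, hz0⟩ := intermediate_value_Icc' hτ.1 (hw.mono (Icc_subset_Icc le_rfl (hτ.2.le.trans he.1.2))) ⟨hneg, h0.le⟩
  have := hmin ⟨⟨hz.1, hz.2.trans (hτ.2.le.trans he.1.2)⟩, hz0⟩
  linarith [hz.2, hτ.2]

lemma pos_of_ne {f : ℝ → ℝ} {a b q : ℝ} (hf : ContinuousOn f (Icc a b)) (hq : q ∈ Icc a b) (hpos : 0 < f q)
    (hne : ∀ x ∈ Icc a b, f x ≠ 0) : ∀ x ∈ Icc a b, 0 < f x := by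
  intro x hx
  by_contra hneg
  push Not at hneg
  have hneg' : f x < 0 := lt_of_le_of_ne hneg (hne x hx)
  rcases lt_trichotomy x q with h | h | h
  · obtain ⟨z, hz, hz0⟩ := ivt_sign h (hf.mono (Icc_subset_Icc hx.1 hq.2)) (mul_neg_of_neg_of_pos hneg' hpos)
    exact hne z ⟨hx.1.trans hz.1.le, hz.2.le.trans hq.2⟩ hz0
  · rw [h] at hneg'; linarith
  · obtain ⟨z, hz, hz0⟩ := ivt_sign h (hf.mono (Icc_subset_Icc hq.1 hx.2)) (mul_neg_of_pos_of_neg hpos hneg')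
    exact hne z ⟨hq.1.trans hz.1.le, hz.2.le.trans hx.2⟩ hz0

lemma keep_left {M T l r u} (h : Pre M T l r u) {t s q : ℝ} (ht : 0 < t) (hts : t ≤ s) (hs : s < T)
    (hlq : ∀ τ ∈ Icc t s, l τ < q) (hqr : ∀ τ ∈ Icc t s, q ≤ r τ) (huq : ∀ τ ∈ Icc t s, 0 < u q τ)
    (hb : ∀ x ∈ Icc (l t) q, 0 ≤ u x t) (h0 : 0 < u (l t) t) : ∀ τ ∈ Icc t s, 0 < u (l τ) τ := by
  intro τ hτ
  by_contra hneg
  push Not at hneg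
  have hsub : ∀ {e}, e ≤ s → ∀ σ ∈ Icc t e, σ ∈ Icc t s := fun he σ hσ => ⟨hσ.1, hσ.2.trans he⟩
  have hloc : ∀ e, e ≤ s → LocSol M l (fun _ => q) t e u := fun e he =>
    h.restr ht.le (he.trans hs.le) (h.lc ht.le (he.trans hs.le)) continuousOn_const (fun _ _ => le_rfl)
      (fun σ hσ => (hlq σ (hsub he σ hσ)).le) (fun σ hσ => hqr σ (hsub he σ hσ))
  have hlc := hloc τ hτ.2
  obtain ⟨e, he, he0, hep⟩ := first_zero hτ.1
    (hlc.time hlc.lc fun σ hσ => ⟨le_rfl, hlc.lr σ hσ⟩) h0 hneg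
  have hes : e ≤ s := he.2.trans hτ.2
  have hle := hloc e hes
  have hnn := MP_nonneg hle hb (fun σ hσ => by
    rcases hσ.2.eq_or_lt with rfl | hlt
    · exact he0.ge
    · exact (hep σ ⟨hσ.1, hlt⟩).le) (fun σ hσ => (huq σ (hsub hes σ hσ)).le)
  have heT : e ∈ Ioo 0 T := ⟨ht.trans he.1, hes.trans_lt hs⟩
  obtain ⟨⟨L, hL⟩, hle0⟩ := h.h1 e heT he0 ⟨e - t, by linarith [he.1], fun σ hσ => hep σ ⟨by linarith [hσ.1], hσ.2⟩⟩
  have := Hopf_left he.1 hle (hlq e ⟨he.1.le, hes⟩) hnn (fun σ hσ => huq σ (hsub hes σ hσ)) he0 hL (h.dl e heT)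
  linarith

lemma keep_right {M T l r u} (h : Pre M T l r u) {t s q : ℝ} (ht : 0 < t) (hts : t ≤ s) (hs : s < T)
    (hqr : ∀ τ ∈ Icc t s, q < r τ) (hlq : ∀ τ ∈ Icc t s, l τ ≤ q) (huq : ∀ τ ∈ Icc t s, 0 < u q τ)
    (hb : ∀ x ∈ Icc q (r t), 0 ≤ u x t) (h0 : 0 < u (r t) t) : ∀ τ ∈ Icc t s, 0 < u (r τ) τ := by
  intro τ hτ
  have := keep_left h.refl (q := -q) ht hts hs (fun τ hτ => by linarith [hqr τ hτ]) (fun τ hτ => by linarith [hlq τ hτ])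
    (fun τ hτ => by simpa using huq τ hτ) (fun x hx => hb (-x) ⟨by linarith [hx.2], by linarith [hx.1]⟩)
    (by simpa using h0) τ hτ
  simpa using this

lemma pp_pos {M u q1 q2 t s} (hts : t < s) (h : LocSol M (fun _ => q1) (fun _ => q2) t s u)
    (h1 : ∀ τ ∈ Icc t s, 0 < u q1 τ) (h2 : ∀ τ ∈ Icc t s, 0 < u q2 τ) (hb : ∀ x ∈ Icc q1 q2, 0 ≤ u x t) :
    ∀ x ∈ Icc q1 q2, 0 < u x s := by
  intro x hx
  have hnn := MP_nonneg h hb (fun τ hτ => (h1 τ hτ).le) (fun τ hτ => (h2 τ hτ).le)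
  rcases hx.1.eq_or_lt with rfl | hlt
  · exact h1 s ⟨hts.le, le_rfl⟩
  · exact SM_right hts h hnn h2 x ⟨hlt, hx.2⟩

lemma Pre.ev_ct {M T l r u} (h : Pre M T l r u) {s q : ℝ} (hs : s ∈ Ioo 0 T) (hq : q ∈ Ioo (l s) (r s)) (hu : 0 < u q s) :
    ∀ᶠ τ in 𝓝 s, τ ∈ Ioo 0 T ∧ l τ < q ∧ q < r τ ∧ 0 < u q τ := by
  have hn : Icc 0 T ∈ 𝓝 s := Icc_mem_nhds hs.1 hs.2
  have e1 : ∀ᶠ τ in 𝓝 s, l τ < q := (h.loc.lc.continuousAt hn).eventually (gt_mem_nhds hq.1)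
  have e2 : ∀ᶠ τ in 𝓝 s, q < r τ := (h.loc.rc.continuousAt hn).eventually (lt_mem_nhds hq.2)
  have e3 : ∀ᶠ τ in 𝓝 s, τ ∈ Ioo 0 T := Ioo_mem_nhds hs.1 hs.2
  have hsI : s ∈ Icc 0 T := ⟨hs.1.le, hs.2.le⟩
  have e4 : ContinuousAt (fun τ => u q τ) s := (h.loc.good s ⟨hs.1, hs.2.le⟩ q hq).2.2.1.continuousAt
  filter_upwards [e1, e2, e3, e4.eventually (lt_mem_nhds hu)] with τ a b c d using ⟨c, a, b, d⟩

def NV (l r : ℝ → ℝ) (u : ℝ → ℝ → ℝ) (s : ℝ) : Prop :=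
  ∀ a b, l s ≤ a → a < b → b ≤ r s → ∃ q ∈ Ioo a b, u q s ≠ 0

lemma NV.neg {l r u s} (h : NV l r u s) : NV l r (fun x t => -u x t) s := by
  intro a b h1 h2 h3
  obtain ⟨q, hq, h0⟩ := h a b h1 h2 h3
  exact ⟨q, hq, by simpa using h0⟩

lemma NV.refl {l r u s} (h : NV l r u s) : NV (fun t => -r t) (fun t => -l t) (fun x t => u (-x) t) s := by
  intro a b h1 h2 h3
  obtain ⟨q, hq, h0⟩ := h (-b) (-a) (by linarith) (by linarith) (by linarith)
  exact ⟨-q, ⟨by linarith [hq.2], by linarith [hq.1]⟩, by simpa using h0⟩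

lemma Pre.slice {M T l r u} (h : Pre M T l r u) {t a b : ℝ} (ht : t ∈ Ioo 0 T) (ha : l t ≤ a) (hb : b ≤ r t) :
    ContinuousOn (fun x => u x t) (Icc a b) :=
  (h.loc.slice ⟨ht.1.le, ht.2.le⟩).mono (Icc_subset_Icc ha hb)

lemma Pre.constloc {M T l r u} (h : Pre M T l r u) {t s q1 q2 : ℝ} (ht : 0 ≤ t) (hs : s ≤ T) (hq : q1 ≤ q2)
    (h1 : ∀ τ ∈ Icc t s, l τ ≤ q1) (h2 : ∀ τ ∈ Icc t s, q2 ≤ r τ) :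
    LocSol M (fun _ => q1) (fun _ => q2) t s u :=
  h.restr ht hs continuousOn_const continuousOn_const h1 (fun _ _ => hq) h2

lemma L2_int_pos {M T l r u} (h : Pre M T l r u) {s q1 q2 x0 : ℝ} (hs : s ∈ Ioo 0 T) (h1 : q1 < x0) (h2 : x0 < q2)
    (hl : l s < q1) (hr : q2 < r s) (hu1 : 0 < u q1 s) (hu2 : u q2 s ≠ 0) (h0 : u x0 s = 0) :
    ∀ᶠ t in 𝓝[<] s, ∃ z ∈ Icc (l t) (r t), z ∈ Ioo q1 q2 ∧ u z t = 0 := by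
  have e1 := (h.ev_ct hs ⟨hl, (h1.trans h2).trans hr⟩ hu1)
  rcases lt_or_gt_of_ne hu2 with hn | hp
  · have e2 := (h.neg.ev_ct hs (q := q2) ⟨hl.trans (h1.trans h2), hr⟩ (by simpa using hn))
    filter_upwards [nhdsWithin_le_nhds e1, nhdsWithin_le_nhds e2] with t g1 g2
    have hc := h.slice g1.1 g1.2.1.le g2.2.2.1.le
    obtain ⟨z, hz, hz0⟩ := ivt_sign (h1.trans h2) hc (mul_neg_of_pos_of_neg g1.2.2.2 (by simpa using g2.2.2.2))
    exact ⟨z, ⟨g1.2.1.le.trans hz.1.le, hz.2.le.trans g2.2.2.1.le⟩, hz, hz0⟩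
  · have e2 := (h.ev_ct hs (q := q2) ⟨hl.trans (h1.trans h2), hr⟩ hp)
    filter_upwards [ev_lt hs.1 (nhdsWithin_le_nhds (e1.and e2))] with t ⟨ht, hg⟩
    have gt := hg t ⟨le_rfl, ht.2.le⟩
    by_contra hcon
    push Not at hcon
    have hc := h.slice gt.1.1 gt.1.2.1.le gt.2.2.2.1.le
    have hne : ∀ x ∈ Icc q1 q2, u x t ≠ 0 := by
      intro x hx
      rcases hx.1.eq_or_lt with rfl | ha
      · exact gt.1.2.2.2.ne'
      rcases hx.2.eq_or_lt with rfl | hb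
      · exact gt.2.2.2.2.ne'
      exact hcon x ⟨gt.1.2.1.le.trans hx.1, hx.2.trans gt.2.2.2.1.le⟩ ⟨ha, hb⟩
    have hp := pos_of_ne hc ⟨le_rfl, (h1.trans h2).le⟩ gt.1.2.2.2 hne
    have := pp_pos ht.2 (h.constloc ht.1.le hs.2.le (h1.trans h2).le (fun τ hτ => (hg τ hτ).1.2.1.le)
      (fun τ hτ => (hg τ hτ).2.2.2.1.le)) (fun τ hτ => (hg τ hτ).1.2.2.2) (fun τ hτ => (hg τ hτ).2.2.2.2)
      (fun x hx => (hp x hx).le) x0 ⟨h1.le, h2.le⟩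
    linarith

lemma L2_int {M T l r u} (h : Pre M T l r u) {s q1 q2 x0 : ℝ} (hs : s ∈ Ioo 0 T) (h1 : q1 < x0) (h2 : x0 < q2)
    (hl : l s < q1) (hr : q2 < r s) (hu1 : u q1 s ≠ 0) (hu2 : u q2 s ≠ 0) (h0 : u x0 s = 0) :
    ∀ᶠ t in 𝓝[<] s, ∃ z ∈ Icc (l t) (r t), z ∈ Ioo q1 q2 ∧ u z t = 0 := by
  rcases lt_or_gt_of_ne hu1 with hn | hp
  · have := L2_int_pos h.neg hs h1 h2 hl hr (by simpa using hn) (by simpa using hu2) (by simpa using h0)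
    simpa using this
  · exact L2_int_pos h hs h1 h2 hl hr hp hu2 h0

lemma L2_left_pos {M T l r u} (h : Pre M T l r u) {s q : ℝ} (hs : s ∈ Ioo 0 T)
    (hl : l s < q) (hr : q < r s) (hu1 : 0 < u q s) (h0 : u (l s) s = 0) :
    ∀ᶠ t in 𝓝[<] s, ∃ z ∈ Icc (l t) (r t), z ∈ Ico (l t) q ∧ u z t = 0 := by
  have e1 := (h.ev_ct hs ⟨hl, hr⟩ hu1)
  filter_upwards [ev_lt hs.1 (nhdsWithin_le_nhds e1)] with t ⟨ht, hg⟩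
  have gt := hg t ⟨le_rfl, ht.2.le⟩
  by_contra hcon
  push Not at hcon
  have hc := h.slice gt.1 le_rfl gt.2.2.1.le
  have hne : ∀ x ∈ Icc (l t) q, u x t ≠ 0 := by
    intro x hx
    rcases hx.2.eq_or_lt with rfl | hb
    · exact gt.2.2.2.ne'
    exact hcon x ⟨hx.1, hx.2.trans gt.2.2.1.le⟩ ⟨hx.1, hb⟩
  have hp := pos_of_ne hc ⟨gt.2.1.le, le_rfl⟩ gt.2.2.2 hne
  have := keep_left h ht.1 ht.2.le hs.2 (fun τ hτ => (hg τ hτ).2.1) (fun τ hτ => (hg τ hτ).2.2.1.le)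
    (fun τ hτ => (hg τ hτ).2.2.2) (fun x hx => (hp x hx).le) (hp _ ⟨le_rfl, gt.2.1.le⟩) s ⟨ht.2.le, le_rfl⟩
  linarith

lemma L2_left {M T l r u} (h : Pre M T l r u) {s q : ℝ} (hs : s ∈ Ioo 0 T)
    (hl : l s < q) (hr : q < r s) (hu1 : u q s ≠ 0) (h0 : u (l s) s = 0) :
    ∀ᶠ t in 𝓝[<] s, ∃ z ∈ Icc (l t) (r t), z ∈ Ico (l t) q ∧ u z t = 0 := by
  rcases lt_or_gt_of_ne hu1 with hn | hp
  · have := L2_left_pos h.neg hs hl hr (by simpa using hn) (by simpa using h0)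
    simpa using this
  · exact L2_left_pos h hs hl hr hp h0

lemma Pre.ev_l {M T l r u} (h : Pre M T l r u) {s : ℝ} (hs : s ∈ Ioo 0 T) {ρ : ℝ} (hρ : 0 < ρ) :
    ∀ᶠ t in 𝓝 s, |l t - l s| < ρ := by
  have := (h.loc.lc.continuousAt (Icc_mem_nhds hs.1 hs.2)).eventually (Metric.ball_mem_nhds _ hρ)
  simpa [Real.dist_eq] using this

lemma L2_l {M T l r u} (h : Pre M T l r u) {s : ℝ} (hs : s ∈ Ioo 0 T) (hnv : NV l r u s) {ρ : ℝ} (hρ : 0 < ρ)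
    (h0 : u (l s) s = 0) : ∀ᶠ t in 𝓝[<] s, ∃ z ∈ Icc (l t) (r t), |z - l s| < ρ ∧ u z t = 0 := by
  have hlr := h.lr s ⟨hs.1.le, hs.2.le⟩
  obtain ⟨q, hq, hq0⟩ := hnv (l s) (min (r s) (l s + ρ)) le_rfl (lt_min hlr (by linarith)) (min_le_left _ _)
  have hq1 := lt_of_lt_of_le hq.2 (min_le_left _ _)
  have hq2 := lt_of_lt_of_le hq.2 (min_le_right _ _)
  filter_upwards [L2_left h hs hq.1 hq1 hq0 h0, nhdsWithin_le_nhds (h.ev_l hs hρ)] with t ⟨z, hz, hzq, hz0⟩ hl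
  refine ⟨z, hz, ?_, hz0⟩
  rw [abs_lt] at hl ⊢
  constructor <;> linarith [hzq.1, hzq.2]

lemma L2 {M T l r u} (h : Pre M T l r u) {s : ℝ} (hs : s ∈ Ioo 0 T) (hnv : NV l r u s) {ρ : ℝ} (hρ : 0 < ρ)
    {x0 : ℝ} (hx : x0 ∈ zeroSet u l r s) :
    ∀ᶠ t in 𝓝[<] s, ∃ z ∈ zeroSet u l r t, |z - x0| < ρ := by
  obtain ⟨hx, h0⟩ := hx
  rcases hx.1.eq_or_lt with rfl | h1
  · filter_upwards [L2_l h hs hnv hρ h0] with t ⟨z, a, b, c⟩ using ⟨z, ⟨a, c⟩, b⟩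
  rcases hx.2.eq_or_lt with rfl | h2
  · filter_upwards [L2_l h.refl hs hnv.refl hρ (by simpa using h0)] with t ⟨z, a, b, c⟩
    refine ⟨-z, ⟨⟨by linarith [a.2], by linarith [a.1]⟩, c⟩, ?_⟩
    rw [abs_lt] at b ⊢
    constructor <;> linarith [b.1, b.2]
  obtain ⟨q1, hq1, hu1⟩ := hnv (max (l s) (x0 - ρ)) x0 (le_max_left _ _) (max_lt h1 (by linarith)) hx.2
  obtain ⟨q2, hq2, hu2⟩ := hnv x0 (min (r s) (x0 + ρ)) hx.1 (lt_min h2 (by linarith)) (min_le_left _ _)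
  have a1 := lt_of_le_of_lt (le_max_left _ _) hq1.1
  have a2 := lt_of_le_of_lt (le_max_right _ _) hq1.1
  have b1 := lt_of_lt_of_le hq2.2 (min_le_left _ _)
  have b2 := lt_of_lt_of_le hq2.2 (min_le_right _ _)
  filter_upwards [L2_int h hs hq1.2 hq2.1 a1 b1 hu1 hu2 h0] with t ⟨z, a, b, c⟩
  refine ⟨z, ⟨a, c⟩, ?_⟩
  rw [abs_lt]
  constructor <;> linarith [b.1, b.2]

/-- separation of a finite set -/
lemma fin_sep (F : Finset ℝ) : ∃ ρ > 0, ∀ x ∈ F, ∀ y ∈ F, x ≠ y → 2 * ρ ≤ |x - y| := by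
  have : ∀ᶠ ρ : ℝ in 𝓝[>] 0, ∀ x ∈ F, ∀ y ∈ F, x ≠ y → 2 * ρ ≤ |x - y| := by
    rw [Filter.eventually_all_finset]
    intro x _
    rw [Filter.eventually_all_finset]
    intro y _
    by_cases hxy : x = y
    · simp [hxy]
    · have hp : 0 < |x - y| / 2 := by have := abs_pos.mpr (sub_ne_zero.mpr hxy); linarith
      filter_upwards [Ioo_mem_nhdsGT hp] with ρ hρ _
      linarith [hρ.2]
  obtain ⟨ρ, h1, h2⟩ := (this.and self_mem_nhdsWithin).exists
  exact ⟨ρ, h2, h1⟩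

lemma fin_near {F : Finset ℝ} {S : Set ℝ} {ρ : ℝ} (hsep : ∀ x ∈ F, ∀ y ∈ F, x ≠ y → 2 * ρ ≤ |x - y|)
    (hz : ∀ x ∈ F, ∃ z ∈ S, |z - x| < ρ) : (F.card : ℕ∞) ≤ S.encard := by
  choose! f hf hd using hz
  rw [← Set.encard_coe_eq_coe_finsetCard]
  refine Set.encard_le_encard_of_injOn (f := f) (fun x hx => hf x hx) ?_
  intro x hx y hy hxy
  by_contra hne
  have h1 := hsep x hx y hy hne
  have h2 := hd x hx
  have h3 := hd y hy
  rw [hxy] at h2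
  have : |x - y| ≤ |f y - x| + |f y - y| := by
    rw [show x - y = (f y - y) - (f y - x) by ring]
    linarith [abs_sub (f y - y) (f y - x)]
  linarith

lemma L2fin {M T l r u} (h : Pre M T l r u) {s : ℝ} (hs : s ∈ Ioo 0 T) (hnv : NV l r u s) {ρ : ℝ} (hρ : 0 < ρ)
    (F : Finset ℝ) (hF : ∀ x ∈ F, x ∈ zeroSet u l r s) :
    ∀ᶠ t in 𝓝[<] s, ∀ x ∈ F, ∃ z ∈ zeroSet u l r t, |z - x| < ρ := by
  rw [Filter.eventually_all_finset]
  exact fun x hx => L2 h hs hnv hρ (hF x hx)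

lemma L2count {M T l r u} (h : Pre M T l r u) {s a0 : ℝ} (hs : s ∈ Ioo 0 T) (hnv : NV l r u s) {N : ℕ} (ha : a0 < s)
    (hZ : ∀ t ∈ Ico a0 s, (zeroSet u l r t).encard ≤ N) : (zeroSet u l r s).encard ≤ N := by
  by_contra hcon
  push Not at hcon
  obtain ⟨G, hG, hc⟩ := Set.exists_subset_encard_eq (k := ((N + 1 : ℕ) : ℕ∞)) (s := zeroSet u l r s)
    (by have := Order.add_one_le_of_lt hcon; exact_mod_cast this)
  have hfin : G.Finite := Set.finite_of_encard_eq_coe hc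
  lift G to Finset ℝ using hfin
  obtain ⟨ρ, hρ, hsep⟩ := fin_sep G
  obtain ⟨t, h1, h2⟩ := ((L2fin h hs hnv hρ G (fun x hx => hG hx)).and (Ico_mem_nhdsLT ha)).exists
  have h3 := fin_near hsep h1
  rw [Set.encard_coe_eq_coe_finsetCard] at hc
  rw [hc] at h3
  have := h3.trans (hZ t h2)
  have : N + 1 ≤ N := by exact_mod_cast this
  omega

def Pat (q p : ℝ) (f : ℝ → ℝ) : Prop :=
  ∀ x1 ∈ Icc q p, ∀ x2 ∈ Icc q p, x1 < x2 → f x1 < 0 → 0 < f x2 → False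

lemma perturb {M α β : ℝ} (hM : 1 ≤ M) (hαβ : α < β) : ∃ η > 0, ∀ (q : ℝ) (ρ : ℝ → ℝ) (t0 t : ℝ) (u : ℝ → ℝ → ℝ),
    LocSol M (fun _ => q) ρ t0 t u → (∀ τ ∈ Icc t0 t, q < ρ τ) → t0 ≤ t → t - t0 < η → q ≤ α →
    (∀ τ ∈ Icc t0 t, β ≤ ρ τ) → (∀ τ ∈ Icc t0 t, 0 ≤ u q τ) → (∀ τ ∈ Icc t0 t, u (ρ τ) τ ≤ 0) →
    (∀ x ∈ Icc α β, u x t = 0) → (∀ x ∈ Icc α β, u x t0 ≠ 0) → Pat q (ρ t0) (fun x => u x t0) → False := by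
  set δ := (β - α) / 8 with hδ
  have hδ0 : 0 < δ := by rw [hδ]; linarith
  have hβ : β = α + 8 * δ := by rw [hδ]; ring
  obtain ⟨B, hB, hA⟩ := bump_comb hδ0 2
  refine ⟨min (1 / (2 * M)) (1 / (6 * M * B + 1)), by positivity, ?_⟩
  intro q ρ t0 t u h hlr hts hη hqα hβρ hq hρ hz hnz hpat
  have ht1 : t - t0 < 1 / (2 * M) := hη.trans_le (min_le_left _ _)
  have ht2 : t - t0 < 1 / (6 * M * B + 1) := hη.trans_le (min_le_right _ _)
  rw [lt_div_iff₀ (by positivity)] at ht1 ht2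
  obtain ⟨A, A1, A2, d1, d2, b0, b1, b2, hc, hs⟩ := hA ![α + 2 * δ, α + 6 * δ] ![-1, 1]
    (by intro j; fin_cases j <;> simp) (by
      intro i j hij
      fin_cases i <;> fin_cases j <;> simp at hij ⊢
      · rw [abs_of_nonpos] <;> linarith
      · rw [abs_of_nonneg] <;> linarith)
  have hc1 : A (α + 2 * δ) = -1 := by simpa using hc 0
  have hc2 : A (α + 6 * δ) = 1 := by simpa using hc 1
  have hsupp : ∀ x, A x ≠ 0 → x ∈ Ioo α β ∧ |A x| ≤ 1 := by
    intro x hx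
    rcases hs x with h0 | ⟨j, hj, θ, h1, h2, h3⟩
    · exact absurd h0 hx
    rw [abs_lt] at hj
    rw [h3, abs_mul, abs_of_pos h1]
    fin_cases j <;> simp at hj ⊢
    · exact ⟨⟨by linarith [hj.1], by linarith [hj.2]⟩, h2⟩
    · exact ⟨⟨by linarith [hj.1], by linarith [hj.2]⟩, h2⟩
  -- lower bound of |u| at t0
  have ht0 : t0 ∈ Icc t0 t := ⟨le_rfl, hts⟩
  have htt : t ∈ Icc t0 t := ⟨hts, le_rfl⟩
  have hcont : ContinuousOn (fun x => |u x t0|) (Icc α β) :=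
    ((h.slice ht0).mono (Icc_subset_Icc hqα (hβρ t0 ht0))).abs
  obtain ⟨xm, hxm, hmin⟩ := isCompact_Icc.exists_isMinOn (nonempty_Icc.mpr hαβ.le) hcont
  set ε := |u xm t0| with hε
  have hε0 : 0 < ε := abs_pos.mpr (hnz xm hxm)
  have hmin' : ∀ x ∈ Icc α β, ε ≤ |u x t0| := fun x hx => hmin hx
  set lam := ε / 2 with hlam
  have hlam0 : 0 < lam := by rw [hlam]; linarith
  have hAl : A q = 0 := by
    by_contra hne
    have := (hsupp q hne).1.1
    linarith
  have hAr : ∀ τ ∈ Icc t0 t, A (ρ τ) = 0 := by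
    intro τ hτ
    by_contra hne
    have := (hsupp _ hne).1.2
    linarith [hβρ τ hτ]
  obtain ⟨Y, hY1, hY2, hY3⟩ := AT h hlr hts d1 d2 (K := 6 * M * B) b0 b1 b2 hlam0.le (by positivity)
    (by nlinarith [mul_nonneg (by positivity : 0 ≤ M * B) (sub_nonneg.mpr hts), mul_nonneg (by positivity : 0 ≤ 3 * M * B) (show 0 ≤ 1 - (t - t0) * (2 * M) by linarith)])
    (fun _ _ => hAl) hAr (pL := True) (pR := False) (by simp) (fun _ => hρ) (fun _ => hq) (by simp)
  have hI1 : α + 2 * δ ∈ Icc α β := ⟨by linarith, by linarith⟩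
  have hI2 : α + 6 * δ ∈ Icc α β := ⟨by linarith, by linarith⟩
  have hsub : Icc α β ⊆ Icc q (ρ t) := Icc_subset_Icc hqα (hβρ t htt)
  have hKt : 6 * M * B * (t - t0) < 1 := by nlinarith
  have g2 : 0 < u (α + 6 * δ) t + lam * (A (α + 6 * δ) - 6 * M * B * (t - t0)) := by
    rw [hz _ hI2, hc2, zero_add]; exact mul_pos hlam0 (by linarith)
  have g1 : u (α + 2 * δ) t + lam * (A (α + 2 * δ) + 6 * M * B * (t - t0)) < 0 := by
    rw [hz _ hI1, hc1, zero_add]; exact mul_neg_of_pos_of_neg hlam0 (by linarith)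
  obtain ⟨m2, k2⟩ := hY1 _ (hsub hI2) g2
  obtain ⟨m1, k1⟩ := hY2 _ (hsub hI1) g1
  have ho := (hY3 _ (hsub hI2) _ (hsub hI1) g2 g1).2 (by linarith)
  have k2' : 0 < u (Y (α + 6 * δ)) t0 + lam * A (Y (α + 6 * δ)) := by
    rcases k2 with k | k | k
    · exact k
    · exfalso; have := m1.1; linarith [k.2]
    · exact k.1.elim
  have k1' : u (Y (α + 2 * δ)) t0 + lam * A (Y (α + 2 * δ)) < 0 := by
    rcases k1 with k | k | k
    · exact k
    · exact absurd trivial k.1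
    · exfalso; have := m2.2; linarith [k.2]
  have hbd : ∀ x, A x ≠ 0 → |lam * A x| < |u x t0| := by
    intro x hx
    have h1 := hsupp x hx
    rw [abs_mul, abs_of_pos hlam0]
    have := hmin' x (Ioo_subset_Icc_self h1.1)
    nlinarith [h1.2]
  refine hpat _ m1 _ m2 ho ?_ ?_
  · by_cases h0 : A (Y (α + 2 * δ)) = 0
    · simpa [h0] using k1'
    · have := hbd _ h0
      by_contra hneg
      push Not at hneg
      rw [abs_of_nonneg hneg, abs_lt] at this
      linarith [this.1]
  · by_cases h0 : A (Y (α + 6 * δ)) = 0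
    · simpa [h0] using k2'
    · have := hbd _ h0
      by_contra hneg
      push Not at hneg
      rw [abs_of_nonpos hneg, abs_lt] at this
      linarith [this.2]

structure Box (M q : ℝ) (ρ : ℝ → ℝ) (s t1 : ℝ) (u : ℝ → ℝ → ℝ) : Prop where
  loc : LocSol M (fun _ => q) ρ s t1 u
  lr : ∀ τ ∈ Icc s t1, q < ρ τ
  uq : ∀ τ ∈ Icc s t1, 0 < u q τ
  ur : ∀ τ ∈ Icc s t1, u (ρ τ) τ ≤ 0
  init : Pat q (ρ s) (fun x => u x s)

lemma Box.sub {M q ρ s t1 u} (h : Box M q ρ s t1 u) {a b : ℝ} (ha : s ≤ a) (hb : b ≤ t1) :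
    LocSol M (fun _ => q) ρ a b u :=
  h.loc.mono ha hb continuousOn_const (h.loc.rc.mono (Icc_subset_Icc ha hb)) (fun _ _ => le_rfl)
    (fun t ht => h.loc.lr t ⟨ha.trans ht.1, ht.2.trans hb⟩) (fun _ _ => le_rfl)

lemma Box.pat {M q ρ s t1 u} (h : Box M q ρ s t1 u) {t : ℝ} (ht : t ∈ Icc s t1) : Pat q (ρ t) (fun x => u x t) := by
  intro x1 hx1 x2 hx2 h12 hn hp
  have hsub : ∀ τ ∈ Icc s t, τ ∈ Icc s t1 := fun τ hτ => ⟨hτ.1, hτ.2.trans ht.2⟩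
  obtain ⟨Y, hY1, hY2, hY3⟩ := AT (h.sub le_rfl ht.2) (fun τ hτ => h.lr τ (hsub τ hτ)) ht.1 (A := fun _ => 0)
    (A1 := fun _ => 0) (A2 := fun _ => 0) (B := 0) (K := 0) (lam := 0) (fun y => hasDerivAt_const y 0)
    (fun y => hasDerivAt_const y 0) (by simp) (by simp) (by simp) le_rfl le_rfl (by simp) (by simp) (by simp)
    (pL := True) (pR := False) (by simp) (fun _ τ hτ => h.ur τ (hsub τ hτ)) (fun _ τ hτ => (h.uq τ (hsub τ hτ)).le)
    (by simp)
  simp only [zero_mul, add_zero] at hY1 hY2 hY3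
  obtain ⟨m2, k2⟩ := hY1 _ hx2 hp
  obtain ⟨m1, k1⟩ := hY2 _ hx1 hn
  have ho := (hY3 _ hx2 _ hx1 hp hn).2 h12
  have k2' : 0 < u (Y x2) s := by
    rcases k2 with k | k | k
    · exact k
    · exfalso; have := m1.1; linarith [k.2]
    · exact k.1.elim
  have k1' : u (Y x1) s < 0 := by
    rcases k1 with k | k | k
    · exact k
    · exact absurd trivial k.1
    · exfalso; have := m2.2; linarith [k.2]
  exact h.init _ m1 _ m2 ho k1' k2'

lemma Box.ev {M q ρ s t1 u} (h : Box M q ρ s t1 u) {t x : ℝ} (ht : t ∈ Ioc s t1) (hx : x ∈ Ioo q (ρ t)) {P : ℝ → Prop}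
    (hP : ∀ᶠ z in 𝓝 (u x t), P z) : ∃ t0 ∈ Ico s t, ∀ τ ∈ Icc t0 t, x < ρ τ ∧ P (u x τ) := by
  have ht' : t ∈ Icc s t1 := ⟨ht.1.le, ht.2⟩
  have e1 : ∀ᶠ τ in 𝓝[Icc s t] t, x < ρ τ :=
    ((h.loc.rc.mono (Icc_subset_Icc le_rfl ht.2)) t ⟨ht.1.le, le_rfl⟩).eventually (lt_mem_nhds hx.2)
  have e2 : ∀ᶠ τ in 𝓝[Icc s t] t, P (u x τ) :=
    nhdsWithin_le_nhds ((h.loc.good t ht x hx).2.2.1.continuousAt.eventually hP)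
  obtain ⟨t0, h0, h1⟩ := (ev_lt ht.1 (e1.and e2)).exists
  exact ⟨t0, ⟨h0.1.le, h0.2⟩, h1⟩

lemma Box.pos {M q ρ s t1 u} (h : Box M q ρ s t1 u) {t x : ℝ} (ht : t ∈ Ioc s t1) (hx : x ∈ Icc q (ρ t))
    (hu : 0 < u x t) : ∀ y ∈ Icc q x, 0 < u y t := by
  have ht' : t ∈ Icc s t1 := ⟨ht.1.le, ht.2⟩
  have h2 : x < ρ t := lt_of_le_of_ne hx.2 (by rintro rfl; linarith [h.ur t ht'])
  rcases hx.1.eq_or_lt with rfl | h1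
  · intro y hy
    rw [le_antisymm hy.2 hy.1]; exact hu
  obtain ⟨t0, ht0, hev⟩ := h.ev ht ⟨h1, h2⟩ (lt_mem_nhds hu)
  have hI : ∀ τ ∈ Icc t0 t, τ ∈ Icc s t1 := fun τ hτ => ⟨ht0.1.trans hτ.1, hτ.2.trans ht.2⟩
  refine pp_pos ht0.2 ((h.sub ht0.1 ht.2).mono le_rfl le_rfl continuousOn_const continuousOn_const (fun _ _ => le_rfl)
    (fun _ _ => h1.le) (fun τ hτ => (hev τ hτ).1.le)) (fun τ hτ => h.uq τ (hI τ hτ)) (fun τ hτ => (hev τ hτ).2) ?_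
  intro y hy
  have hl : t0 ∈ Icc t0 t := ⟨le_rfl, ht0.2.le⟩
  by_contra hneg
  push Not at hneg
  have hyx : y < x := lt_of_le_of_ne hy.2 (by rintro rfl; linarith [(hev t0 hl).2])
  exact h.pat (hI t0 hl) y ⟨hy.1, hy.2.trans (hev t0 hl).1.le⟩ x ⟨h1.le, (hev t0 hl).1.le⟩ hyx hneg (hev t0 hl).2

lemma Box.negl {M q ρ s t1 u} (h : Box M q ρ s t1 u) {t x : ℝ} (ht : t ∈ Ioc s t1) (hr : u (ρ t) t < 0)
    (hx : x ∈ Icc q (ρ t)) (hu : u x t < 0) : ∀ y ∈ Icc x (ρ t), u y t < 0 := by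
  have ht' : t ∈ Icc s t1 := ⟨ht.1.le, ht.2⟩
  intro y hy
  have h1 : q < x := lt_of_le_of_ne hx.1 (by rintro rfl; linarith [h.uq t ht'])
  rcases hy.2.eq_or_lt with rfl | hyr
  · exact hr
  -- x2 near the right end
  have hc : ContinuousWithinAt (fun x => u x t) (Icc q (ρ t)) (ρ t) := h.loc.slice ht' _ ⟨(h.lr t ht').le, le_rfl⟩
  have hev2 := (ev_lt (h.lr t ht') (hc.eventually (gt_mem_nhds hr))).and (Ioo_mem_nhdsLT hyr)
  obtain ⟨x2, ⟨hx2, hx2'⟩, hx2y⟩ := hev2.exists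
  have hu2 : u x2 t < 0 := hx2' x2 ⟨le_rfl, hx2.2.le⟩
  obtain ⟨a, ha, hea⟩ := h.ev ht ⟨h1, hy.1.trans_lt hyr⟩ (gt_mem_nhds hu)
  obtain ⟨b, hb, heb⟩ := h.ev ht hx2 (gt_mem_nhds hu2)
  set t0 := max a b with ht0d
  have ht0 : t0 ∈ Ico s t := ⟨ha.1.trans (le_max_left _ _), max_lt ha.2 hb.2⟩
  have hea' : ∀ τ ∈ Icc t0 t, x < ρ τ ∧ u x τ < 0 := fun τ hτ => hea τ ⟨(le_max_left _ _).trans hτ.1, hτ.2⟩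
  have heb' : ∀ τ ∈ Icc t0 t, x2 < ρ τ ∧ u x2 τ < 0 := fun τ hτ => heb τ ⟨(le_max_right _ _).trans hτ.1, hτ.2⟩
  have hI : ∀ τ ∈ Icc t0 t, τ ∈ Icc s t1 := fun τ hτ => ⟨ht0.1.trans hτ.1, hτ.2.trans ht.2⟩
  have hl : t0 ∈ Icc t0 t := ⟨le_rfl, ht0.2.le⟩
  have hxx2 : x < x2 := hy.1.trans_lt hx2y.1
  have := pp_pos ht0.2 ((h.sub ht0.1 ht.2).neg.mono le_rfl le_rfl continuousOn_const continuousOn_const (fun _ _ => h1.le)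
    (fun _ _ => hxx2.le) (fun τ hτ => (heb' τ hτ).1.le)) (fun τ hτ => by simpa using (hea' τ hτ).2)
    (fun τ hτ => by simpa using (heb' τ hτ).2) ?_ y ⟨hy.1, hx2y.1.le⟩
  · simpa using this
  intro z hz
  by_contra hneg
  push Not at hneg
  have hneg' : 0 < u z t0 := by linarith
  have hxz : x < z := lt_of_le_of_ne hz.1 (by rintro rfl; linarith [(hea' t0 hl).2])
  exact h.pat (hI t0 hl) x ⟨h1.le, (hea' t0 hl).1.le⟩ z ⟨h1.le.trans hz.1, hz.2.trans (heb' t0 hl).1.le⟩ hxz (hea' t0 hl).2 hneg'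

lemma Box.one {M q ρ s t1 u} (h : Box M q ρ s t1 u)
    (hG : ∀ t ∈ Ioc s t1, u (ρ t) t < 0 ∨ ∀ x ∈ Icc q (ρ t), 0 ≤ u x t) {t y1 y2 : ℝ} (ht : t ∈ Ioc s t1)
    (hy1 : q ≤ y1) (hy2 : y2 ≤ ρ t) (hz1 : u y1 t = 0) (hz2 : u y2 t = 0) (hlt : y1 < y2) : False := by
  have hNEG : ∀ t ∈ Ioc s t1, ∀ x ∈ Icc q (ρ t), u x t < 0 → ∀ y ∈ Icc x (ρ t), u y t < 0 := by
    intro t ht x hx hu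
    refine h.negl ht ?_ hx hu
    rcases hG t ht with h1 | h1
    · exact h1
    · linarith [h1 x hx]
  have ht' : t ∈ Icc s t1 := ⟨ht.1.le, ht.2⟩
  have hzero : ∀ x ∈ Icc y1 y2, u x t = 0 := by
    intro x hx
    rcases lt_trichotomy (u x t) 0 with hn | h0 | hp
    · have := hNEG t ht x ⟨hy1.trans hx.1, hx.2.trans hy2⟩ hn y2 ⟨hx.2, hy2⟩
      linarith
    · exact h0
    · have := h.pos ht ⟨hy1.trans hx.1, hx.2.trans hy2⟩ hp y1 ⟨hy1, hx.1⟩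
      linarith
  set d := (y2 - y1) / 4 with hd
  have hd0 : 0 < d := by rw [hd]; linarith
  have hy2d : y2 = y1 + 4 * d := by rw [hd]; ring
  obtain ⟨η1, hη1, hp1⟩ := perturb (M := M) (α := y1) (β := y1 + d) h.loc.hM (by linarith)
  obtain ⟨η2, hη2, hp2⟩ := perturb (M := M) (α := y1 + 2 * d) (β := y1 + 3 * d) h.loc.hM (by linarith)
  obtain ⟨e, he1, he2, he3⟩ := ev_left' (f := ρ) (q := y1 + 3 * d) ht.1 (h.loc.rc.mono (Icc_subset_Icc le_rfl ht.2)) (by linarith)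
  set a := max e (t - min η1 η2 / 2) with ha
  have hm : 0 < min η1 η2 := lt_min hη1 hη2
  have hat : a < t := max_lt he2 (by linarith)
  have hsa : s ≤ a := he1.trans (le_max_left _ _)
  have hρa : ∀ τ ∈ Icc a t, y1 + 3 * d < ρ τ := fun τ hτ => he3 τ ⟨(le_max_left _ _).trans hτ.1, hτ.2⟩
  have hIa : ∀ τ ∈ Icc a t, τ ∈ Icc s t1 := fun τ hτ => ⟨hsa.trans hτ.1, hτ.2.trans ht.2⟩
  have hη : ∀ t0, a ≤ t0 → t - t0 < η1 ∧ t - t0 < η2 := by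
    intro t0 h0
    have := (le_max_right e (t - min η1 η2 / 2)).trans h0
    constructor
    · linarith [min_le_left η1 η2]
    · linarith [min_le_right η1 η2]
  -- no time in (a,t) has strict sign
  have ha1 : ∀ t0 ∈ Ioo a t, ¬ (∀ x ∈ Icc q (y1 + d), 0 < u x t0) := by
    intro t0 h0 hpos
    have hI0 : ∀ τ ∈ Icc t0 t, τ ∈ Icc a t := fun τ hτ => ⟨h0.1.le.trans hτ.1, hτ.2⟩
    refine hp1 q ρ t0 t u (h.sub (hsa.trans h0.1.le) ht.2) (fun τ hτ => h.lr τ (hIa τ (hI0 τ hτ))) h0.2.le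
      (hη t0 h0.1.le).1 hy1 (fun τ hτ => by linarith [hρa τ (hI0 τ hτ)]) (fun τ hτ => (h.uq τ (hIa τ (hI0 τ hτ))).le)
      (fun τ hτ => h.ur τ (hIa τ (hI0 τ hτ))) (fun x hx => hzero x ⟨hx.1, by linarith [hx.2]⟩)
      (fun x hx => (hpos x ⟨hy1.trans hx.1, hx.2⟩).ne') (h.pat (hIa t0 ⟨h0.1.le, h0.2.le⟩))
  have ha2 : ∀ t0 ∈ Ioo a t, ¬ (∀ x ∈ Icc (y1 + 2 * d) (ρ t0), u x t0 < 0) := by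
    intro t0 h0 hpos
    have hI0 : ∀ τ ∈ Icc t0 t, τ ∈ Icc a t := fun τ hτ => ⟨h0.1.le.trans hτ.1, hτ.2⟩
    refine hp2 q ρ t0 t u (h.sub (hsa.trans h0.1.le) ht.2) (fun τ hτ => h.lr τ (hIa τ (hI0 τ hτ))) h0.2.le
      (hη t0 h0.1.le).2 (by linarith) (fun τ hτ => by linarith [hρa τ (hI0 τ hτ)]) (fun τ hτ => (h.uq τ (hIa τ (hI0 τ hτ))).le)
      (fun τ hτ => h.ur τ (hIa τ (hI0 τ hτ))) (fun x hx => hzero x ⟨by linarith [hx.1], by linarith [hx.2]⟩)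
      (fun x hx => (hpos x ⟨hx.1, by linarith [hx.2, hρa t0 ⟨h0.1.le, h0.2.le⟩]⟩).ne) (h.pat (hIa t0 ⟨h0.1.le, h0.2.le⟩))
  -- hence u ≥ 0 on [q, y1+2d] for times in (a,t]
  set b := (a + t) / 2 with hb
  have hab : a < b := by rw [hb]; linarith
  have hbt : b < t := by rw [hb]; linarith
  have hnn : ∀ τ ∈ Icc b t, ∀ x ∈ Icc q (y1 + 2 * d), 0 ≤ u x τ := by
    intro τ hτ x hx
    by_contra hneg
    push Not at hneg
    have hτa : τ ∈ Icc a t := ⟨hab.le.trans hτ.1, hτ.2⟩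
    have hτs : τ ∈ Ioc s t1 := ⟨by linarith [hτ.1], hτ.2.trans ht.2⟩
    have hN := hNEG τ hτs x ⟨hx.1, by linarith [hx.2, hρa τ hτa]⟩ hneg
    rcases hτ.2.eq_or_lt with rfl | hlt'
    · have := hN y2 ⟨by linarith [hx.2], hy2⟩
      linarith
    · exact ha2 τ ⟨by linarith [hτ.1], hlt'⟩ fun y hy => hN y ⟨hx.2.trans hy.1, hy.2⟩
  have := SM_left hbt ((h.sub (hsa.trans hab.le) ht.2).mono le_rfl le_rfl continuousOn_const (r' := fun _ => y1 + 2 * d) continuousOn_const (fun _ _ => le_rfl)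
    (fun _ _ => by linarith) (fun τ hτ => by linarith [hρa τ ⟨hab.le.trans hτ.1, hτ.2⟩])) hnn
    (fun τ hτ => h.uq τ (hIa τ ⟨hab.le.trans hτ.1, hτ.2⟩)) (y1 + d) ⟨by linarith, by linarith⟩
  linarith [hzero (y1 + d) ⟨by linarith, by linarith⟩]

structure Prob (M T : ℝ) (l r : ℝ → ℝ) (u : ℝ → ℝ → ℝ) : Prop where
  pre : Pre M T l r u
  h3l : ∀ s ∈ Ioo 0 T, u (l s) s = 0 → ∃ ε > 0, ∃ δ > 0, ∀ t ∈ Ioo s (s + ε), ∀ x, l s < x → x ≤ r s → x - l s < δ →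
    0 ≤ u (l t) t * u x s
  h3r : ∀ s ∈ Ioo 0 T, u (r s) s = 0 → ∃ ε > 0, ∃ δ > 0, ∀ t ∈ Ioo s (s + ε), ∀ x, x < r s → l s ≤ x → r s - x < δ →
    u (r t) t * u x s ≤ 0

lemma Prob.neg {M T l r u} (h : Prob M T l r u) : Prob M T l r (fun x t => -u x t) := by
  refine ⟨h.pre.neg, fun s hs h0 => ?_, fun s hs h0 => ?_⟩
  · simpa only [neg_mul_neg] using h.h3l s hs (by simpa using h0)
  · simpa only [neg_mul_neg] using h.h3r s hs (by simpa using h0)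

lemma sign_Ioc {f : ℝ → ℝ} {a b : ℝ} (hab : a < b) (hf : ContinuousOn f (Icc a b)) (hne : ∀ x ∈ Ioc a b, f x ≠ 0) :
    (∀ x ∈ Ioc a b, 0 < f x) ∨ (∀ x ∈ Ioc a b, f x < 0) := by
  have key : ∀ x ∈ Ioc a b, 0 < f x * f b := by
    intro x hx
    rcases hx.2.eq_or_lt with rfl | hlt
    · exact mul_self_pos.mpr (hne _ hx)
    by_contra hneg
    have h1 : f x * f b < 0 := lt_of_le_of_ne (not_lt.mp hneg) (mul_ne_zero (hne x hx) (hne b ⟨hab, le_rfl⟩))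
    obtain ⟨z, hz, h0⟩ := ivt_sign hlt (hf.mono (Icc_subset_Icc hx.1.le le_rfl)) h1
    exact hne z ⟨hx.1.trans hz.1, hz.2.le⟩ h0
  rcases lt_or_gt_of_ne (hne b ⟨hab, le_rfl⟩) with hn | hp
  · right; intro x hx; have := key x hx; nlinarith
  · left; intro x hx; exact pos_of_mul_pos_left (key x hx) hp.le

lemma sign_Ico {f : ℝ → ℝ} {a b : ℝ} (hab : a < b) (hf : ContinuousOn f (Icc a b)) (hne : ∀ x ∈ Ico a b, f x ≠ 0) :
    (∀ x ∈ Ico a b, 0 < f x) ∨ (∀ x ∈ Ico a b, f x < 0) := by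
  have := sign_Ioc (f := fun x => f (-x)) (a := -b) (b := -a) (by linarith)
    (hf.comp (f := fun x => -x) (by fun_prop) fun x hx => ⟨by linarith [hx.2], by linarith [hx.1]⟩)
    (fun x hx => hne _ ⟨by linarith [hx.2], by linarith [hx.1]⟩)
  rcases this with h | h
  · left; intro x hx; simpa using h (-x) ⟨by linarith [hx.2], by linarith [hx.1]⟩
  · right; intro x hx; simpa using h (-x) ⟨by linarith [hx.2], by linarith [hx.1]⟩

lemma R_pp {M T l r u} (h : Pre M T l r u) {s q1 q2 : ℝ} (hs : s ∈ Ioo 0 T) (h12 : q1 < q2)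
    (hl : l s < q1) (hr : q2 < r s) (hu1 : 0 < u q1 s) (hu2 : 0 < u q2 s) (hb : ∀ x ∈ Icc q1 q2, 0 ≤ u x s) :
    ∀ᶠ t in 𝓝[>] s, ∀ x ∈ Icc q1 q2, 0 < u x t := by
  have e1 := (h.ev_ct hs ⟨hl, h12.trans hr⟩ hu1)
  have e2 := (h.ev_ct hs (q := q2) ⟨hl.trans h12, hr⟩ hu2)
  filter_upwards [ev_gt hs.2 (nhdsWithin_le_nhds (e1.and e2))] with t ⟨ht, hg⟩
  exact pp_pos ht.1 (h.constloc hs.1.le ht.2.le h12.le (fun τ hτ => (hg τ hτ).1.2.1.le)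
      (fun τ hτ => (hg τ hτ).2.2.2.1.le)) (fun τ hτ => (hg τ hτ).1.2.2.2) (fun τ hτ => (hg τ hτ).2.2.2.2) hb

def OneZ (u : ℝ → ℝ → ℝ) (t a b : ℝ) : Prop :=
  ∀ y1 y2, a ≤ y1 → y1 < y2 → y2 ≤ b → u y1 t = 0 → u y2 t = 0 → False

lemma R_pn {M T l r u} (h : Pre M T l r u) {s q1 q2 : ℝ} (hs : s ∈ Ioo 0 T) (h12 : q1 < q2)
    (hl : l s < q1) (hr : q2 < r s) (hu1 : 0 < u q1 s) (hu2 : u q2 s < 0) (hb : Pat q1 q2 (fun x => u x s)) :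
    ∀ᶠ t in 𝓝[>] s, OneZ u t q1 q2 := by
  have e1 := (h.ev_ct hs ⟨hl, h12.trans hr⟩ hu1)
  have e2 := (h.neg.ev_ct hs (q := q2) ⟨hl.trans h12, hr⟩ (by simpa using hu2))
  filter_upwards [ev_gt hs.2 (nhdsWithin_le_nhds (e1.and e2))] with t ⟨ht, hg⟩
  have hneg : ∀ τ ∈ Icc s t, u q2 τ < 0 := fun τ hτ => by simpa using (hg τ hτ).2.2.2.2
  have hbox : Box M q1 (fun _ => q2) s t u :=
    ⟨h.constloc hs.1.le ht.2.le h12.le (fun τ hτ => (hg τ hτ).1.2.1.le) (fun τ hτ => (hg τ hτ).2.2.2.1.le),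
      fun _ _ => h12, fun τ hτ => (hg τ hτ).1.2.2.2, fun τ hτ => (hneg τ hτ).le, hb⟩
  intro y1 y2 a b c d e
  exact hbox.one (fun τ hτ => Or.inl (hneg τ ⟨hτ.1.le, hτ.2⟩)) ⟨ht.1, le_rfl⟩ a c d e b

lemma R_left {M T l r u} (h : Prob M T l r u) {s q : ℝ} (hs : s ∈ Ioo 0 T) (hl : l s < q) (hr : q < r s)
    (h0 : u (l s) s = 0) (hp : ∀ x ∈ Ioc (l s) q, 0 < u x s) :
    ∀ᶠ t in 𝓝[>] s, 0 ≤ u (l t) t ∧ ∀ x ∈ Ioc (l t) q, 0 < u x t := by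
  obtain ⟨ε, hε, δ, hδ, h3⟩ := h.h3l s hs h0
  have e1 := h.pre.ev_ct hs ⟨hl, hr⟩ (hp q ⟨hl, le_rfl⟩)
  have e2 : ∀ᶠ t in 𝓝[>] s, t < s + ε := nhdsWithin_le_nhds (gt_mem_nhds (by linarith))
  filter_upwards [ev_gt hs.2 (nhdsWithin_le_nhds e1), e2] with t ⟨ht, hg⟩ hte
  have hw : ∀ τ ∈ Icc s t, 0 ≤ u (l τ) τ := by
    intro τ hτ
    rcases hτ.1.eq_or_lt with rfl | hlt
    · exact h0.ge
    set x := l s + min (q - l s) (δ / 2) with hx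
    have hm : 0 < min (q - l s) (δ / 2) := lt_min (by linarith) (by linarith)
    have hx1 := min_le_left (q - l s) (δ / 2)
    have hx2 := min_le_right (q - l s) (δ / 2)
    have := h3 τ ⟨hlt, by linarith [hτ.2]⟩ x (by linarith) (by linarith) (by linarith)
    exact nonneg_of_mul_nonneg_left this (hp x ⟨by linarith, by linarith⟩)
  have hloc : LocSol M l (fun _ => q) s t u :=
    h.pre.restr hs.1.le ht.2.le (h.pre.lc hs.1.le ht.2.le) continuousOn_const (fun _ _ => le_rfl)
      (fun τ hτ => (hg τ hτ).2.1.le) (fun τ hτ => (hg τ hτ).2.2.1.le)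
  have hnn := MP_nonneg hloc (fun x hx => by
    rcases hx.1.eq_or_lt with rfl | hlt
    · exact h0.ge
    · exact (hp x ⟨hlt, hx.2⟩).le) hw (fun τ hτ => (hg τ hτ).2.2.2.le)
  refine ⟨hw t ⟨ht.1.le, le_rfl⟩, fun x hx => ?_⟩
  set p := (l t + x) / 2 with hpd
  have hp1 : l t < p := by rw [hpd]; linarith [hx.1]
  have hp2 : p < x := by rw [hpd]; linarith [hx.1]
  obtain ⟨e, he1, he2, he3⟩ := ev_left ht.1 hloc.lc hp1
  exact SM_right he2 (hloc.mono (l' := fun _ => p) (r' := fun _ => q) he1 le_rfl continuousOn_const continuousOn_const (fun τ hτ => (he3 τ hτ).le)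
    (fun _ _ => hp2.le.trans hx.2) (fun _ _ => le_rfl)) (fun τ hτ y hy => hnn τ ⟨he1.trans hτ.1, hτ.2⟩ y
      ⟨(he3 τ hτ).le.trans hy.1, hy.2⟩) (fun τ hτ => (hg τ ⟨he1.trans hτ.1, hτ.2⟩).2.2.2) x ⟨hp2, hx.2⟩

lemma G_claim {M T l r u} (h : Pre M T l r u) {s q t1 : ℝ} (hs : 0 < s) (ht1 : t1 < T) (hb : Box M q r s t1 u)
    (hlq : ∀ τ ∈ Icc s t1, l τ ≤ q) {t x : ℝ} (ht : t ∈ Ioc s t1) (h0 : u (r t) t = 0) (hx : x ∈ Icc q (r t))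
    (hu : u x t < 0) : ∃ t0 ∈ Ico s t, ∀ τ ∈ Icc t0 t, u (r τ) τ = 0 := by
  have ht' : t ∈ Icc s t1 := ⟨ht.1.le, ht.2⟩
  have h1 : q < x := lt_of_le_of_ne hx.1 (by rintro rfl; linarith [hb.uq t ht'])
  have h2 : x < r t := lt_of_le_of_ne hx.2 (by rintro rfl; linarith)
  obtain ⟨t0, ht0, hev⟩ := hb.ev ht ⟨h1, h2⟩ (gt_mem_nhds hu)
  have hI : ∀ τ ∈ Icc t0 t, τ ∈ Icc s t1 := fun τ hτ => ⟨ht0.1.trans hτ.1, hτ.2.trans ht.2⟩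
  refine ⟨t0, ht0, fun τ hτ => ?_⟩
  by_contra hne
  have hlt := lt_of_le_of_ne (hb.ur τ (hI τ hτ)) hne
  have hII : ∀ σ ∈ Icc τ t, σ ∈ Icc t0 t := fun σ hσ => ⟨hτ.1.trans hσ.1, hσ.2⟩
  have := keep_right h.neg (t := τ) (s := t) (q := x) (by linarith [ht0.1, hτ.1]) hτ.2 (ht.2.trans_lt ht1)
    (fun σ hσ => (hev σ (hII σ hσ)).1) (fun σ hσ => (hlq σ (hI σ (hII σ hσ))).trans h1.le)
    (fun σ hσ => by simpa using (hev σ (hII σ hσ)).2) (fun y hy => by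
      by_contra hneg
      push Not at hneg
      have hpos : 0 < u y τ := by linarith
      have hxy : x < y := lt_of_le_of_ne hy.1 (by rintro rfl; linarith [(hev τ hτ).2])
      exact hb.pat (hI τ hτ) x ⟨h1.le, (hev τ hτ).1.le⟩ y ⟨h1.le.trans hy.1, hy.2⟩ hxy (hev τ hτ).2 hpos)
    (by simpa using hlt) t ⟨hτ.2, le_rfl⟩
  linarith

lemma G_main {M T l r u} (h : Pre M T l r u) {s q t1 : ℝ} (hs : 0 < s) (ht1 : t1 < T) (hb : Box M q r s t1 u)
    (hlq : ∀ τ ∈ Icc s t1, l τ ≤ q) (hinit : ∀ x ∈ Icc q (r s), 0 ≤ u x s) {t : ℝ} (ht : t ∈ Ioc s t1) :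
    u (r t) t < 0 ∨ ∀ x ∈ Icc q (r t), 0 ≤ u x t := by
  have ht' : t ∈ Icc s t1 := ⟨ht.1.le, ht.2⟩
  rcases (hb.ur t ht').lt_or_eq with hlt | h0
  · exact Or.inl hlt
  right
  by_contra hcon
  push Not at hcon
  set S := {t' ∈ Icc s t | ∀ τ ∈ Icc t' t, u (r τ) τ = 0} with hS
  have hneg : ∀ t' ∈ S, ∃ x ∈ Icc q (r t'), u x t' < 0 := by
    intro t' ht'S
    by_contra hall
    push Not at hall
    obtain ⟨x, hx, hxn⟩ := hcon
    have := MP_nonneg (hb.sub ht'S.1.1 ht.2) hall (fun τ hτ => (hb.uq τ ⟨ht'S.1.1.trans hτ.1, hτ.2.trans ht.2⟩).le)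
      (fun τ hτ => (ht'S.2 τ hτ).ge) t ⟨ht'S.1.2, le_rfl⟩ x hx
    linarith
  have htS : t ∈ S := ⟨⟨ht.1.le, le_rfl⟩, fun τ hτ => by rw [le_antisymm hτ.2 hτ.1]; exact h0⟩
  have hbdd : BddBelow S := ⟨s, fun x hx => hx.1.1⟩
  set c := sInf S with hc
  have hcs : s ≤ c := le_csInf ⟨t, htS⟩ fun x hx => hx.1.1
  have hct : c ≤ t := csInf_le hbdd htS
  have hIoc : ∀ τ ∈ Ioc c t, u (r τ) τ = 0 := by
    intro τ hτ
    obtain ⟨t', ht'S, hlt⟩ := exists_lt_of_csInf_lt ⟨t, htS⟩ hτ.1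
    exact ht'S.2 τ ⟨hlt.le, hτ.2⟩
  have hcS : c ∈ S := by
    refine ⟨⟨hcs, hct⟩, ?_⟩
    rcases hct.eq_or_lt with heq | hlt
    · intro τ hτ; rw [heq] at hτ; rw [le_antisymm hτ.2 hτ.1]; exact h0
    have hcl : IsClosed {τ ∈ Icc s t1 | u (r τ) τ = 0} :=
      (hb.loc.time hb.loc.rc fun σ hσ => ⟨hb.loc.lr σ hσ, le_rfl⟩).preimage_isClosed_of_isClosed isClosed_Icc
        (isClosed_singleton (x := (0:ℝ)))
    have hsub : Ioc c t ⊆ {τ ∈ Icc s t1 | u (r τ) τ = 0} := fun τ hτ =>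
      ⟨⟨hcs.trans hτ.1.le, hτ.2.trans ht.2⟩, hIoc τ hτ⟩
    have := closure_minimal hsub hcl
    rw [closure_Ioc hlt.ne] at this
    exact fun τ hτ => (this hτ).2
  obtain ⟨x, hx, hxn⟩ := hneg c hcS
  rcases hcs.eq_or_lt with heq | hlt
  · rw [← heq] at hx hxn
    linarith [hinit x hx]
  obtain ⟨t0, ht0, hz⟩ := G_claim h hs ht1 hb hlq ⟨hlt, hct.trans ht.2⟩ (hcS.2 c ⟨le_rfl, hct⟩) hx hxn
  have : t0 ∈ S := ⟨⟨ht0.1, ht0.2.le.trans hct⟩, fun τ hτ => by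
    rcases le_total τ c with h1 | h1
    · exact hz τ ⟨hτ.1, h1⟩
    · exact hcS.2 τ ⟨h1, hτ.2⟩⟩
  linarith [csInf_le hbdd this, ht0.2]

lemma R_right {M T l r u} (h : Prob M T l r u) {s q : ℝ} (hs : s ∈ Ioo 0 T) (hl : l s < q) (hr : q < r s)
    (h0 : u (r s) s = 0) (hp : ∀ x ∈ Ico q (r s), 0 < u x s) :
    ∀ᶠ t in 𝓝[>] s, q < r t ∧ (u (r t) t < 0 ∨ (u (r t) t = 0 ∧ ∀ x ∈ Ico q (r t), 0 < u x t)) ∧ OneZ u t q (r t) := by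
  obtain ⟨ε, hε, δ, hδ, h3⟩ := h.h3r s hs h0
  have e1 := h.pre.ev_ct hs ⟨hl, hr⟩ (hp q ⟨le_rfl, hr⟩)
  have e2 : ∀ᶠ t in 𝓝[>] s, t < s + ε := nhdsWithin_le_nhds (gt_mem_nhds (by linarith))
  filter_upwards [ev_gt hs.2 (nhdsWithin_le_nhds e1), e2] with t ⟨ht, hg⟩ hte
  have hw : ∀ τ ∈ Icc s t, u (r τ) τ ≤ 0 := by
    intro τ hτ
    rcases hτ.1.eq_or_lt with rfl | hlt
    · exact h0.le
    set x := r s - min (r s - q) (δ / 2) with hx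
    have hm : 0 < min (r s - q) (δ / 2) := lt_min (by linarith) (by linarith)
    have hx1 := min_le_left (r s - q) (δ / 2)
    have hx2 := min_le_right (r s - q) (δ / 2)
    have := h3 τ ⟨hlt, by linarith [hτ.2]⟩ x (by linarith) (by linarith) (by linarith)
    exact nonpos_of_mul_nonpos_left this (hp x ⟨by linarith, by linarith⟩)
  have hnn : ∀ x ∈ Icc q (r s), 0 ≤ u x s := fun x hx => by
    rcases hx.2.eq_or_lt with rfl | hlt
    · exact h0.ge
    · exact (hp x ⟨hx.1, hlt⟩).le
  have hbox : Box M q r s t u :=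
    ⟨h.pre.restr hs.1.le ht.2.le continuousOn_const (h.pre.rc hs.1.le ht.2.le) (fun τ hτ => (hg τ hτ).2.1.le)
      (fun τ hτ => (hg τ hτ).2.2.1.le) (fun _ _ => le_rfl), fun τ hτ => (hg τ hτ).2.2.1, fun τ hτ => (hg τ hτ).2.2.2,
      hw, fun x1 hx1 _ _ _ hn _ => by linarith [hnn x1 hx1]⟩
  have hG : ∀ τ ∈ Ioc s t, u (r τ) τ < 0 ∨ ∀ x ∈ Icc q (r τ), 0 ≤ u x τ := fun τ hτ =>
    G_main h.pre hs.1 ht.2 hbox (fun σ hσ => (hg σ hσ).2.1.le) hnn hτ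
  have htI : t ∈ Ioc s t := ⟨ht.1, le_rfl⟩
  have hone : OneZ u t q (r t) := fun y1 y2 a b c d e => hbox.one hG htI a c d e b
  refine ⟨(hg t ⟨ht.1.le, le_rfl⟩).2.2.1, ?_, hone⟩
  rcases (hw t ⟨ht.1.le, le_rfl⟩).lt_or_eq with hlt | heq
  · exact Or.inl hlt
  right
  refine ⟨heq, fun x hx => ?_⟩
  have hge : 0 ≤ u x t := (hG t htI).resolve_left (by linarith) x ⟨hx.1, hx.2.le⟩
  rcases hge.lt_or_eq with h1 | h1
  · exact h1
  · exact (hone x (r t) hx.1 hx.2 le_rfl h1.symm heq).elim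

lemma near_zeros {M T l r u} (h : Pre M T l r u) {s ρ : ℝ} (hs : s ∈ Ioo 0 T) {F : Set ℝ}
    (hF : ∀ y ∈ zeroSet u l r s, ∃ x ∈ F, |y - x| < ρ) :
    ∀ᶠ t in 𝓝 s, ∀ y ∈ zeroSet u l r t, ∃ x ∈ F, |y - x| < ρ := by
  have hc1 : IsCompact (Reg l r 0 T) := h.loc.compact
  have hcl1 : IsClosed (Reg l r 0 T ∩ (fun p : ℝ × ℝ => u p.1 p.2) ⁻¹' {0}) :=
    h.loc.uc.preimage_isClosed_of_isClosed hc1.isClosed isClosed_singleton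
  have hcl2 : IsClosed {p : ℝ × ℝ | ∀ x ∈ F, ρ ≤ |p.1 - x|} := by
    have : {p : ℝ × ℝ | ∀ x ∈ F, ρ ≤ |p.1 - x|} = ⋂ x ∈ F, {p : ℝ × ℝ | ρ ≤ |p.1 - x|} := by
      ext p; simp
    rw [this]
    exact isClosed_biInter fun x _ => isClosed_le continuous_const (by fun_prop)
  set K := (Reg l r 0 T ∩ (fun p : ℝ × ℝ => u p.1 p.2) ⁻¹' {0}) ∩ {p : ℝ × ℝ | ∀ x ∈ F, ρ ≤ |p.1 - x|} with hK
  have hKc : IsCompact K := hc1.of_isClosed_subset (hcl1.inter hcl2) fun p hp => hp.1.1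
  have hKi : IsClosed (Prod.snd '' K) := (hKc.image continuous_snd).isClosed
  have hsn : s ∉ Prod.snd '' K := by
    rintro ⟨⟨x, t⟩, ⟨⟨h1, h2⟩, h3⟩, rfl⟩
    obtain ⟨z, hz, hd⟩ := hF x ⟨h1.2, h2⟩
    linarith [h3 z hz]
  filter_upwards [hKi.isOpen_compl.mem_nhds hsn, Ioo_mem_nhds hs.1 hs.2] with t ht htT y hy
  by_contra hcon
  push Not at hcon
  exact ht ⟨(y, t), ⟨⟨⟨⟨htT.1.le, htT.2.le⟩, hy.1⟩, hy.2⟩, hcon⟩, rfl⟩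

def Loc1 (u : ℝ → ℝ → ℝ) (l r : ℝ → ℝ) (s x0 ρ : ℝ) : Prop :=
  ∀ᶠ t in 𝓝[>] s, ∀ y1 ∈ zeroSet u l r t, ∀ y2 ∈ zeroSet u l r t, |y1 - x0| < ρ → |y2 - x0| < ρ →
    y1 = y2 ∧ (x0 = l s → y1 = l t)

lemma zeroSet_neg {u : ℝ → ℝ → ℝ} {l r t} : zeroSet (fun x t => -u x t) l r t = zeroSet u l r t := by
  ext x; simp [zeroSet]

lemma Loc1.of_neg {u l r s x0 ρ} (h : Loc1 (fun x t => -u x t) l r s x0 ρ) : Loc1 u l r s x0 ρ := by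
  simpa only [Loc1, zeroSet_neg] using h

lemma loc1_left {M T l r u} (h : Prob M T l r u) {s q : ℝ} (hs : s ∈ Ioo 0 T) (hl : l s < q) (hr : q < r s)
    (h0 : u (l s) s = 0) (hp : ∀ x ∈ Ioc (l s) q, 0 < u x s) : Loc1 u l r s (l s) (q - l s) := by
  filter_upwards [R_left h hs hl hr h0 hp] with t ⟨_, ht⟩ y1 hy1 y2 hy2 d1 d2
  have key : ∀ y ∈ zeroSet u l r t, |y - l s| < q - l s → y = l t := by
    intro y hy hd
    by_contra hne
    have h1 := lt_of_le_of_ne hy.1.1 (Ne.symm hne)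
    rw [abs_lt] at hd
    have := ht y ⟨h1, by linarith [hd.2]⟩
    linarith [hy.2]
  exact ⟨(key y1 hy1 d1).trans (key y2 hy2 d2).symm, fun _ => key y1 hy1 d1⟩

lemma loc1_right {M T l r u} (h : Prob M T l r u) {s q : ℝ} (hs : s ∈ Ioo 0 T) (hl : l s < q) (hr : q < r s)
    (h0 : u (r s) s = 0) (hp : ∀ x ∈ Ico q (r s), 0 < u x s) : Loc1 u l r s (r s) (r s - q) := by
  filter_upwards [R_right h hs hl hr h0 hp] with t ⟨_, _, ht⟩ y1 hy1 y2 hy2 d1 d2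
  rw [abs_lt] at d1 d2
  refine ⟨?_, fun hh => by linarith⟩
  rcases lt_trichotomy y1 y2 with hlt | heq | hlt
  · exact (ht y1 y2 (by linarith) hlt hy2.1.2 hy1.2 hy2.2).elim
  · exact heq
  · exact (ht y2 y1 (by linarith) hlt hy1.1.2 hy2.2 hy1.2).elim

lemma loc1_int {M T l r u} (h : Prob M T l r u) {s x0 d : ℝ} (hs : s ∈ Ioo 0 T) (hd : 0 < d) (hl : l s < x0 - d)
    (hr : x0 + d < r s) (h0 : u x0 s = 0) (hp : ∀ x ∈ Ico (x0 - d) x0, 0 < u x s)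
    (hp2 : (∀ x ∈ Ioc x0 (x0 + d), 0 < u x s) ∨ (∀ x ∈ Ioc x0 (x0 + d), u x s < 0)) : Loc1 u l r s x0 d := by
  rcases hp2 with hp2 | hp2
  · filter_upwards [R_pp h.pre hs (q1 := x0 - d) (q2 := x0 + d) (by linarith) hl hr (hp _ ⟨le_rfl, by linarith⟩)
      (hp2 _ ⟨by linarith, le_rfl⟩) (fun x hx => by
        rcases lt_trichotomy x x0 with h1 | h1 | h1
        · exact (hp x ⟨hx.1, h1⟩).le
        · rw [h1, h0]
        · exact (hp2 x ⟨h1, hx.2⟩).le)] with t ht y1 hy1 y2 hy2 d1 d2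
    rw [abs_lt] at d1
    have := ht y1 ⟨by linarith, by linarith⟩
    linarith [hy1.2]
  · have hle : ∀ x ∈ Ico (x0 - d) (x0 + d), u x s < 0 → x0 < x := fun x hx hn => by
      by_contra hc
      rcases (not_lt.mp hc).eq_or_lt with h1 | h1
      · rw [h1] at hn; linarith
      · linarith [hp x ⟨hx.1, h1⟩]
    filter_upwards [R_pn h.pre hs (q1 := x0 - d) (q2 := x0 + d) (by linarith) hl hr (hp _ ⟨le_rfl, by linarith⟩)
      (hp2 _ ⟨by linarith, le_rfl⟩) (fun x1 hx1 x2 hx2 h12 hn hpos => by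
        have := hle x1 ⟨hx1.1, h12.trans_le hx2.2⟩ hn
        linarith [hp2 x2 ⟨this.trans h12, hx2.2⟩])] with t ht y1 hy1 y2 hy2 d1 d2
    rw [abs_lt] at d1 d2
    refine ⟨?_, fun hh => by linarith⟩
    rcases lt_trichotomy y1 y2 with hlt | heq | hlt
    · exact (ht y1 y2 (by linarith) hlt (by linarith) hy1.2 hy2.2).elim
    · exact heq
    · exact (ht y2 y1 (by linarith) hlt (by linarith) hy2.2 hy1.2).elim

lemma loc1 {M T l r u} (h : Prob M T l r u) {s x0 ε : ℝ} (hs : s ∈ Ioo 0 T) (hx : x0 ∈ zeroSet u l r s) (hε : 0 < ε)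
    (hiso : ∀ y ∈ zeroSet u l r s, |y - x0| < ε → y = x0) : ∃ ρ > 0, Loc1 u l r s x0 ρ := by
  obtain ⟨hxI, h0⟩ := hx
  have hlr := h.pre.lr s ⟨hs.1.le, hs.2.le⟩
  rcases hxI.1.eq_or_lt with rfl | h1
  · obtain ⟨q, hq1, hq2⟩ := exists_between (lt_min hlr (show l s < l s + ε by linarith))
    have hqr := hq2.trans_le (min_le_left _ _)
    have hqe := hq2.trans_le (min_le_right _ _)
    refine ⟨q - l s, by linarith, ?_⟩
    rcases sign_Ioc hq1 (h.pre.slice hs le_rfl hqr.le) (fun x hx hz => by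
      have := hiso x ⟨⟨hx.1.le, hx.2.trans hqr.le⟩, hz⟩ (by rw [abs_lt]; constructor <;> linarith [hx.1, hx.2])
      linarith [hx.1]) with hp | hn
    · exact loc1_left h hs hq1 hqr h0 hp
    · exact (loc1_left h.neg hs hq1 hqr (by simpa using h0) (by simpa using hn)).of_neg
  rcases hxI.2.eq_or_lt with rfl | h2
  · obtain ⟨q, hq1, hq2⟩ := exists_between (max_lt hlr (show r s - ε < r s by linarith))
    have hqr := (le_max_left _ _).trans_lt hq1
    have hqe := (le_max_right _ _).trans_lt hq1
    refine ⟨r s - q, by linarith, ?_⟩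
    rcases sign_Ico hq2 (h.pre.slice hs hqr.le le_rfl) (fun x hx hz => by
      have := hiso x ⟨⟨hqr.le.trans hx.1, hx.2.le⟩, hz⟩ (by rw [abs_lt]; constructor <;> linarith [hx.1, hx.2])
      linarith [hx.2]) with hp | hn
    · exact loc1_right h hs hqr hq2 h0 hp
    · exact (loc1_right h.neg hs hqr hq2 (by simpa using h0) (by simpa using hn)).of_neg
  obtain ⟨d, hd, hd'⟩ := exists_between (lt_min hε (lt_min (show 0 < x0 - l s by linarith) (show 0 < r s - x0 by linarith)))
  have hd1 := hd'.trans_le (min_le_left _ _)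
  have hd2 := hd'.trans_le ((min_le_right _ _).trans (min_le_left _ _))
  have hd3 := hd'.trans_le ((min_le_right _ _).trans (min_le_right _ _))
  refine ⟨d, hd, ?_⟩
  have hL := sign_Ico (f := fun x => u x s) (show x0 - d < x0 by linarith) (h.pre.slice hs (by linarith) hxI.2) (fun x hx hz => by
      have := hiso x ⟨⟨by linarith [hx.1], by linarith [hx.2]⟩, hz⟩ (by rw [abs_lt]; constructor <;> linarith [hx.1, hx.2])
      linarith [hx.2])
  have hR := sign_Ioc (f := fun x => u x s) (show x0 < x0 + d by linarith) (h.pre.slice hs hxI.1 (by linarith)) (fun x hx hz => by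
      have := hiso x ⟨⟨by linarith [hx.1], by linarith [hx.2]⟩, hz⟩ (by rw [abs_lt]; constructor <;> linarith [hx.1, hx.2])
      linarith [hx.1])
  rcases hL with hL | hL
  · exact loc1_int h hs hd (by linarith) (by linarith) h0 hL hR
  · refine (loc1_int h.neg hs hd (by linarith) (by linarith) (by simpa using h0) (by simpa using hL) ?_).of_neg
    rcases hR with hR | hR
    · right; simpa using hR
    · left; simpa using hR

lemma stepR {M T l r u} (h : Prob M T l r u) {s : ℝ} (hs : s ∈ Ioo 0 T) (hfin : (zeroSet u l r s).Finite) :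
    ∀ᶠ t in 𝓝[>] s, ∃ f : ℝ → ℝ, MapsTo f (zeroSet u l r t) (zeroSet u l r s) ∧ InjOn f (zeroSet u l r t) ∧
      ∀ z ∈ zeroSet u l r t, f z = l s → z = l t := by
  set F := hfin.toFinset with hF
  have hmem : ∀ x, x ∈ F ↔ x ∈ zeroSet u l r s := fun x => hfin.mem_toFinset
  obtain ⟨ρ0, hρ0, hsep⟩ := fin_sep F
  have hx : ∀ x ∈ F, ∃ ρ > 0, Loc1 u l r s x ρ := by
    intro x hx
    refine loc1 h hs ((hmem x).mp hx) hρ0 fun y hy hd => ?_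
    by_contra hne
    linarith [hsep y ((hmem y).mpr hy) x hx hne]
  have hall : ∀ᶠ ρ : ℝ in 𝓝[>] 0, ∀ x ∈ F, Loc1 u l r s x ρ := by
    rw [Filter.eventually_all_finset]
    intro x hxF
    obtain ⟨ρ, hρ, hL⟩ := hx x hxF
    filter_upwards [Ioo_mem_nhdsGT hρ] with ρ' hρ'
    filter_upwards [hL] with t ht y1 h1 y2 h2 d1 d2 using ht y1 h1 y2 h2 (d1.trans hρ'.2) (d2.trans hρ'.2)
  obtain ⟨ρ, hL, hρ⟩ := (hall.and self_mem_nhdsWithin).exists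
  have hρ' : 0 < ρ := hρ
  have hL' : ∀ᶠ t in 𝓝[>] s, ∀ x ∈ F, ∀ y1 ∈ zeroSet u l r t, ∀ y2 ∈ zeroSet u l r t, |y1 - x| < ρ → |y2 - x| < ρ →
    y1 = y2 ∧ (x = l s → y1 = l t) := by
    rw [Filter.eventually_all_finset]; exact hL
  have hnear := near_zeros h.pre hs (ρ := ρ) (F := zeroSet u l r s) fun y hy => ⟨y, hy, by simpa using hρ'⟩
  filter_upwards [hL', nhdsWithin_le_nhds hnear] with t h1 h2
  choose! f hf hd using h2
  refine ⟨f, hf, fun a ha b hb hab => ?_, fun z hz hzl => ?_⟩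
  · exact (h1 (f a) ((hmem _).mpr (hf a ha)) a ha b hb (hd a ha) (by rw [hab]; exact hd b hb)).1
  · exact (h1 (f z) ((hmem _).mpr (hf z hz)) z hz z hz (hd z hz) (hd z hz)).2 hzl

lemma surj_of_card {f : ℝ → ℝ} {A B : Set ℝ} {N : ℕ} (hA : A.encard = N) (hB : B.encard = N) (hm : MapsTo f A B)
    (hi : InjOn f A) : ∀ y ∈ B, ∃ x ∈ A, f x = y := by
  have hfin : B.Finite := Set.finite_of_encard_eq_coe hB
  have : f '' A = B := hfin.eq_of_subset_of_encard_le' hm.image_subset (by rw [hi.encard_image, hA, hB])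
  intro y hy
  rw [← this] at hy
  exact hy

lemma NV_of_fin {u l r s} (hfin : (zeroSet u l r s).Finite) : NV l r u s := by
  intro a b h1 h2 h3
  by_contra hcon
  push Not at hcon
  exact (Ioo_infinite h2) (hfin.subset fun x hx => ⟨⟨h1.trans hx.1.le, hx.2.le.trans h3⟩, hcon x hx⟩)

lemma LSl {M T l r u} (h : Prob M T l r u) {a0 s : ℝ} {N : ℕ} (ha : 0 < a0) (hs : s < T)
    (hZ : ∀ t ∈ Ico a0 s, (zeroSet u l r t).encard = N) :
    (∀ t ∈ Ico a0 s, 0 ≤ u (l t) t) ∨ (∀ t ∈ Ico a0 s, u (l t) t ≤ 0) := by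
  have hcont : ContinuousOn (fun t => u (l t) t) (Icc 0 T) :=
    h.pre.loc.time h.pre.loc.lc fun t ht => ⟨le_rfl, h.pre.loc.lr t ht⟩
  have hz : ∀ τ ∈ Ico a0 s, u (l τ) τ = 0 → ∀ᶠ t in 𝓝[>] τ, u (l t) t = 0 := by
    intro τ hτ h0
    have hτT : τ ∈ Ioo 0 T := ⟨ha.trans_le hτ.1, hτ.2.trans hs⟩
    filter_upwards [stepR h hτT (Set.finite_of_encard_eq_coe (hZ τ hτ)), Ioo_mem_nhdsGT hτ.2] with t ⟨f, h1, h2, h3⟩ ht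
    obtain ⟨z, hz, hzl⟩ := surj_of_card (hZ t ⟨hτ.1.trans ht.1.le, ht.2⟩) (hZ τ hτ) h1 h2 (l τ)
      ⟨⟨le_rfl, h.pre.loc.lr τ ⟨hτT.1.le, hτT.2.le⟩⟩, h0⟩
    have := h3 z hz hzl
    rw [← this]; exact hz.2
  have hz2 : ∀ τ ∈ Ico a0 s, u (l τ) τ = 0 → ∀ t ∈ Ico τ s, u (l t) t = 0 := by
    intro τ hτ h0 t ht
    have hsub : Icc τ t ⊆ Icc 0 T := Icc_subset_Icc (ha.le.trans hτ.1) (ht.2.le.trans hs.le)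
    have hcl : IsClosed ({σ | u (l σ) σ = 0} ∩ Icc τ t) := by
      rw [inter_comm]
      exact (hcont.mono hsub).preimage_isClosed_of_isClosed isClosed_Icc (isClosed_singleton (x := (0:ℝ)))
    exact hcl.Icc_subset_of_forall_mem_nhdsWithin h0 (fun x hx => hz x ⟨hτ.1.trans hx.2.1, hx.2.2.trans ht.2⟩ hx.1)
      ⟨ht.1, le_rfl⟩
  have key : ∀ t1 ∈ Ico a0 s, ∀ t2 ∈ Ico a0 s, t1 < t2 → u (l t1) t1 * u (l t2) t2 < 0 → False := by
    intro t1 h1 t2 h2 h12 hneg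
    obtain ⟨z, hzI, hz0⟩ := ivt_sign (f := fun t => u (l t) t) h12
      (hcont.mono (Icc_subset_Icc (ha.le.trans h1.1) (h2.2.le.trans hs.le))) hneg
    have := hz2 z ⟨h1.1.trans hzI.1.le, hzI.2.trans h2.2⟩ hz0 t2 ⟨hzI.2.le, h2.2⟩
    rw [this] at hneg
    simp at hneg
  by_contra hcon
  push Not at hcon
  obtain ⟨⟨t1, h1, n1⟩, ⟨t2, h2, n2⟩⟩ := hcon
  rcases lt_trichotomy t1 t2 with hlt | heq | hlt
  · exact key t1 h1 t2 h2 hlt (mul_neg_of_neg_of_pos n1 n2)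
  · rw [heq] at n1; linarith
  · exact key t2 h2 t1 h1 hlt (mul_neg_of_pos_of_neg n2 n1)

def YP (l r : ℝ → ℝ) (u : ℝ → ℝ → ℝ) (t : ℝ) : Prop :=
  u (r t) t < 0 ∨ (u (r t) t = 0 ∧ ∃ q ∈ Ioo (l t) (r t), ∀ x ∈ Ico q (r t), 0 < u x t)

lemma YP_left {M T l r u} (h : Pre M T l r u) {s q : ℝ} {N : ℕ} (hs : s ∈ Ioo 0 T) (hl : l s < q) (hr : q < r s)
    (h0 : u (r s) s = 0) (hp : ∀ x ∈ Ico q (r s), 0 < u x s) (hN : (zeroSet u l r s).encard = N) {a0 : ℝ} (ha : a0 < s)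
    (hZ : ∀ t ∈ Ico a0 s, (zeroSet u l r t).encard = N) : ∀ᶠ t in 𝓝[<] s, YP l r u t := by
  have hfin : (zeroSet u l r s).Finite := Set.finite_of_encard_eq_coe hN
  set F := hfin.toFinset with hF
  have hmem : ∀ x, x ∈ F ↔ x ∈ zeroSet u l r s := fun x => hfin.mem_toFinset
  obtain ⟨ρ0, hρ0, hsep⟩ := fin_sep F
  have hlt : ∀ x ∈ F, x ≠ r s → x < q := by
    intro x hx hne
    have hx' := (hmem x).mp hx
    by_contra hc
    have := hp x ⟨not_lt.mp hc, lt_of_le_of_ne hx'.1.2 hne⟩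
    linarith [hx'.2]
  have hev : ∀ᶠ ρ : ℝ in 𝓝[>] 0, ∀ x ∈ F, x ≠ r s → x + ρ < q := by
    rw [Filter.eventually_all_finset]
    intro x hx
    by_cases hne : x = r s
    · simp [hne]
    · filter_upwards [Ioo_mem_nhdsGT (show 0 < q - x by linarith [hlt x hx hne])] with ρ hρ _
      linarith [hρ.2]
  obtain ⟨ρ, hρ1, hρ2⟩ := (hev.and (Ioo_mem_nhdsGT hρ0)).exists
  have e1 := h.ev_ct hs ⟨hl, hr⟩ (hp q ⟨le_rfl, hr⟩)
  filter_upwards [L2fin h hs (NV_of_fin hfin) hρ2.1 F (fun x hx => (hmem x).mp hx), Ico_mem_nhdsLT ha,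
    ev_lt hs.1 (nhdsWithin_le_nhds e1)] with t hz ht ⟨ht0, hg⟩
  choose! g hg1 hg2 using hz
  have gt := hg t ⟨le_rfl, ht0.2.le⟩
  have hsurj := surj_of_card hN (hZ t ht) (f := g) (fun x hx => hg1 x ((hmem x).mpr hx)) (by
    intro x hx y hy hxy
    by_contra hne
    have h1 := hsep x ((hmem x).mpr hx) y ((hmem y).mpr hy) hne
    have h2 := hg2 x ((hmem x).mpr hx)
    have h3 := hg2 y ((hmem y).mpr hy)
    rw [hxy] at h2
    have : |x - y| ≤ |g y - x| + |g y - y| := by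
      rw [show x - y = (g y - y) - (g y - x) by ring]
      linarith [abs_sub (g y - y) (g y - x)]
    linarith [hρ2.2])
  have huniq : ∀ z ∈ Icc q (r t), u z t = 0 → z = g (r s) := by
    intro z hz hz0
    obtain ⟨x, hx, hxz⟩ := hsurj z ⟨⟨gt.2.1.le.trans hz.1, hz.2⟩, hz0⟩
    by_cases hne : x = r s
    · rw [← hxz, hne]
    · have h1 := hρ1 x ((hmem x).mpr hx) hne
      have h2 := (abs_lt.mp (hg2 x ((hmem x).mpr hx))).2
      rw [hxz] at h2
      linarith [hz.1]
  have hc := h.slice gt.1 gt.2.1.le (le_refl (r t))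
  rcases lt_trichotomy (u (r t) t) 0 with hn | h0' | hpos
  · exact Or.inl hn
  · right
    refine ⟨h0', q, ⟨gt.2.1, gt.2.2.1⟩, fun x hx => ?_⟩
    have hzr := huniq (r t) ⟨gt.2.2.1.le, le_rfl⟩ h0'
    exact pos_of_ne (hc.mono (Icc_subset_Icc le_rfl hx.2.le)) ⟨le_rfl, hx.1⟩ gt.2.2.2 (fun y hy hy0 => by
      have := huniq y ⟨hy.1, hy.2.trans hx.2.le⟩ hy0
      linarith [hy.2, hx.2]) x ⟨hx.1, le_rfl⟩
  · exfalso
    have := keep_right h ht0.1 ht0.2.le hs.2 (fun τ hτ => (hg τ hτ).2.2.1) (fun τ hτ => (hg τ hτ).2.1.le)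
      (fun τ hτ => (hg τ hτ).2.2.2) (fun x hx => by
        by_contra hneg
        push Not at hneg
        have hqx : q < x := lt_of_le_of_ne hx.1 (by rintro rfl; linarith [gt.2.2.2])
        have hxr : x < r t := lt_of_le_of_ne hx.2 (by rintro rfl; linarith)
        obtain ⟨z1, hz1, hz10⟩ := ivt_sign hqx (hc.mono (Icc_subset_Icc le_rfl hx.2)) (mul_neg_of_pos_of_neg gt.2.2.2 hneg)
        obtain ⟨z2, hz2, hz20⟩ := ivt_sign hxr (hc.mono (Icc_subset_Icc hx.1 le_rfl)) (mul_neg_of_neg_of_pos hneg hpos)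
        have a1 := huniq z1 ⟨hz1.1.le, hz1.2.le.trans hx.2⟩ hz10
        have a2 := huniq z2 ⟨hx.1.trans hz2.1.le, hz2.2.le⟩ hz20
        linarith [hz1.2, hz2.1]) hpos s ⟨ht0.2.le, le_rfl⟩
    linarith

lemma YP_stable {M T l r u} (h : Prob M T l r u) {a0 s : ℝ} {N : ℕ} (ha : 0 < a0) (hs : s < T)
    (hZ : ∀ t ∈ Ico a0 s, (zeroSet u l r t).encard = N) {τ : ℝ} (hτ : τ ∈ Ico a0 s) (hY : YP l r u τ) :
    ∀ᶠ t in 𝓝[Ico a0 s] τ, YP l r u t := by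
  have hτT : τ ∈ Ioo 0 T := ⟨ha.trans_le hτ.1, hτ.2.trans hs⟩
  have hcont : ContinuousOn (fun t => u (r t) t) (Icc 0 T) :=
    h.pre.loc.time h.pre.loc.rc fun t ht => ⟨h.pre.loc.lr t ht, le_rfl⟩
  rcases hY with hneg | ⟨h0, q, hq, hp⟩
  · have := (hcont.continuousAt (Icc_mem_nhds hτT.1 hτT.2)).eventually (gt_mem_nhds hneg)
    filter_upwards [nhdsWithin_le_nhds this] with t ht using Or.inl ht
  have hY : YP l r u τ := Or.inr ⟨h0, q, hq, hp⟩
  rw [eventually_nhdsWithin_iff, ← nhdsNE_sup_pure, ← nhdsLT_sup_nhdsGT, eventually_sup, eventually_sup]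
  refine ⟨⟨?_, ?_⟩, ?_⟩
  · rcases hτ.1.eq_or_lt with rfl | hlt
    · filter_upwards [self_mem_nhdsWithin] with t ht htI
      have ht' : t < a0 := ht
      linarith [htI.1]
    · filter_upwards [YP_left h.pre hτT hq.1 hq.2 h0 hp (hZ τ hτ) hlt (fun t ht => hZ t ⟨ht.1, ht.2.trans hτ.2⟩)] with t ht _ using ht
  · have e1 := h.pre.ev_ct hτT hq (hp q ⟨le_rfl, hq.2⟩)
    filter_upwards [R_right h hτT hq.1 hq.2 h0 hp, nhdsWithin_le_nhds e1] with t ⟨h1, h2, _⟩ h3 _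
    rcases h2 with h2 | h2
    · exact Or.inl h2
    · exact Or.inr ⟨h2.1, q, ⟨h3.2.1, h1⟩, h2.2⟩
  · simp only [eventually_pure]
    exact fun _ => hY

lemma YP_or {M T l r u} (h : Pre M T l r u) {s : ℝ} (hs : s ∈ Ioo 0 T) (hfin : (zeroSet u l r s).Finite) :
    YP l r u s ∨ YP l r (fun x t => -u x t) s := by
  rcases lt_trichotomy (u (r s) s) 0 with hn | h0 | hp
  · exact Or.inl (Or.inl hn)
  · have hlr := h.lr s ⟨hs.1.le, hs.2.le⟩
    have hev : ∀ᶠ q in 𝓝[<] r s, ∀ x ∈ hfin.toFinset, x < r s → x < q := by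
      rw [Filter.eventually_all_finset]
      intro x hx
      by_cases hne : x < r s
      · filter_upwards [Ioo_mem_nhdsLT hne] with q hq _ using hq.1
      · simp [hne]
    obtain ⟨q, h1, hq⟩ := (hev.and (Ioo_mem_nhdsLT hlr)).exists
    rcases sign_Ico hq.2 (h.slice hs hq.1.le le_rfl) (fun x hx hz => by
      have := h1 x (hfin.mem_toFinset.mpr ⟨⟨hq.1.le.trans hx.1, hx.2.le⟩, hz⟩) hx.2
      linarith [hx.1]) with hp | hn
    · exact Or.inl (Or.inr ⟨h0, q, hq, hp⟩)
    · exact Or.inr (Or.inr ⟨by simpa using h0, q, hq, by simpa using hn⟩)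
  · exact Or.inr (Or.inl (by simpa using hp))

lemma YP_not {l r u} {s : ℝ} (h1 : YP l r u s) (h2 : YP l r (fun x t => -u x t) s) : False := by
  rcases h1 with h1 | ⟨a, q, hq, b⟩ <;> rcases h2 with h2 | ⟨c, p, hp, d⟩
  · linarith
  · linarith
  · linarith
  · have := b (max q p) ⟨le_max_left _ _, max_lt hq.2 hp.2⟩
    have := d (max q p) ⟨le_max_right _ _, max_lt hq.2 hp.2⟩
    linarith

lemma LSr {M T l r u} (h : Prob M T l r u) {a0 s : ℝ} {N : ℕ} (ha : 0 < a0) (hs : s < T) (has : a0 < s)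
    (hZ : ∀ t ∈ Ico a0 s, (zeroSet u l r t).encard = N) :
    (∀ t ∈ Ico a0 s, 0 ≤ u (r t) t) ∨ (∀ t ∈ Ico a0 s, u (r t) t ≤ 0) := by
  have hZ' : ∀ t ∈ Ico a0 s, (zeroSet (fun x t => -u x t) l r t).encard = N := by simpa only [zeroSet_neg] using hZ
  have hor : ∀ t ∈ Ico a0 s, YP l r u t ∨ YP l r (fun x t => -u x t) t := fun t ht =>
    YP_or h.pre ⟨ha.trans_le ht.1, ht.2.trans hs⟩ (Set.finite_of_encard_eq_coe (hZ t ht))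
  have hP : ∀ x ∈ Ico a0 s, ∀ y ∈ Ico a0 s, YP l r u x → YP l r u y := by
    intro x hx y hy
    refine isPreconnected_Ico.induction₂' (fun x y => YP l r u x → YP l r u y) (fun z hz => ?_)
      (fun a b c _ _ _ h1 h2 h3 => h2 (h1 h3)) hx hy
    rcases hor z hz with hY | hY
    · filter_upwards [YP_stable h ha hs hZ hz hY] with t ht using ⟨fun _ => ht, fun _ => hY⟩
    · filter_upwards [YP_stable h.neg ha hs hZ' hz hY] with t ht
      exact ⟨fun h1 => (YP_not h1 hY).elim, fun h1 => (YP_not h1 ht).elim⟩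
  have ha0 : a0 ∈ Ico a0 s := ⟨le_rfl, has⟩
  rcases hor a0 ha0 with hY | hY
  · right
    intro t ht
    rcases hP a0 ha0 t ht hY with h1 | h1
    · exact h1.le
    · exact h1.1.le
  · left
    intro t ht
    rcases hor t ht with h1 | h1
    · exact (YP_not (hP t ht a0 ha0 h1) hY).elim
    · rcases h1 with h1 | h1
      · linarith
      · linarith [h1.1]

lemma ext_closed {w : ℝ → ℝ} {a s : ℝ} (has : a < s) (hw : ContinuousOn w (Icc a s)) (h : ∀ t ∈ Ico a s, 0 ≤ w t) :
    ∀ t ∈ Icc a s, 0 ≤ w t := by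
  have hcl : IsClosed (Icc a s ∩ w ⁻¹' Ici 0) := hw.preimage_isClosed_of_isClosed isClosed_Icc isClosed_Ici
  have hsub : Ico a s ⊆ Icc a s ∩ w ⁻¹' Ici 0 := fun t ht => ⟨Ico_subset_Icc_self ht, h t ht⟩
  have := closure_minimal hsub hcl
  rw [closure_Ico has.ne] at this
  exact fun t ht => (this ht).2

lemma ext_or {w : ℝ → ℝ} {a s : ℝ} (has : a < s) (hw : ContinuousOn w (Icc a s))
    (h : (∀ t ∈ Ico a s, 0 ≤ w t) ∨ (∀ t ∈ Ico a s, w t ≤ 0)) :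
    ∃ p : Prop, (¬ p → ∀ t ∈ Icc a s, w t ≤ 0) ∧ (p → ∀ t ∈ Icc a s, 0 ≤ w t) := by
  rcases h with h | h
  · exact ⟨True, by simp, fun _ => ext_closed has hw h⟩
  · refine ⟨False, fun _ t ht => ?_, by simp⟩
    have := ext_closed has hw.neg (fun t ht => by simpa using h t ht) t ht
    simpa using this

lemma stepL {M T l r u} (h : Prob M T l r u) {a0 s : ℝ} {N : ℕ} (ha : 0 < a0) (hs : s < T) (has : a0 < s)
    (hZ : ∀ t ∈ Ico a0 s, (zeroSet u l r t).encard = N) : (zeroSet u l r s).encard ≤ N := by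
  have hsub : Icc a0 s ⊆ Icc 0 T := Icc_subset_Icc ha.le hs.le
  have hc1 : ContinuousOn (fun t => u (l t) t) (Icc 0 T) :=
    h.pre.loc.time h.pre.loc.lc fun t ht => ⟨le_rfl, h.pre.loc.lr t ht⟩
  have hc2 : ContinuousOn (fun t => u (r t) t) (Icc 0 T) :=
    h.pre.loc.time h.pre.loc.rc fun t ht => ⟨h.pre.loc.lr t ht, le_rfl⟩
  obtain ⟨pL, hL, hL'⟩ := ext_or has (hc1.mono hsub) (LSl h ha hs hZ)
  obtain ⟨pR, hR, hR'⟩ := ext_or has (hc2.mono hsub) (LSr h ha hs has hZ)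
  have hloc : LocSol M l r a0 s u := h.pre.restr ha.le hs.le (h.pre.lc ha.le hs.le) (h.pre.rc ha.le hs.le) (fun _ _ => le_rfl)
    (fun t ht => h.pre.loc.lr t (hsub ht)) (fun _ _ => le_rfl)
  refine L2count h.pre ⟨ha.trans has, hs⟩ ?_ has (fun t ht => (hZ t ht).le)
  intro a b h1 h2 h3
  by_contra hcon
  push Not at hcon
  exact L1 hloc (fun t ht => h.pre.lr t (hsub ht)) has hL hR hL' hR' (fun t ht => (hZ t ht).le)
    (α := (2 * a + b) / 3) (β := (a + 2 * b) / 3) (by linarith) (by linarith) (by linarith)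
    (fun x hx => hcon x ⟨by linarith [hx.1], by linarith [hx.2]⟩)

lemma final_ind {M T l r u} (h : Prob M T l r u) : ∀ N : ℕ, ∀ a0 b0 : ℝ, 0 < a0 → a0 ≤ b0 → b0 < T →
    (zeroSet u l r a0).encard = N → (zeroSet u l r b0).encard ≤ N := by
  intro N
  induction N using Nat.strong_induction_on with
  | _ N ih =>
  intro a0 b0 ha hab hb hN
  by_contra hbad
  set S := {t ∈ Icc a0 b0 | ¬ (zeroSet u l r t).encard ≤ N} with hS
  have hbS : b0 ∈ S := ⟨⟨hab, le_rfl⟩, hbad⟩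
  have hbdd : BddBelow S := ⟨a0, fun x hx => hx.1.1⟩
  set c := sInf S with hc
  have hac : a0 ≤ c := le_csInf ⟨b0, hbS⟩ fun x hx => hx.1.1
  have hcb : c ≤ b0 := csInf_le hbdd hbS
  have hlt : ∀ t ∈ Ico a0 c, (zeroSet u l r t).encard ≤ N := by
    intro t ht
    by_contra hcon
    have : t ∈ S := ⟨⟨ht.1, ht.2.le.trans hcb⟩, hcon⟩
    linarith [csInf_le hbdd this, ht.2]
  have heq : ∀ t ∈ Ico a0 c, (zeroSet u l r t).encard = N := by
    intro t ht
    refine le_antisymm (hlt t ht) ?_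
    by_contra hcon
    push Not at hcon
    obtain ⟨m, hm⟩ := ENat.ne_top_iff_exists.mp (ne_top_of_lt hcon)
    rw [← hm] at hcon
    have hmN : m < N := by exact_mod_cast hcon
    have := ih m hmN t b0 (ha.trans_le ht.1) (ht.2.le.trans hcb) hb hm.symm
    exact hbad (this.trans (by exact_mod_cast hmN.le))
  have hcN : (zeroSet u l r c).encard ≤ N := by
    rcases hac.eq_or_lt with heq' | hlt'
    · rw [← heq', hN]
    · exact stepL h ha (hcb.trans_lt hb) hlt' heq
  have hcT : c ∈ Ioo 0 T := ⟨ha.trans_le hac, hcb.trans_lt hb⟩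
  have hfin : (zeroSet u l r c).Finite := Set.finite_of_encard_le_coe hcN
  have hR := stepR h hcT hfin
  obtain ⟨d, hd, hd'⟩ := mem_nhdsGT_iff_exists_Ioo_subset.mp hR
  have hcd : c < d := hd
  obtain ⟨t, htS, htd⟩ := exists_lt_of_csInf_lt ⟨b0, hbS⟩ hcd
  rcases (csInf_le hbdd htS).eq_or_lt with h1 | h1
  · rw [← hc] at h1
    exact htS.2 (by rw [← h1]; exact hcN)
  · obtain ⟨f, f1, f2, _⟩ := hd' ⟨h1, htd⟩
    exact htS.2 ((Set.encard_le_encard_of_injOn f1 f2).trans hcN)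

lemma main_prob
    (T : ℝ) (xi1 xi2 : ℝ → ℝ) (a b c u : ℝ → ℝ → ℝ)
    (hxc1 : ContinuousOn xi1 (Icc 0 T)) (hxc2 : ContinuousOn xi2 (Icc 0 T))
    (hxlt : ∀ t ∈ Icc (0:ℝ) T, xi1 t < xi2 t)
    (hsol : IsClassicalSolution a b c xi1 xi2 T u)
    (hreg : Reg12 a b c xi1 xi2 T)
    (hH2a : ∀ s ∈ Ioo (0:ℝ) T, IsNZstar (bdryTrace u xi1) s → H2at u xi1 (-1) s)
    (hH2b : ∀ s ∈ Ioo (0:ℝ) T, IsNZstar (bdryTrace u xi2) s → H2at u xi2 1 s)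
    (hH3a : ∀ s ∈ Ioo (0:ℝ) T, bdryTrace u xi1 s = 0 → H3at u xi1 xi2 xi1 (-1) s)
    (hH3b : ∀ s ∈ Ioo (0:ℝ) T, bdryTrace u xi2 s = 0 → H3at u xi1 xi2 xi2 1 s) :
    ∃ M, Prob M T xi1 xi2 u := by
  obtain ⟨M, hM⟩ := hreg
  refine ⟨max 1 M, ⟨⟨⟨le_max_left _ _, hxc1, hxc2, fun t ht => (hxlt t ht).le, hsol.cont, ?_⟩,
    hxlt, ?_, ?_, ?_, ?_, ?_, ?_⟩, ?_, ?_⟩⟩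
  · intro t ht x hx
    have hp : ((x, t) : ℝ × ℝ) ∈ domLat xi1 xi2 T := ⟨ht, Ioo_subset_Icc_self hx⟩
    obtain ⟨h0, -, -, -, -, -, h1, h2, -, -, -, h3, -, -, h4⟩ := hM _ hp
    simp only at h0 h1 h2 h3 h4
    refine ⟨?_, hsol.diff_xx _ hp, hsol.diff_t _ hp, a x t, b x t, c x t, ⟨?_, ?_, ?_, ?_⟩, hsol.eqn _ hp⟩
    · filter_upwards [Ioo_mem_nhds hx.1 hx.2] with y hy
      exact hsol.diff_x (y, t) ⟨ht, Ioo_subset_Icc_self hy⟩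
    · have h5 : (a x t)⁻¹ ≤ max 1 M := (le_abs_self _).trans (h2.trans (le_max_right _ _))
      rw [one_div]
      exact inv_le_of_inv_le₀ h0 h5
    · exact (le_abs_self _).trans (h1.trans (le_max_right _ _))
    · exact h3.trans (le_max_right _ _)
    · exact h4.trans (le_max_right _ _)
  · intro t ht
    exact hsol.diff_x (xi1 t, t) ⟨Ioo_subset_Ioc_self ht, le_rfl, (hxlt t (Ioo_subset_Icc_self ht)).le⟩
  · intro t ht
    exact hsol.diff_x (xi2 t, t) ⟨Ioo_subset_Ioc_self ht, (hxlt t (Ioo_subset_Icc_self ht)).le, le_rfl⟩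
  · intro s hs h0 hp
    obtain ⟨hd, h1, h2⟩ := hH2a s hs ⟨h0, by obtain ⟨e, he, h⟩ := hp; exact ⟨e, he, fun t ht => (h t ht).ne'⟩⟩
    exact ⟨hd, by linarith [h1 hp]⟩
  · intro s hs h0 hp
    have h0' : u (xi1 s) s = 0 := neg_eq_zero.1 h0
    have hn : ∃ ε > 0, ∀ t ∈ Ioo (s - ε) s, u (xi1 t) t < 0 := by
      obtain ⟨e, he, h⟩ := hp
      exact ⟨e, he, fun t ht => neg_pos.1 (h t ht)⟩
    obtain ⟨hd, h1, h2⟩ := hH2a s hs ⟨h0', by obtain ⟨e, he, h⟩ := hn; exact ⟨e, he, fun t ht => (h t ht).ne⟩⟩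
    refine ⟨hd, ?_⟩
    rw [pdx_neg]
    linarith [h2 hn]
  · intro s hs h0 hp
    simp only [neg_neg] at h0 hp
    obtain ⟨⟨L, hd⟩, h1, h2⟩ := hH2b s hs ⟨h0, by obtain ⟨e, he, h⟩ := hp; exact ⟨e, he, fun t ht => (h t ht).ne'⟩⟩
    refine ⟨⟨-L, hd.fun_neg⟩, ?_⟩
    rw [pdx_refl, neg_neg]
    linarith [h1 hp]
  · intro s hs h0 hp
    simp only [neg_neg] at h0 hp
    have h0' : u (xi2 s) s = 0 := neg_eq_zero.1 h0
    have hn : ∃ ε > 0, ∀ t ∈ Ioo (s - ε) s, u (xi2 t) t < 0 := by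
      obtain ⟨e, he, h⟩ := hp
      exact ⟨e, he, fun t ht => neg_pos.1 (h t ht)⟩
    obtain ⟨⟨L, hd⟩, h1, h2⟩ := hH2b s hs ⟨h0', by obtain ⟨e, he, h⟩ := hn; exact ⟨e, he, fun t ht => (h t ht).ne⟩⟩
    refine ⟨⟨-L, hd.fun_neg⟩, ?_⟩
    have h3 : pdx (fun x t => -u (-x) t) (-xi2 s) s = -pdx (fun x t => u (-x) t) (-xi2 s) s := pdx_neg ..
    rw [h3, pdx_refl, neg_neg, neg_neg]
    linarith [h2 hn]
  · intro s hs h0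
    obtain ⟨e, he, d, hd, h⟩ := hH3a s hs h0
    refine ⟨e, he, d, hd, fun t ht x h1 h2 h3 => ?_⟩
    have := h t ht x ⟨h1.le, h2⟩ h1.ne' (by rw [abs_lt]; constructor <;> linarith)
    linarith
  · intro s hs h0
    obtain ⟨e, he, d, hd, h⟩ := hH3b s hs h0
    refine ⟨e, he, d, hd, fun t ht x h1 h2 h3 => ?_⟩
    have := h t ht x ⟨h2, h1.le⟩ h1.ne (by rw [abs_lt]; constructor <;> linarith)
    linarith

lemma main_fin {M T l r u} (h : Prob M T l r u) {a0 b0 : ℝ} (ha : 0 < a0) (hab : a0 ≤ b0) (hb : b0 < T) :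
    Znum u l r b0 ≤ Znum u l r a0 := by
  by_cases ht : (zeroSet u l r a0).encard = ⊤
  · exact (le_top).trans_eq ht.symm
  · obtain ⟨N, hN⟩ := ENat.ne_top_iff_exists.1 ht
    have := final_ind h N a0 b0 ha hab hb hN.symm
    exact this.trans_eq hN

end Helpers

/-- Theorem 1.2(ii): for moving boundaries satisfying (H1)-(H3), `Z(t)` is
non-increasing in `t ∈ (0,T)`. -/
theorem main_zero_number_nonincreasing
    (T : ℝ) (xi1 xi2 : ℝ → ℝ) (a b c u : ℝ → ℝ → ℝ)
    (hT : 0 < T)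
    (hxc1 : ContinuousOn xi1 (Icc 0 T)) (hxc2 : ContinuousOn xi2 (Icc 0 T))
    (hxlt : ∀ t ∈ Icc (0:ℝ) T, xi1 t < xi2 t)
    (hsol : IsClassicalSolution a b c xi1 xi2 T u)
    (hreg : Reg12 a b c xi1 xi2 T)
    (hnz : ∀ t ∈ Icc (0:ℝ) T, ∃ x ∈ Icc (xi1 t) (xi2 t), u x t ≠ 0)
    (hH1a : H1cond (bdryTrace u xi1) xi1 T) (hH1b : H1cond (bdryTrace u xi2) xi2 T)
    (hH2a : ∀ s ∈ Ioo (0:ℝ) T, IsNZstar (bdryTrace u xi1) s → H2at u xi1 (-1) s)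
    (hH2b : ∀ s ∈ Ioo (0:ℝ) T, IsNZstar (bdryTrace u xi2) s → H2at u xi2 1 s)
    (hH3a : ∀ s ∈ Ioo (0:ℝ) T, bdryTrace u xi1 s = 0 → H3at u xi1 xi2 xi1 (-1) s)
    (hH3b : ∀ s ∈ Ioo (0:ℝ) T, bdryTrace u xi2 s = 0 → H3at u xi1 xi2 xi2 1 s) :
    ∀ t₁ ∈ Ioo (0:ℝ) T, ∀ t₂ ∈ Ioo (0:ℝ) T, t₁ ≤ t₂ →
      Znum u xi1 xi2 t₂ ≤ Znum u xi1 xi2 t₁ := by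
  obtain ⟨M, hP⟩ := main_prob T xi1 xi2 a b c u hxc1 hxc2 hxlt hsol hreg hH2a hH2b hH3a hH3b
  intro t₁ h₁ t₂ h₂ h₁₂
  exact main_fin hP h₁.1 h₁₂ h₂.2
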